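/- Let X be a finitely primitive countable Markov shift, φ: X → ℝ a measurable function and μ_φ a Gibbs state for the potential φ. For each n ≥ 1 let η_n = (1/Z_n(φ, Per_n(σ))) Σ_{x ∈ Per_n(σ)} exp(S_nφ(x)) δ_{δ_x^n}, where Per_n(σ) = {x ∈ X : σ^n x = x} and δ_{δ_x^n} is the unit point mass at δ_x^n. Then {η_n} is exponentially tight and satisfies the Large Deviation Principle with the convex good rate function I(μ) = -inf_{G ∋ μ} sup_G F (infimum over open G ⊂ M containing μ). -/

import Mathlib

open MeasureTheory Filter Topology Set
open scoped ENNReal NNReal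

namespace CMS

/-! ### Generic dynamical notions -/

variable {X : Type*}

/-- Birkhoff sum `S_n φ`. -/
noncomputable def birkhoff (T : X → X) (φ : X → ℝ) (n : ℕ) (x : X) : ℝ :=
  ∑ i ∈ Finset.range n, φ (T^[i] x)

/-- A measure is invariant under `T`. -/
def Invariant [MeasurableSpace X] (T : X → X) (μ : Measure X) : Prop :=
  Measure.map T μ = μ

/-- `∫ φ dμ > -∞`, i.e. the negative part of `φ` is integrable. -/
def IntegralGtBot [MeasurableSpace X] (φ : X → ℝ) (μ : Measure X) : Prop :=
  (∫⁻ x, ENNReal.ofReal (-φ x) ∂μ) ≠ ⊤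

/-- The integral of `φ`, with values in `EReal` (defined whenever one of the parts is finite). -/
noncomputable def eintegral [MeasurableSpace X] (φ : X → ℝ) (μ : Measure X) : EReal :=
  ((∫⁻ x, ENNReal.ofReal (φ x) ∂μ : ℝ≥0∞) : EReal) -
    ((∫⁻ x, ENNReal.ofReal (-φ x) ∂μ : ℝ≥0∞) : EReal)

/-- Entropy of the countable partition induced by a map `g` with countable range. -/
noncomputable def partitionEntropy [MeasurableSpace X] {α : Type*} (μ : Measure X) (g : X → α) :
    ℝ≥0∞ :=
  ∑' a : α, ENNReal.ofReal (-((μ (g ⁻¹' {a})).toReal * Real.log ((μ (g ⁻¹' {a})).toReal)))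

/-- Kolmogorov–Sinaĭ entropy of `T` with respect to `μ`: the supremum over finite measurable
partitions (coded by maps `X → ℕ` with finite range) of the asymptotic entropy of iterated
joins of the partition. -/
noncomputable def entropy [MeasurableSpace X] (T : X → X) (μ : Measure X) : ℝ≥0∞ :=
  ⨆ (p : X → ℕ) (_ : Measurable p ∧ (Set.range p).Finite),
    atTop.liminf fun n : ℕ =>
      ENNReal.ofReal ((n : ℝ)⁻¹) * partitionEntropy μ (fun x => fun i : Fin n => p (T^[i] x))

/-- The empirical measure `δ_x^n = (1/n) ∑_{i<n} δ_{T^i x}` (with junk convention `n = 0 ↦ n = 1`,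
irrelevant since only `n ≥ 1` is ever used). -/
noncomputable def empirical [MeasurableSpace X] (T : X → X) (x : X) (n : ℕ) :
    ProbabilityMeasure X :=
  ⟨((max n 1 : ℕ) : ℝ≥0∞)⁻¹ • ∑ i ∈ Finset.range (max n 1), Measure.dirac (T^[i] x), by
    refine ⟨?_⟩
    have h1 : (∑ i ∈ Finset.range (max n 1), Measure.dirac (T^[i] x)) Set.univ
        = ((max n 1 : ℕ) : ℝ≥0∞) := by
      rw [Measure.finset_sum_apply]
      simp
    rw [Measure.smul_apply, h1, smul_eq_mul, ENNReal.inv_mul_cancel] <;> simp⟩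

noncomputable instance [MeasurableSpace X] [TopologicalSpace X] [OpensMeasurableSpace X] :
    MeasurableSpace (ProbabilityMeasure X) := borel _

/-- Sets of periodic points. -/
def perSet (T : X → X) (n : ℕ) : Set X := {x | T^[n] x = x}

/-- Sets of iterated preimages of a point. -/
def preimSet (T : X → X) (n : ℕ) (y : X) : Set X := {x | T^[n] x = y}

/-- The partition function `Z_n(φ, C)` over a subset `C`. -/
noncomputable def Zfn [MeasurableSpace X] (T : X → X) (φ : X → ℝ) (n : ℕ) (C : Set X) : ℝ≥0∞ :=
  ∑' x : C, ENNReal.ofReal (Real.exp (birkhoff T φ n x))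

/-- The distribution of the empirical measures under `μ`. -/
noncomputable def empDistr [MeasurableSpace X] [TopologicalSpace X] [OpensMeasurableSpace X]
    (T : X → X) (μ : Measure X) (n : ℕ) : Measure (ProbabilityMeasure X) :=
  Measure.map (fun x => empirical T x n) μ

/-- The distribution `Z_n(φ,C)⁻¹ ∑_{x ∈ C} e^{S_nφ(x)} δ_{δ_x^n}` on the space of probability
measures, for a countable set `C` (of weighted periodic points or iterated preimages). -/
noncomputable def weightedDistr [MeasurableSpace X] [TopologicalSpace X] [OpensMeasurableSpace X]
    (T : X → X) (φ : X → ℝ) (n : ℕ) (C : Set X) : Measure (ProbabilityMeasure X) :=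
  (Zfn T φ n C)⁻¹ •
    Measure.sum (fun x : C =>
      ENNReal.ofReal (Real.exp (birkhoff T φ n x)) • Measure.dirac (empirical T (x : X) n))

/-! ### Large deviations notions -/

variable {Y : Type*}

/-- The large deviation principle for a sequence of (sub)probability measures with rate
function `J`. -/
def HasLDP [TopologicalSpace Y] [MeasurableSpace Y] (μ : ℕ → Measure Y) (J : Y → EReal) : Prop :=
  (∀ G : Set Y, IsOpen G →
      -(⨅ y ∈ G, J y) ≤
        atTop.liminf fun n : ℕ => (((n : ℝ)⁻¹ : ℝ) : EReal) * ENNReal.log (μ n G)) ∧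
  (∀ K : Set Y, IsClosed K →
      atTop.limsup (fun n : ℕ => (((n : ℝ)⁻¹ : ℝ) : EReal) * ENNReal.log (μ n K)) ≤
        -(⨅ y ∈ K, J y))

/-- Exponential tightness of a sequence of measures. -/
def ExpTight [TopologicalSpace Y] [MeasurableSpace Y] (μ : ℕ → Measure Y) : Prop :=
  ∀ L : ℝ, 0 < L → ∃ K : Set Y, IsCompact K ∧
    atTop.limsup (fun n : ℕ => (((n : ℝ)⁻¹ : ℝ) : EReal) * ENNReal.log (μ n Kᶜ)) ≤ ((-L : ℝ) : EReal)

/-- A good rate function: lower semicontinuous with compact sublevel sets. -/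
def GoodRate [TopologicalSpace Y] (J : Y → EReal) : Prop :=
  LowerSemicontinuous J ∧ ∀ α : ℝ, 0 ≤ α → IsCompact {y | J y ≤ (α : EReal)}

/-- The rate function `I(μ) = - inf_{G ∋ μ} sup_G F`. -/
noncomputable def rateOf [TopologicalSpace Y] (F : Y → EReal) (μ : Y) : EReal :=
  -(⨅ (G : Set Y) (_ : IsOpen G ∧ μ ∈ G), ⨆ ν ∈ G, F ν)

/-- The convex combination `t μ + (1-t) ν` of two probability measures. -/
noncomputable def mix [MeasurableSpace X] (t : ℝ) (h0 : 0 ≤ t) (h1 : t ≤ 1)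
    (μ ν : ProbabilityMeasure X) : ProbabilityMeasure X :=
  ⟨ENNReal.ofReal t • (μ : Measure X) + ENNReal.ofReal (1 - t) • (ν : Measure X), by
    refine ⟨?_⟩
    simp only [Measure.add_apply, Measure.smul_apply, smul_eq_mul, measure_univ, mul_one]
    rw [← ENNReal.ofReal_add h0 (by linarith)]
    norm_num⟩

/-- Convexity of a rate function on probability measures. -/
def ConvexRate [MeasurableSpace X] (J : ProbabilityMeasure X → EReal) : Prop :=
  ∀ μ ν : ProbabilityMeasure X, ∀ t : ℝ, ∀ (h0 : 0 ≤ t) (h1 : t ≤ 1),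
    J (mix t h0 h1 μ ν) ≤ ((t : ℝ) : EReal) * J μ + ((1 - t : ℝ) : EReal) * J ν

-- The free energy functional `F`.
open Classical in
noncomputable def freeEnergy [MeasurableSpace X] (T : X → X) (φ : X → ℝ) (P : ℝ)
    (ν : ProbabilityMeasure X) : EReal :=
  if Invariant T (ν : Measure X) ∧ IntegralGtBot φ (ν : Measure X)
  then ((entropy T (ν : Measure X) : ℝ≥0∞) : EReal) + eintegral φ (ν : Measure X) - ((P : ℝ) : EReal)
  else ⊥

/-! ### Countable Markov shifts -/

variable {S : Type*}

/-- The topological Markov shift with alphabet `S` and transition relation `A`. -/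
def Space (A : S → S → Prop) : Type _ := {x : ℕ → S // ∀ i, A (x i) (x (i + 1))}

variable (A : S → S → Prop)

instance [TopologicalSpace S] : TopologicalSpace (Space A) :=
  inferInstanceAs (TopologicalSpace {x : ℕ → S // ∀ i, A (x i) (x (i + 1))})

noncomputable instance [TopologicalSpace S] : MeasurableSpace (Space A) := borel _

instance [TopologicalSpace S] : BorelSpace (Space A) := ⟨rfl⟩

/-- The left shift. -/
def shift : Space A → Space A := fun x => ⟨fun i => x.1 (i + 1), fun i => x.2 (i + 1)⟩

/-- Admissible words. -/
def Admissible (w : List S) : Prop := w ≠ [] ∧ w.Chain' A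

/-- The cylinder set of a word. -/
def cylinder (w : List S) : Set (Space A) := {x | ∀ i : Fin w.length, x.1 i = w.get i}

variable {A}

/-- The initial word of length `n` of a point. -/
def word (x : Space A) (n : ℕ) : List S := List.ofFn (fun i : Fin n => x.1 i)

variable (A)

/-- `μ` is a Gibbs state for the potential `φ` with constants `c₀` and `P`. -/
def IsGibbsWith [TopologicalSpace S] (φ : Space A → ℝ) (μ : Measure (Space A)) (c₀ P : ℝ) :
    Prop :=
  ∀ n : ℕ, 1 ≤ n → ∀ x : Space A,
    c₀⁻¹ * Real.exp (-(P * n) + birkhoff (shift A) φ n x)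
        ≤ (μ (cylinder A (word x n))).toReal ∧
      (μ (cylinder A (word x n))).toReal
        ≤ c₀ * Real.exp (-(P * n) + birkhoff (shift A) φ n x)

/-- `μ` is a Gibbs state for `φ`. -/
def IsGibbs [TopologicalSpace S] (φ : Space A → ℝ) (μ : Measure (Space A)) : Prop :=
  ∃ c₀ P : ℝ, 1 ≤ c₀ ∧ IsGibbsWith A φ μ c₀ P

/-- The transition matrix has no row or column identically zero. -/
def NoZeroRowCol : Prop := (∀ a : S, ∃ b, A a b) ∧ ∀ b : S, ∃ a, A a b

/-- Finite irreducibility. -/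
def FinitelyIrreducible : Prop :=
  ∃ Λ : Finset (List S), ∀ v w : List S, Admissible A v → Admissible A w →
    ∃ l ∈ Λ, Admissible A (v ++ l ++ w)

/-- Finite primitiveness. -/
def FinitelyPrimitive : Prop :=
  ∃ Λ : Finset (List S), (∃ N : ℕ, ∀ l ∈ Λ, l.length = N) ∧
    ∀ v w : List S, Admissible A v → Admissible A w →
      ∃ l ∈ Λ, Admissible A (v ++ l ++ w)

/-- Topological transitivity. -/
def TopTransitive : Prop :=
  ∀ a b : S, ∃ n : ℕ, 1 ≤ n ∧
    (cylinder A [a] ∩ (shift A)^[n] ⁻¹' (cylinder A [b])).Nonempty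

/-- Varadhan's functional `Q(ψ) = sup_μ (∫ψ dμ - I(μ))`. -/
noncomputable def varQ {X : Type*} [MeasurableSpace X] (I : ProbabilityMeasure X → EReal)
    (ψ : X → ℝ) : EReal :=
  ⨆ μ : ProbabilityMeasure X, (((∫ x, ψ x ∂(μ : Measure X)) : ℝ) : EReal) - I μ

/-- `φ` is uniformly continuous for the standard metric of the shift space. -/
def UnifCont (φ : Space A → ℝ) : Prop :=
  ∀ ε : ℝ, 0 < ε → ∃ N : ℕ, ∀ x y : Space A, (∀ i < N, x.1 i = y.1 i) → |φ x - φ y| ≤ ε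

/-- `φ` is bounded. -/
def Bdd (φ : Space A → ℝ) : Prop := ∃ C : ℝ, ∀ x : Space A, |φ x| ≤ C

end CMS

namespace CMS

set_option linter.unusedSectionVars false

section Topology

variable {S : Type*} [TopologicalSpace S] {A : S → S → Prop}

instance [T2Space S] : T2Space (Space A) :=
  inferInstanceAs (T2Space {x : ℕ → S // ∀ i, A (x i) (x (i + 1))})

lemma isEmbedding_val : IsEmbedding (fun x : Space A => x.1) := IsEmbedding.subtypeVal

instance [DiscreteTopology S] : TopologicalSpace.MetrizableSpace (Space A) :=
  isEmbedding_val.metrizableSpace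

lemma continuous_apply (i : ℕ) : Continuous fun x : Space A => x.1 i :=
  (_root_.continuous_apply i).comp isEmbedding_val.continuous

lemma continuous_of_coord {Z : Type*} [TopologicalSpace Z] {f : Z → Space A}
    (h : ∀ i, Continuous fun z => (f z).1 i) : Continuous f :=
  isEmbedding_val.continuous_iff.2 (continuous_pi h)

lemma continuous_shift : Continuous (shift A) :=
  continuous_of_coord fun i => continuous_apply (i + 1)

lemma measurable_shift : Measurable (shift A) := continuous_shift.measurable

lemma shift_iterate_apply (x : Space A) (n i : ℕ) : ((shift A)^[n] x).1 i = x.1 (n + i) := by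
  induction n generalizing i with
  | zero => simp
  | succ n ih =>
    rw [Function.iterate_succ_apply']
    change ((shift A)^[n] x).1 (i + 1) = _
    rw [ih, Nat.succ_add_eq_add_succ, add_comm i 1, Nat.succ_eq_add_one, add_comm i 1]

lemma ext_coord {x y : Space A} (h : ∀ i, x.1 i = y.1 i) : x = y := Subtype.ext (funext h)

/-- A set of points which is determined by the first `n` coordinates. -/
def Determined (n : ℕ) (U : Set (Space A)) : Prop :=
  ∀ x y : Space A, (∀ i < n, x.1 i = y.1 i) → x ∈ U → y ∈ U

lemma Determined.mono {n m : ℕ} (h : n ≤ m) {U : Set (Space A)} (hU : Determined n U) :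
    Determined m U :=
  fun x y hxy hx => hU x y (fun i hi => hxy i (hi.trans_le h)) hx

lemma Determined.compl {n : ℕ} {U : Set (Space A)} (hU : Determined n U) : Determined n Uᶜ :=
  fun x y hxy hx hy => hx (hU y x (fun i hi => (hxy i hi).symm) hy)

lemma Determined.union {n : ℕ} {U V : Set (Space A)} (hU : Determined n U)
    (hV : Determined n V) : Determined n (U ∪ V) :=
  fun x y hxy hx => hx.imp (hU x y hxy) (hV x y hxy)

/-- The set of points sharing their first `n` coordinates with `x`. -/
def cyl (x : Space A) (n : ℕ) : Set (Space A) := {y | ∀ i < n, y.1 i = x.1 i}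

lemma cylinder_word (x : Space A) (n : ℕ) : cylinder A (word x n) = cyl x n := by
  ext y
  simp only [cylinder, cyl, word, mem_ofPred_eq]
  constructor
  · intro h i hi
    have := h ⟨i, by simpa using hi⟩
    simpa using this
  · intro h i
    have hi : (i : ℕ) < n := by simpa using i.2
    simpa using h i hi

lemma mem_cyl_self (x : Space A) (n : ℕ) : x ∈ cyl x n := fun _ _ => rfl

lemma cyl_congr {x y : Space A} {n : ℕ} (h : ∀ i < n, x.1 i = y.1 i) : cyl x n = cyl y n := by
  ext z
  exact forall₂_congr fun i hi => by rw [h i hi]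

lemma determined_cylinder (w : List S) : Determined w.length (cylinder A w) :=
  fun _ _ h hy i => (h i i.2).symm.trans (hy i)

variable [DiscreteTopology S]

lemma isOpen_cyl (x : Space A) (n : ℕ) : IsOpen (cyl x n) := by
  have : cyl x n = ⋂ i ∈ Finset.range n, (fun y : Space A => y.1 i) ⁻¹' {x.1 i} := by
    ext y; simp [cyl]
  rw [this]
  exact isOpen_biInter_finset fun i _ => (isOpen_discrete _).preimage (continuous_apply i)

lemma Determined.isOpen {n : ℕ} {U : Set (Space A)} (hU : Determined n U) : IsOpen U := by
  rw [isOpen_iff_mem_nhds]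
  intro x hx
  exact Filter.mem_of_superset ((isOpen_cyl x n).mem_nhds (mem_cyl_self x n))
    fun y hy => hU x y (fun i hi => (hy i hi).symm) hx

lemma Determined.isClopen {n : ℕ} {U : Set (Space A)} (hU : Determined n U) : IsClopen U :=
  ⟨⟨hU.compl.isOpen⟩, hU.isOpen⟩

lemma Determined.measurableSet {n : ℕ} {U : Set (Space A)} (hU : Determined n U) :
    MeasurableSet U := hU.isOpen.measurableSet

lemma measurableSet_cyl (x : Space A) (n : ℕ) : MeasurableSet (cyl x n) :=
  (isOpen_cyl x n).measurableSet

lemma exists_cyl_subset {G : Set (Space A)} (hG : IsOpen G) {x : Space A} (hx : x ∈ G) :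
    ∃ n, cyl x n ⊆ G := by
  obtain ⟨V, hV, rfl⟩ := isEmbedding_val.isOpen_iff.1 hG
  obtain ⟨I, u, hu, hIu⟩ := isOpen_pi_iff.1 hV _ hx
  refine ⟨I.sup id + 1, fun y hy => hIu ?_⟩
  intro i hi
  have : y.1 i = x.1 i := hy i (Nat.lt_succ_of_le (Finset.le_sup (f := id) hi))
  change y.1 i ∈ u i
  rw [this]; exact (hu i hi).2

variable [Countable S]

/-- Open sets are countable unions of cylinders. -/
lemma isOpen_eq_iUnion_cylinder {G : Set (Space A)} (hG : IsOpen G) :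
    G = ⋃ w ∈ {w : List S | cylinder A w ⊆ G}, cylinder A w := by
  ext x
  simp only [mem_iUnion, exists_prop]
  constructor
  · intro hx
    obtain ⟨n, hn⟩ := exists_cyl_subset hG hx
    exact ⟨word x n, by rwa [mem_ofPred_eq, cylinder_word], by
      rw [cylinder_word]; exact mem_cyl_self x n⟩
  · rintro ⟨w, hw, hx⟩
    exact hw hx

/-- Weak neighbourhoods contain neighbourhoods given by finitely many sets depending on finitely
many coordinates. -/
lemma exists_determined_nhds {G : Set (ProbabilityMeasure (Space A))} (hG : IsOpen G)
    {ν : ProbabilityMeasure (Space A)} (hν : ν ∈ G) :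
    ∃ (l : ℕ) (D : Finset (Set (Space A))) (ε : ℝ), 0 < ε ∧ (∀ U ∈ D, Determined l U) ∧
      ∀ ξ : ProbabilityMeasure (Space A),
        (∀ U ∈ D, (ν : Measure (Space A)).real U - ε < (ξ : Measure (Space A)).real U) →
          ξ ∈ G := by
  classical
  obtain ⟨e, he⟩ := exists_surjective_nat (Finset (List S))
  let U : ℕ → Set (Space A) := fun j => ⋃ w ∈ e j, cylinder A w
  have hU : ∀ j, ∃ l, Determined l (U j) := fun j => by
    refine ⟨(e j).sup List.length, fun x y hxy hx => ?_⟩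
    simp only [U, mem_iUnion] at hx ⊢
    obtain ⟨w, hw, hx⟩ := hx
    exact ⟨w, hw, (determined_cylinder w).mono (Finset.le_sup hw) x y hxy hx⟩
  choose l hl using hU
  by_contra! hcon
  have h1 : ∀ j : ℕ, ∃ ξ : ProbabilityMeasure (Space A), (∀ i < j,
      (ν : Measure (Space A)).real (U i) - ((j : ℝ) + 1)⁻¹ <
        (ξ : Measure (Space A)).real (U i)) ∧ ξ ∉ G := fun j => by
    obtain ⟨ξ, hξ, hξG⟩ := hcon ((Finset.range j).sup l) ((Finset.range j).image U)
      (((j : ℝ) + 1)⁻¹) (by positivity) (by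
        simp only [Finset.mem_image, Finset.mem_range, forall_exists_index, and_imp]
        rintro _ i hi rfl
        exact (hl i).mono (Finset.le_sup (Finset.mem_range.2 hi)))
    exact ⟨ξ, fun i hi => hξ _ (Finset.mem_image_of_mem _ (Finset.mem_range.2 hi)), hξG⟩
  choose ξ hξ hξG using h1
  have hlim : Tendsto ξ atTop (𝓝 ν) := by
    refine tendsto_of_forall_isOpen_le_liminf_nat' fun V hV => ?_
    have hlow : ∀ j, U j ⊆ V → (ν : Measure (Space A)) (U j) ≤
        liminf (fun i => (ξ i : Measure (Space A)) V) atTop := by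
      intro j hj
      have ht : Tendsto (fun i : ℕ => ENNReal.ofReal
          ((ν : Measure (Space A)).real (U j) - ((i : ℝ) + 1)⁻¹)) atTop
          (𝓝 ((ν : Measure (Space A)) (U j))) := by
        have h0 : Tendsto (fun i : ℕ => ((i : ℝ) + 1)⁻¹) atTop (𝓝 0) := by
          simpa using tendsto_one_div_add_atTop_nhds_zero_nat (𝕜 := ℝ)
        have := ENNReal.tendsto_ofReal (h0.const_sub ((ν : Measure (Space A)).real (U j)))
        simpa [ofReal_measureReal] using this
      rw [← ht.liminf_eq]
      refine liminf_le_liminf ?_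
      filter_upwards [eventually_gt_atTop j] with i hi
      calc _ ≤ ENNReal.ofReal ((ξ i : Measure (Space A)).real (U j)) :=
            ENNReal.ofReal_le_ofReal (hξ i j hi).le
        _ = (ξ i : Measure (Space A)) (U j) := ofReal_measureReal (measure_ne_top _ _)
        _ ≤ _ := measure_mono hj
    let W : Set (List S) := {w | cylinder A w ⊆ V}
    have hcover : V = ⋃ T : Finset W, ⋃ w ∈ T, cylinder A w.1 := by
      conv_lhs => rw [isOpen_eq_iUnion_cylinder hV]
      ext x
      simp only [mem_iUnion]
      constructor
      · rintro ⟨w, hw, hx⟩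
        exact ⟨{⟨w, hw⟩}, ⟨w, hw⟩, by simp, hx⟩
      · rintro ⟨T, w, hw, hx⟩
        exact ⟨w.1, w.2, hx⟩
    rw [hcover]
    have hdir : Directed (· ⊆ ·) fun T : Finset W => ⋃ w ∈ T, cylinder A w.1 := by
      refine Monotone.directed_le ?_
      intro T T' hT
      exact biUnion_subset_biUnion_left hT
    rw [hdir.measure_iUnion, ← hcover]
    refine iSup_le fun T => ?_
    obtain ⟨j, hj⟩ := he (T.image Subtype.val)
    have hUj : U j = ⋃ w ∈ T, cylinder A w.1 := by
      simp only [U, hj]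
      ext x; simp
    rw [← hUj]
    refine hlow j ?_
    rw [hUj]
    exact iUnion₂_subset fun w _ => w.2
  obtain ⟨j, hj⟩ := (hlim.eventually (hG.mem_nhds hν)).exists
  exact hξG j hj

lemma continuous_real_determined {l : ℕ} {U : Set (Space A)} (hU : Determined l U) :
    Continuous fun ξ : ProbabilityMeasure (Space A) => (ξ : Measure (Space A)).real U := by
  rw [continuous_iff_continuousAt]
  intro ξ
  have := ProbabilityMeasure.tendsto_measure_of_null_frontier_of_tendsto' (μ := ξ)
    (μs := id) (L := 𝓝 ξ) tendsto_id (E := U) (by rw [hU.isClopen.frontier_eq]; simp)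
  exact (ENNReal.tendsto_toReal (measure_ne_top _ _)).comp this

end Topology

section Information

/-- The information content `-log x`, with values in `[0, ∞]`. -/
noncomputable def nlog (x : ℝ≥0∞) : ℝ≥0∞ :=
  if x = 0 then ⊤ else ENNReal.ofReal (-Real.log x.toReal)

lemma nlog_ofReal {r : ℝ} (hr : 0 < r) : nlog (ENNReal.ofReal r) = ENNReal.ofReal (-Real.log r) := by
  rw [nlog, if_neg (by simpa using hr), ENNReal.toReal_ofReal hr.le]

lemma nlog_one : nlog 1 = 0 := by simp [nlog]

lemma nlog_anti {x y : ℝ≥0∞} (h : x ≤ y) (hy : y ≠ ⊤) : nlog y ≤ nlog x := by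
  by_cases hx : x = 0
  · simp [nlog, hx]
  have hy0 : y ≠ 0 := fun h0 => hx (le_zero_iff.1 (h0 ▸ h))
  rw [nlog, nlog, if_neg hx, if_neg hy0]
  refine ENNReal.ofReal_le_ofReal (neg_le_neg (Real.log_le_log ?_ ?_))
  · exact ENNReal.toReal_pos hx (ne_top_of_le_ne_top hy h)
  · exact ENNReal.toReal_mono hy h

lemma nlog_mul_le {x y : ℝ≥0∞} (hx : x ≠ ⊤) (hy : y ≠ ⊤) : nlog (x * y) ≤ nlog x + nlog y := by
  by_cases hx0 : x = 0
  · simp [nlog, hx0]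
  by_cases hy0 : y = 0
  · simp [nlog, hy0]
  rw [nlog, nlog, nlog, if_neg hx0, if_neg hy0, if_neg (mul_ne_zero hx0 hy0), ENNReal.toReal_mul,
    Real.log_mul (ENNReal.toReal_pos hx0 hx).ne' (ENNReal.toReal_pos hy0 hy).ne', neg_add]
  exact ENNReal.ofReal_add_le

lemma nlog_prod_le {ι : Type*} (s : Finset ι) (f : ι → ℝ≥0∞) (hf : ∀ i ∈ s, f i ≠ ⊤) :
    nlog (∏ i ∈ s, f i) ≤ ∑ i ∈ s, nlog (f i) := by
  classical
  induction s using Finset.induction_on with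
  | empty => simp [nlog_one]
  | insert a s ha ih =>
    rw [Finset.prod_insert ha, Finset.sum_insert ha]
    have h1 : ∀ i ∈ s, f i ≠ ⊤ := fun i hi => hf i (Finset.mem_insert_of_mem hi)
    exact (nlog_mul_le (hf a (Finset.mem_insert_self a s)) (ENNReal.prod_ne_top h1)).trans
      (add_le_add le_rfl (ih h1))

lemma sum_nlog_le_nlog_prod {ι : Type*} (s : Finset ι) (f : ι → ℝ≥0∞) (hf : ∀ i ∈ s, f i ≤ 1) :
    ∑ i ∈ s, nlog (f i) ≤ nlog (∏ i ∈ s, f i) := by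
  by_cases h0 : ∏ i ∈ s, f i = 0
  · simp [nlog, h0]
  have h1 : ∀ i ∈ s, f i ≠ 0 := Finset.prod_ne_zero_iff.1 h0
  have h2 : ∀ i ∈ s, 0 < (f i).toReal := fun i hi =>
    ENNReal.toReal_pos (h1 i hi) (ne_top_of_le_ne_top ENNReal.one_ne_top (hf i hi))
  rw [nlog, if_neg h0, ENNReal.toReal_prod, Real.log_prod (fun i hi => (h2 i hi).ne'),
    ← Finset.sum_neg_distrib, ENNReal.ofReal_sum_of_nonneg]
  · exact Finset.sum_le_sum fun i hi => by rw [nlog, if_neg (h1 i hi)]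
  · intro i hi
    rw [neg_nonneg]
    exact Real.log_nonpos (h2 i hi).le (ENNReal.toReal_le_of_le_ofReal zero_le_one
      (by simpa using hf i hi))

lemma ofReal_neg_mul_log {x : ℝ≥0∞} (hx : x ≠ ⊤) :
    ENNReal.ofReal (-(x.toReal * Real.log x.toReal)) = x * nlog x := by
  by_cases hx0 : x = 0
  · simp [hx0]
  rw [nlog, if_neg hx0, neg_mul_eq_mul_neg, ENNReal.ofReal_mul ENNReal.toReal_nonneg,
    ENNReal.ofReal_toReal hx]

lemma mul_nlog_add_le {a b : ℝ≥0∞} (ha : a ≤ 1) (hb : b ≤ 1) :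
    a * nlog a + a ≤ a * nlog b + b := by
  by_cases ha0 : a = 0
  · simp [ha0]
  by_cases hb0 : b = 0
  · simp [nlog, hb0, ENNReal.mul_top ha0]
  have hat := ne_top_of_le_ne_top ENNReal.one_ne_top ha
  have hbt := ne_top_of_le_ne_top ENNReal.one_ne_top hb
  lift a to ℝ≥0 using hat
  lift b to ℝ≥0 using hbt
  have ha1 : 0 < (a : ℝ) := by
    have : a ≠ 0 := by exact_mod_cast ha0
    positivity
  have hb1 : 0 < (b : ℝ) := by
    have : b ≠ 0 := by exact_mod_cast hb0
    positivity
  have ha2 : (a : ℝ) ≤ 1 := by exact_mod_cast ha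
  have hb2 : (b : ℝ) ≤ 1 := by exact_mod_cast hb
  have e : ∀ c : ℝ≥0, (c : ℝ≥0∞) = ENNReal.ofReal (c : ℝ) := fun c => by simp
  rw [e a, e b, nlog_ofReal ha1, nlog_ofReal hb1, ← ENNReal.ofReal_mul ha1.le,
    ← ENNReal.ofReal_mul ha1.le, ← ENNReal.ofReal_add _ ha1.le, ← ENNReal.ofReal_add _ hb1.le]
  · refine ENNReal.ofReal_le_ofReal ?_
    have h := Real.log_le_sub_one_of_pos (div_pos hb1 ha1)
    rw [Real.log_div hb1.ne' ha1.ne'] at h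
    have h2 := mul_le_mul_of_nonneg_left h ha1.le
    have h3 : (a : ℝ) * (b / a - 1) = b - a := by field_simp
    nlinarith
  · exact mul_nonneg ha1.le (neg_nonneg.2 (Real.log_nonpos hb1.le hb2))
  · exact mul_nonneg ha1.le (neg_nonneg.2 (Real.log_nonpos ha1.le ha2))

end Information

section PartitionEntropy

variable {X : Type*} [MeasurableSpace X] {α β : Type*} [Countable α] [MeasurableSpace α]
  [MeasurableSingletonClass α]

lemma lintegral_comp_countable (μ : Measure X) {g : X → α} (hg : Measurable g) (f : α → ℝ≥0∞) :
    ∫⁻ x, f (g x) ∂μ = ∑' a, f a * μ (g ⁻¹' {a}) := by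
  have : Measurable f := measurable_of_countable f
  rw [← lintegral_map this hg, lintegral_countable']
  exact tsum_congr fun a => by rw [Measure.map_apply hg (measurableSet_singleton a)]

lemma tsum_measure_fiber (μ : Measure X) [IsProbabilityMeasure μ] {g : X → α}
    (hg : Measurable g) : ∑' a, μ (g ⁻¹' {a}) = 1 := by
  have := lintegral_comp_countable μ hg (fun _ => 1)
  simpa using this.symm

lemma partitionEntropy_eq_tsum {γ : Type*} (μ : Measure X) [IsProbabilityMeasure μ] (g : X → γ) :
    partitionEntropy μ g = ∑' a, μ (g ⁻¹' {a}) * nlog (μ (g ⁻¹' {a})) :=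
  tsum_congr fun _ => ofReal_neg_mul_log (measure_ne_top _ _)

lemma partitionEntropy_eq_lintegral (μ : Measure X) [IsProbabilityMeasure μ] {g : X → α}
    (hg : Measurable g) : partitionEntropy μ g = ∫⁻ x, nlog (μ (g ⁻¹' {g x})) ∂μ := by
  rw [partitionEntropy_eq_tsum, lintegral_comp_countable μ hg (fun a => nlog (μ (g ⁻¹' {a})))]
  exact tsum_congr fun a => mul_comm _ _

/-- Gibbs' inequality. -/
lemma partitionEntropy_le_cross (μ : Measure X) [IsProbabilityMeasure μ] {g : X → α}
    (hg : Measurable g) (Q : α → ℝ≥0∞) (hQ : ∑' a, Q a ≤ 1) :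
    partitionEntropy μ g ≤ ∫⁻ x, nlog (Q (g x)) ∂μ := by
  rw [partitionEntropy_eq_tsum, lintegral_comp_countable μ hg (fun a => nlog (Q a))]
  have h : ∑' a, (μ (g ⁻¹' {a}) * nlog (μ (g ⁻¹' {a})) + μ (g ⁻¹' {a})) ≤
      ∑' a, (μ (g ⁻¹' {a}) * nlog (Q a) + Q a) :=
    ENNReal.tsum_le_tsum fun a => mul_nlog_add_le prob_le_one ((ENNReal.le_tsum a).trans hQ)
  rw [ENNReal.tsum_add, ENNReal.tsum_add, tsum_measure_fiber μ hg] at h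
  have h2 := h.trans (add_le_add le_rfl hQ)
  have h3 := (ENNReal.add_le_add_iff_right ENNReal.one_ne_top).1 h2
  exact h3.trans (ENNReal.tsum_le_tsum fun a => (mul_comm _ _).le)

lemma partitionEntropy_comp_le [Countable β] [MeasurableSpace β] [MeasurableSingletonClass β]
    (μ : Measure X) [IsProbabilityMeasure μ] {g : X → α} (hg : Measurable g) (f : α → β) :
    partitionEntropy μ (fun x => f (g x)) ≤ partitionEntropy μ g := by
  rw [partitionEntropy_eq_lintegral μ hg, partitionEntropy_eq_lintegral μ
    (show Measurable fun x => f (g x) from (measurable_of_countable f).comp hg)]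
  refine lintegral_mono fun x => nlog_anti (measure_mono ?_) (measure_ne_top _ _)
  intro y hy
  simp only [mem_preimage, mem_singleton_iff] at hy ⊢
  rw [hy]

/-- Concavity of the entropy of a partition. -/
lemma sum_mul_partitionEntropy_le {ι γ : Type*} (s : Finset ι) (c : ι → ℝ≥0∞)
    (hc : ∑ i ∈ s, c i = 1) (μ : ι → Measure X) [∀ i, IsProbabilityMeasure (μ i)] (g : X → γ) :
    ∑ i ∈ s, c i * partitionEntropy (μ i) g ≤ partitionEntropy (∑ i ∈ s, c i • μ i) g := by
  have hct : ∀ i ∈ s, c i ≠ ⊤ := fun i hi => ne_top_of_le_ne_top ENNReal.one_ne_top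
    (hc ▸ Finset.single_le_sum (fun _ _ => zero_le) hi)
  have hc' : ∑ i ∈ s, (c i).toReal = 1 := by
    rw [← ENNReal.toReal_sum hct, hc, ENNReal.toReal_one]
  simp only [partitionEntropy, ← ENNReal.tsum_mul_left]
  rw [← Summable.tsum_finsetSum (fun _ _ => ENNReal.summable)]
  refine ENNReal.tsum_le_tsum fun a => ?_
  have hj := Real.concaveOn_negMulLog.le_map_sum (t := s) (w := fun i => (c i).toReal)
    (p := fun i => (μ i (g ⁻¹' {a})).toReal) (fun i _ => ENNReal.toReal_nonneg) hc'
    (fun i _ => ENNReal.toReal_nonneg)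
  have hm : ((∑ i ∈ s, c i • μ i) (g ⁻¹' {a})).toReal
      = ∑ i ∈ s, (c i).toReal • (μ i (g ⁻¹' {a})).toReal := by
    rw [Measure.finsetSum_apply, ENNReal.toReal_sum]
    · simp
    · intro i hi
      simpa using ENNReal.mul_ne_top (hct i hi) (measure_ne_top _ _)
  have hnn : ∀ i, 0 ≤ Real.negMulLog (μ i (g ⁻¹' {a})).toReal := fun i =>
    Real.negMulLog_nonneg ENNReal.toReal_nonneg measureReal_le_one
  rw [hm]
  refine le_trans (le_of_eq ?_) (ENNReal.ofReal_le_ofReal (hj.trans_eq (by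
    simp [Real.negMulLog])))
  rw [ENNReal.ofReal_sum_of_nonneg (fun i _ => smul_nonneg ENNReal.toReal_nonneg (hnn i))]
  refine Finset.sum_congr rfl fun i hi => ?_
  rw [smul_eq_mul, ENNReal.ofReal_mul ENNReal.toReal_nonneg, ENNReal.ofReal_toReal (hct i hi)]
  simp [Real.negMulLog]

end PartitionEntropy

lemma tsum_pi_prod {α : Type*} : ∀ (n : ℕ) (f : Fin n → α → ℝ≥0∞),
    ∑' s : Fin n → α, ∏ i, f i (s i) = ∏ i, ∑' a, f i a
  | 0, f => by simp
  | n + 1, f => by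
    rw [← (Fin.consEquiv fun _ : Fin (n + 1) => α).tsum_eq, ENNReal.tsum_prod', Fin.prod_univ_succ,
      ← tsum_pi_prod n (fun i => f i.succ), ← ENNReal.tsum_mul_right]
    refine tsum_congr fun a => ?_
    rw [← ENNReal.tsum_mul_left]
    refine tsum_congr fun s => ?_
    simp [Fin.consEquiv, Fin.prod_univ_succ]

section Mass

variable {S : Type*} [TopologicalSpace S] {A : S → S → Prop}

/-- The measure of the cylinder spanned by the first `n` coordinates of `x`. -/
noncomputable def mass (μ : Measure (Space A)) (x : Space A) (n : ℕ) : ℝ := μ.real (cyl x n)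

lemma mass_congr (μ : Measure (Space A)) {x y : Space A} {n : ℕ}
    (h : ∀ i < n, x.1 i = y.1 i) : mass μ x n = mass μ y n := by
  rw [mass, mass, cyl_congr h]

lemma birkhoff_add {X : Type*} (T : X → X) (φ : X → ℝ) (a b : ℕ) (x : X) :
    birkhoff T φ (a + b) x = birkhoff T φ a x + birkhoff T φ b (T^[a] x) := by
  simp only [birkhoff, Finset.sum_range_add]
  congr 1
  refine Finset.sum_congr rfl fun i _ => ?_
  rw [← Function.iterate_add_apply, add_comm]

variable {φ : Space A → ℝ} {μ : Measure (Space A)} [IsProbabilityMeasure μ] {c₀ P : ℝ}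

lemma mass_zero (x : Space A) : mass μ x 0 = 1 := by
  have : cyl x 0 = Set.univ := by ext; simp [cyl]
  simp [mass, this]

lemma mass_le_one (x : Space A) (n : ℕ) : mass μ x n ≤ 1 := measureReal_le_one

lemma mass_nonneg (x : Space A) (n : ℕ) : 0 ≤ mass μ x n := measureReal_nonneg

lemma le_mass (hc₀ : 1 ≤ c₀) (hG : IsGibbsWith A φ μ c₀ P) (x : Space A) (n : ℕ) :
    c₀⁻¹ * Real.exp (-(P * n) + birkhoff (shift A) φ n x) ≤ mass μ x n := by
  rcases Nat.eq_zero_or_pos n with rfl | hn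
  · simpa [mass_zero, birkhoff] using inv_le_one_of_one_le₀ hc₀
  · simpa [cylinder_word, mass, Measure.real] using (hG n hn x).1

lemma mass_le (hc₀ : 1 ≤ c₀) (hG : IsGibbsWith A φ μ c₀ P) (x : Space A) (n : ℕ) :
    mass μ x n ≤ c₀ * Real.exp (-(P * n) + birkhoff (shift A) φ n x) := by
  rcases Nat.eq_zero_or_pos n with rfl | hn
  · simpa [mass_zero, birkhoff] using hc₀
  · simpa [cylinder_word, mass, Measure.real] using (hG n hn x).2

lemma mass_pos (hc₀ : 1 ≤ c₀) (hG : IsGibbsWith A φ μ c₀ P) (x : Space A) (n : ℕ) :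
    0 < mass μ x n :=
  lt_of_lt_of_le (by positivity) (le_mass hc₀ hG x n)

lemma exp_add_eq (x : Space A) (a b : ℕ) :
    Real.exp (-(P * (a + b : ℕ)) + birkhoff (shift A) φ (a + b) x)
      = Real.exp (-(P * a) + birkhoff (shift A) φ a x)
        * Real.exp (-(P * b) + birkhoff (shift A) φ b ((shift A)^[a] x)) := by
  rw [← Real.exp_add, birkhoff_add]; congr 1; push_cast; ring

lemma mul_mass_le_mass_add (hc₀ : 1 ≤ c₀) (hG : IsGibbsWith A φ μ c₀ P) (x : Space A) (a b : ℕ) :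
    (c₀ ^ 3)⁻¹ * mass μ x a * mass μ ((shift A)^[a] x) b ≤ mass μ x (a + b) := by
  have h1 := mass_le hc₀ hG x a
  have h2 := mass_le hc₀ hG ((shift A)^[a] x) b
  have h3 := le_mass hc₀ hG x (a + b)
  rw [exp_add_eq] at h3
  refine le_trans ?_ h3
  have h4 := mul_le_mul h1 h2 (mass_nonneg _ _) (by positivity)
  calc _ = (c₀ ^ 3)⁻¹ * (mass μ x a * mass μ ((shift A)^[a] x) b) := by ring
    _ ≤ (c₀ ^ 3)⁻¹ * _ := mul_le_mul_of_nonneg_left h4 (by positivity)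
    _ = _ := by field_simp

lemma mass_le_prod (hc₀ : 1 ≤ c₀) (hG : IsGibbsWith A φ μ c₀ P) (x : Space A) (n : ℕ) :
    mass μ x n ≤ c₀ ^ (n + 1) * ∏ i ∈ Finset.range n, mass μ ((shift A)^[i] x) 1 := by
  have h : Real.exp (-(P * n) + birkhoff (shift A) φ n x)
      = ∏ i ∈ Finset.range n, Real.exp (-P + φ ((shift A)^[i] x)) := by
    rw [← Real.exp_sum, Finset.sum_add_distrib]; simp [birkhoff]; ring
  calc _ ≤ c₀ * ∏ i ∈ Finset.range n, Real.exp (-P + φ ((shift A)^[i] x)) :=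
        h ▸ mass_le hc₀ hG x n
    _ ≤ c₀ * ∏ i ∈ Finset.range n, c₀ * mass μ ((shift A)^[i] x) 1 := by
        gcongr with i _
        have := le_mass hc₀ hG ((shift A)^[i] x) 1
        simp only [birkhoff, Finset.range_one, Finset.sum_singleton, Nat.cast_one, mul_one,
          Function.iterate_zero, id] at this
        rwa [inv_mul_le_iff₀ (by positivity)] at this
    _ = _ := by rw [Finset.prod_mul_distrib]; simp; ring

lemma phi_le (hc₀ : 1 ≤ c₀) (hG : IsGibbsWith A φ μ c₀ P) (x : Space A) :
    φ x ≤ P + Real.log c₀ := by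
  have h := (le_mass hc₀ hG x 1).trans (mass_le_one x 1)
  simp only [birkhoff, Finset.range_one, Finset.sum_singleton, Nat.cast_one, mul_one,
    Function.iterate_zero, id] at h
  rw [inv_mul_le_iff₀ (by positivity), mul_one] at h
  have := Real.log_le_log (Real.exp_pos _) h
  rw [Real.log_exp] at this
  linarith

lemma le_birkhoff (hc₀ : 1 ≤ c₀) (hG : IsGibbsWith A φ μ c₀ P) (x : Space A) (n : ℕ) :
    P * n + Real.log (mass μ x n) - Real.log c₀ ≤ birkhoff (shift A) φ n x := by
  have h := Real.log_le_log (mass_pos hc₀ hG x n) (mass_le hc₀ hG x n)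
  rw [Real.log_mul (by positivity) (by positivity), Real.log_exp] at h
  linarith

lemma birkhoff_le (hc₀ : 1 ≤ c₀) (hG : IsGibbsWith A φ μ c₀ P) (x : Space A) (n : ℕ) :
    birkhoff (shift A) φ n x ≤ P * n + Real.log (mass μ x n) + Real.log c₀ := by
  have h := Real.log_le_log (by positivity) (le_mass hc₀ hG x n)
  rw [Real.log_mul (by positivity) (by positivity), Real.log_exp, Real.log_inv] at h
  linarith

/-- Words over a finite set of letters of a given length have uniformly positive mass. -/
lemma exists_le_mass_of_finite (hc₀ : 1 ≤ c₀) (hG : IsGibbsWith A φ μ c₀ P) {F : Set S}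
    (hF : F.Finite) (n : ℕ) : ∃ κ : ℝ, 0 < κ ∧ ∀ y : Space A, (∀ i < n, y.1 i ∈ F) →
      κ ≤ mass μ y n := by
  have h1 : ∃ κ : ℝ, 0 < κ ∧ ∀ y : Space A, y.1 0 ∈ F → κ ≤ mass μ y 1 := by
    induction F, hF using Set.Finite.induction_on with
    | empty => exact ⟨1, one_pos, by simp⟩
    | @insert a F _ _ ih =>
      obtain ⟨κ, hκ, h⟩ := ih
      by_cases ha : ∃ z : Space A, z.1 0 = a
      · obtain ⟨z, hz⟩ := ha
        refine ⟨min κ (mass μ z 1), lt_min hκ (mass_pos hc₀ hG z 1), fun y hy => ?_⟩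
        rcases hy with hy | hy
        · rw [mass_congr μ (x := y) (y := z)]
          · exact min_le_right _ _
          · intro i hi
            obtain rfl : i = 0 := by omega
            rw [hy, hz]
        · exact (min_le_left _ _).trans (h y hy)
      · refine ⟨κ, hκ, fun y hy => ?_⟩
        rcases hy with hy | hy
        · exact absurd ⟨y, hy⟩ ha
        · exact h y hy
  obtain ⟨κ₁, hκ₁, h1⟩ := h1
  induction n with
  | zero => exact ⟨1, one_pos, fun y _ => (mass_zero y).ge⟩
  | succ n ih =>
    obtain ⟨κ, hκ, h⟩ := ih
    refine ⟨(c₀ ^ 3)⁻¹ * κ * κ₁, by positivity, fun y hy => ?_⟩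
    refine le_trans ?_ (mul_mass_le_mass_add hc₀ hG y n 1)
    have := h y fun i hi => hy i (by omega)
    have h2 := h1 ((shift A)^[n] y) (by rw [shift_iterate_apply]; exact hy n (by omega))
    have h3 := mass_nonneg (μ := μ) y n
    gcongr

end Mass

section Loops

variable {S : Type*} [TopologicalSpace S] {A : S → S → Prop}

/-- `g` restricted to `{0, …, n}` is an admissible loop of length `n` based at `b`. -/
structure IsLoop (A : S → S → Prop) (b : S) (n : ℕ) (g : ℕ → S) : Prop where
  zero : g 0 = b
  last : g n = b
  step : ∀ i < n, A (g i) (g (i + 1))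

/-- Concatenation of a sequence of loops of length `n`. -/
def conc (n : ℕ) (B : ℕ → ℕ → S) : ℕ → S := fun i => B (i / n) (i % n)

lemma conc_mul_add {n : ℕ} {B : ℕ → ℕ → S} (t : ℕ) {i : ℕ} (hi : i < n) :
    conc n B (t * n + i) = B t i := by
  have hn : 0 < n := by omega
  rw [conc, mul_comm, Nat.mul_add_div hn, Nat.mul_add_mod, Nat.div_eq_of_lt hi,
    Nat.mod_eq_of_lt hi, add_zero]

lemma conc_mul {n : ℕ} (hn : 0 < n) {b : S} {B : ℕ → ℕ → S} (hB : ∀ t, IsLoop A b n (B t))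
    (t : ℕ) : conc n B (t * n) = b := by
  simpa [(hB t).zero] using conc_mul_add (B := B) t hn

lemma conc_adm {n : ℕ} (hn : 0 < n) {b : S} {B : ℕ → ℕ → S} (hB : ∀ t, IsLoop A b n (B t))
    (i : ℕ) : A (conc n B i) (conc n B (i + 1)) := by
  obtain ⟨t, j, hj, rfl⟩ : ∃ t j, j < n ∧ i = t * n + j :=
    ⟨i / n, i % n, Nat.mod_lt _ hn, by rw [mul_comm]; exact (Nat.div_add_mod i n).symm⟩
  rw [conc_mul_add t hj]
  have h := (hB t).step j hj
  rcases Nat.lt_or_ge (j + 1) n with h1 | h1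
  · rwa [add_assoc, conc_mul_add t h1]
  · obtain rfl : n = j + 1 := by omega
    rw [show t * (j + 1) + j + 1 = (t + 1) * (j + 1) by ring, conc_mul hn hB]
    rwa [(hB t).last] at h

lemma isLoop_conc {n : ℕ} (hn : 0 < n) {b : S} {B : ℕ → ℕ → S} (hB : ∀ t, IsLoop A b n (B t))
    (m : ℕ) : IsLoop A b (m * n) (conc n B) :=
  ⟨by simpa using conc_mul hn hB 0, conc_mul hn hB m, fun i _ => conc_adm hn hB i⟩

/-- Concatenation of two loops. -/
def glue (n : ℕ) (g h : ℕ → S) : ℕ → S := fun i => if i < n then g i else h (i - n)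

lemma isLoop_glue {n m : ℕ} {b : S} {g h : ℕ → S} (hn : 0 < n) (hg : IsLoop A b n g)
    (hh : IsLoop A b m h) : IsLoop A b (n + m) (glue n g h) := by
  refine ⟨by simp [glue, hn, hg.zero], by simp [glue, hh.last], fun i hi => ?_⟩
  rcases lt_trichotomy (i + 1) n with h1 | h1 | h1
  · simpa [glue, h1, show i < n by omega] using hg.step i (by omega)
  · have := hg.step i (by omega)
    rw [h1, hg.last] at this
    simpa [glue, h1, show i < n by omega, hh.zero] using this
  · have := hh.step (i - n) (by omega)
    simpa [glue, show ¬ i < n by omega, show ¬ i + 1 < n by omega,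
      show i + 1 - n = i - n + 1 by omega] using this

/-- The point of the shift obtained by concatenating loops. -/
def concPt {n : ℕ} (hn : 0 < n) {b : S} (B : ℕ → ℕ → S) (hB : ∀ t, IsLoop A b n (B t)) :
    Space A := ⟨conc n B, conc_adm hn hB⟩

lemma shift_iterate_concPt {n : ℕ} (hn : 0 < n) {b : S} (B : ℕ → ℕ → S)
    (hB : ∀ t, IsLoop A b n (B t)) :
    (shift A)^[n] (concPt hn B hB) = concPt hn (fun t => B (t + 1)) (fun t => hB (t + 1)) := by
  refine ext_coord fun i => ?_
  rw [shift_iterate_apply]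
  simp [concPt, conc, Nat.add_div_left _ hn]

/-- The periodic point spanned by a loop. -/
def perPt {n : ℕ} (hn : 0 < n) {b : S} (g : ℕ → S) (hg : IsLoop A b n g) : Space A :=
  concPt hn (fun _ => g) (fun _ => hg)

lemma perPt_mem {n : ℕ} (hn : 0 < n) {b : S} (g : ℕ → S) (hg : IsLoop A b n g) :
    perPt hn g hg ∈ perSet (shift A) n := shift_iterate_concPt hn _ _

lemma perPt_apply {n : ℕ} (hn : 0 < n) {b : S} (g : ℕ → S) (hg : IsLoop A b n g) {i : ℕ}
    (hi : i < n) : (perPt hn g hg).1 i = g i := by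
  simp [perPt, concPt, conc, Nat.mod_eq_of_lt hi]

/-- A periodic point is determined by its first `n` coordinates. -/
lemma perSet_ext {n : ℕ} (hn : 0 < n) {x y : Space A} (hx : x ∈ perSet (shift A) n)
    (hy : y ∈ perSet (shift A) n) (h : ∀ i < n, x.1 i = y.1 i) : x = y := by
  have key : ∀ z ∈ perSet (shift A) n, ∀ i, z.1 i = z.1 (i % n) := by
    intro z hz i
    have h1 : ∀ t j, z.1 (t * n + j) = z.1 j := by
      intro t
      induction t with
      | zero => simp
      | succ t ih =>
        intro j
        have : z.1 (n + (t * n + j)) = z.1 (t * n + j) := by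
          rw [← shift_iterate_apply, show (shift A)^[n] z = z from hz]
        rw [← ih j, ← this]; exact congrArg z.1 (by ring)
    conv_lhs => rw [← Nat.div_add_mod i n, mul_comm]
    exact h1 _ _
  refine ext_coord fun i => ?_
  rw [key x hx, key y hy]
  exact h _ (Nat.mod_lt _ hn)

lemma admissible_word (x : Space A) {k : ℕ} (hk : 1 ≤ k) : Admissible A (word x k) := by
  constructor
  · simp [word]; omega
  · change List.IsChain A _
    rw [List.isChain_iff_getElem]
    intro i hi
    simpa [word] using x.2 i

lemma isLoop_of_admissible {b : S} {n : ℕ} {w : List S} (hn : 0 < n) (hw : w.length = n)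
    (h : Admissible A (w ++ [b])) (h0 : w.getD 0 b = b) :
    IsLoop A b n (fun i => (w ++ [b]).getD i b) := by
  refine ⟨?_, ?_, fun i hi => ?_⟩
  · rw [List.getD_append _ _ _ _ (by omega)]; exact h0
  · rw [List.getD_append_right _ _ _ _ (by omega)]; simp [hw]
  · have := List.isChain_iff_getElem.1 h.2 i (by simp; omega)
    rw [List.getD_eq_getElem _ _ (by simp; omega), List.getD_eq_getElem _ _ (by simp; omega)]
    exact this

/-- The letters of the connecting words are contained in a finite set, and every word extends
to a loop. -/
lemma exists_loop_data (hprim : FinitelyPrimitive A) (b : S) :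
    ∃ (N : ℕ) (F : Set S), F.Finite ∧
      (∀ k, 1 ≤ k → ∀ x : Space A, ∃ g, IsLoop A b (k + 2 * N + 1) g ∧
        (∀ i < k, g (N + 1 + i) = x.1 i) ∧ (∀ i < N + 1, g i ∈ F) ∧
        ∀ i < N, g (N + 1 + k + i) ∈ F) ∧
      ∀ r, N + 1 ≤ r → (∃ x : Space A, x.1 0 = b) → ∃ g, IsLoop A b r g := by
  obtain ⟨Λ, ⟨N, hN⟩, h⟩ := hprim
  have hb : Admissible A [b] := ⟨by simp, List.isChain_singleton _⟩
  refine ⟨N, insert b {s | ∃ l ∈ Λ, s ∈ l}, ?_, ?_, ?_⟩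
  · refine Set.Finite.insert _ ?_
    have : {s | ∃ l ∈ Λ, s ∈ l} = ⋃ l ∈ Λ, {s | s ∈ l} := by ext; simp
    rw [this]
    exact Λ.finite_toSet.biUnion fun l _ => List.finite_toSet l
  · intro k hk x
    obtain ⟨l₁, hl₁, h1⟩ := h [b] (word x k) hb (admissible_word x hk)
    obtain ⟨l₂, hl₂, h2⟩ := h _ [b] h1 hb
    have e1 := hN _ hl₁
    have e2 := hN _ hl₂
    refine ⟨_, isLoop_of_admissible (by omega) ?_ h2 ?_, ?_, ?_, ?_⟩
    · simp [word, e1, e2]; omega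
    · simp
    · intro i hi
      rw [List.append_assoc, List.append_assoc, List.getD_append_right _ _ _ _ (by simp; omega),
        List.getD_append _ _ _ _ (by simp [word]; omega)]
      simp [e1, word, show N + 1 + i - (N + 1) = i by omega, hi]
    · intro i hi
      rw [List.append_assoc, List.append_assoc, List.getD_append _ _ _ _ (by simp; omega),
        List.getD_eq_getElem _ _ (by simp; omega)]
      have : ([b] ++ l₁)[i]'(by simp; omega) ∈ [b] ++ l₁ := List.getElem_mem _
      simp only [List.mem_append, List.mem_singleton] at this
      exact this.imp id fun h => ⟨l₁, hl₁, h⟩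
    · intro i hi
      rw [List.append_assoc, List.getD_append_right _ _ _ _ (by simp [word]; omega),
        List.getD_append _ _ _ _ (by simp [word]; omega),
        List.getD_eq_getElem _ _ (by simp [word]; omega)]
      exact Or.inr ⟨l₂, hl₂, List.getElem_mem _⟩
  · rintro r hr ⟨x, hx⟩
    obtain ⟨l, hl, h1⟩ := h (word x (r - N)) [b] (admissible_word x (by omega)) hb
    have e1 := hN _ hl
    refine ⟨_, isLoop_of_admissible (by omega) ?_ h1 ?_⟩
    · simp [word, e1]; omega
    · rw [List.getD_append _ _ _ _ (by simp [word]; omega),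
        List.getD_eq_getElem _ _ (by simp [word]; omega)]
      simp [word, hx]

lemma exists_loops_mass (hprim : FinitelyPrimitive A) (b : S)
    {φ : Space A → ℝ} {μ : Measure (Space A)} [IsProbabilityMeasure μ] {c₀ P : ℝ}
    (hc₀ : 1 ≤ c₀) (hG : IsGibbsWith A φ μ c₀ P) :
    ∃ (N : ℕ) (κ : ℝ), 0 < κ ∧ κ ≤ 1 ∧
      (∀ k, 1 ≤ k → ∀ x : Space A, ∃ g, IsLoop A b (k + 2 * N + 1) g ∧
        (∀ i < k, g (N + 1 + i) = x.1 i) ∧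
        ∀ y : Space A, (∀ i < k + 2 * N + 1, y.1 i = g i) →
          κ * mass μ x k ≤ mass μ y (k + 2 * N + 1)) ∧
      ∀ r, N + 1 ≤ r → (∃ x : Space A, x.1 0 = b) → ∃ g, IsLoop A b r g := by
  obtain ⟨N, F, hF, h1, h2⟩ := exists_loop_data hprim b
  obtain ⟨κ₁, hκ₁, hm₁⟩ := exists_le_mass_of_finite hc₀ hG hF (N + 1)
  obtain ⟨κ₂, hκ₂, hm₂⟩ := exists_le_mass_of_finite hc₀ hG hF N
  refine ⟨N, min 1 ((c₀ ^ 3)⁻¹ * κ₁ * ((c₀ ^ 3)⁻¹ * κ₂)), by positivity, min_le_left _ _,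
    fun k hk x => ?_, h2⟩
  obtain ⟨g, hg, hgx, hg1, hg2⟩ := h1 k hk x
  refine ⟨g, hg, hgx, fun y hy => ?_⟩
  have e1 := mul_mass_le_mass_add hc₀ hG y (N + 1) (k + N)
  have e2 := mul_mass_le_mass_add hc₀ hG ((shift A)^[N + 1] y) k N
  rw [show N + 1 + (k + N) = k + 2 * N + 1 by ring] at e1
  have e3 : mass μ ((shift A)^[N + 1] y) k = mass μ x k := mass_congr μ fun i hi => by
    rw [shift_iterate_apply, hy _ (by omega), hgx i hi]
  have e4 := hm₁ y fun i hi => by rw [hy _ (by omega)]; exact hg1 i hi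
  have e5 := hm₂ ((shift A)^[k] ((shift A)^[N + 1] y)) fun i hi => by
    rw [shift_iterate_apply, shift_iterate_apply, hy _ (by omega), ← add_assoc]
    exact hg2 i hi
  rw [e3] at e2
  have e6 := mass_nonneg (μ := μ) x k
  have e7 := mass_nonneg (μ := μ) y (N + 1)
  refine le_trans ?_ e1
  calc _ ≤ ((c₀ ^ 3)⁻¹ * κ₁ * ((c₀ ^ 3)⁻¹ * κ₂)) * mass μ x k := by
        gcongr; exact min_le_right _ _
    _ = (c₀ ^ 3)⁻¹ * κ₁ * ((c₀ ^ 3)⁻¹ * mass μ x k * κ₂) := by ring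
    _ ≤ (c₀ ^ 3)⁻¹ * mass μ y (N + 1) * ((c₀ ^ 3)⁻¹ * mass μ x k
          * mass μ ((shift A)^[k] ((shift A)^[N + 1] y)) N) := by gcongr
    _ ≤ _ := by gcongr

end Loops

section Prefix

variable {S : Type*} [TopologicalSpace S] {A : S → S → Prop}

/-- The first `k` coordinates of a point. -/
def pref (k : ℕ) (x : Space A) : Fin k → S := fun i => x.1 i

lemma pref_eq_iff {k : ℕ} {x y : Space A} : pref k x = pref k y ↔ ∀ i < k, x.1 i = y.1 i :=
  ⟨fun h i hi => congrFun h ⟨i, hi⟩, fun h => funext fun i => h i i.2⟩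

lemma pref_preimage (k : ℕ) (x : Space A) : pref k ⁻¹' {pref k x} = cyl x k := by
  ext y; simp [pref_eq_iff, cyl]

/-- The admissible words of length `k`. -/
abbrev Word (A : S → S → Prop) (k : ℕ) : Type _ := Set.range (pref (A := A) k)

/-- A point with a given prefix. -/
noncomputable def Word.rep {k : ℕ} (s : Word A k) : Space A := s.2.choose

lemma Word.pref_rep {k : ℕ} (s : Word A k) : pref k s.rep = s.1 := s.2.choose_spec

variable [DiscreteTopology S] [Countable S]

lemma measurable_pref (k : ℕ) {α : Type*} [MeasurableSpace α] (f : (Fin k → S) → α) :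
    Measurable fun x : Space A => f (pref k x) := by
  let _ : MeasurableSpace (Fin k → S) := ⊤
  refine Measurable.comp (g := f) (fun _ _ => trivial) ?_
  refine measurable_to_countable' fun s => ?_
  refine Determined.measurableSet (n := k) fun x y h hx => ?_
  rw [mem_preimage, mem_singleton_iff] at hx ⊢
  rw [← hx, pref_eq_iff]
  exact fun i hi => (h i hi).symm

lemma lintegral_pref (μ : Measure (Space A)) (k : ℕ) (f : (Fin k → S) → ℝ≥0∞) :
    ∫⁻ x, f (pref k x) ∂μ = ∑' s : Word A k, f s.1 * μ (cyl s.rep k) := by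
  let _ : MeasurableSpace (Fin k → S) := ⊤
  rw [lintegral_comp_countable μ (show Measurable (pref (A := A) k) from measurable_pref k id) f]
  rw [← tsum_subtype_eq_of_support_subset (s := Set.range (pref (A := A) k))]
  · refine tsum_congr fun s => ?_
    rw [← pref_preimage, Word.pref_rep s]
  · intro s hs
    by_contra h
    refine hs ?_
    have : pref (A := A) k ⁻¹' {s} = ∅ := by
      ext x
      simp only [mem_preimage, mem_singleton_iff, mem_empty_iff_false, iff_false]
      exact fun hx => h ⟨x, hx⟩
    simp [this]

lemma tsum_measure_cyl (μ : Measure (Space A)) [IsProbabilityMeasure μ] (k : ℕ) :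
    ∑' s : Word A k, μ (cyl s.rep k) = 1 := by
  simpa using (lintegral_pref μ k (fun _ => 1)).symm

end Prefix

section Theta

variable {S : Type*} [TopologicalSpace S] {A : S → S → Prop}

/-- The total mass of the `n`-cylinders of the `n`-periodic points with empirical measure
in `E`. -/
noncomputable def theta (μ : Measure (Space A)) (n : ℕ) (E : Set (ProbabilityMeasure (Space A))) :
    ℝ≥0∞ :=
  ∑' x : perSet (shift A) n, E.indicator (fun _ => μ (cyl x.1 n)) (empirical (shift A) x.1 n)

lemma tsum_le_theta (μ : Measure (Space A)) (n : ℕ) {E : Set (ProbabilityMeasure (Space A))}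
    {R : Type*} (p : R → Space A) (hp : ∀ r, p r ∈ perSet (shift A) n)
    (hinj : Function.Injective p) (hE : ∀ r, empirical (shift A) (p r) n ∈ E) :
    ∑' r, μ (cyl (p r) n) ≤ theta μ n E := by
  have := ENNReal.tsum_comp_le_tsum_of_injective
    (f := fun r => (⟨p r, hp r⟩ : perSet (shift A) n)) (fun a b h => hinj (congrArg Subtype.val h))
    (fun x : perSet (shift A) n =>
      E.indicator (fun _ => μ (cyl x.1 n)) (empirical (shift A) x.1 n))
  refine le_trans (ENNReal.tsum_le_tsum fun r => ?_) this
  simp [indicator_of_mem (hE r)]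

variable [DiscreteTopology S]

lemma tsum_cyl_le_one (μ : Measure (Space A)) [IsProbabilityMeasure μ] {n : ℕ} {R : Type*}
    (p : R → Space A) (hp : ∀ r r', (∀ i < n, (p r).1 i = (p r').1 i) → r = r') :
    ∑' r, μ (cyl (p r) n) ≤ 1 := by
  refine (tsum_meas_le_meas_iUnion_of_disjoint μ (fun r => measurableSet_cyl _ _) ?_).trans
    prob_le_one
  intro r r' hr
  refine Set.disjoint_left.2 fun y h1 h2 => hr (hp r r' fun i hi => ?_)
  rw [← h1 i hi, ← h2 i hi]

lemma theta_le_one (μ : Measure (Space A)) [IsProbabilityMeasure μ] {n : ℕ} (hn : 0 < n)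
    (E : Set (ProbabilityMeasure (Space A))) : theta μ n E ≤ 1 := by
  refine le_trans (ENNReal.tsum_le_tsum fun x => ?_) (tsum_cyl_le_one μ (n := n)
    (fun x : perSet (shift A) n => x.1) fun x y h => Subtype.ext (perSet_ext hn x.2 y.2 h))
  exact indicator_le_self' (fun _ _ => zero_le) _

variable [Countable S]

lemma exists_le_theta_univ (hprim : FinitelyPrimitive A) {φ : Space A → ℝ} {μ : Measure (Space A)}
    [IsProbabilityMeasure μ] {c₀ P : ℝ} (hc₀ : 1 ≤ c₀) (hG : IsGibbsWith A φ μ c₀ P) :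
    ∃ c : ℝ≥0∞, c ≠ 0 ∧ ∃ n₀, ∀ n ≥ n₀, c ≤ theta μ n univ := by
  obtain ⟨x₀⟩ : Nonempty (Space A) := nonempty_of_isProbabilityMeasure μ
  obtain ⟨N, κ, hκ, hκ1, h1, -⟩ := exists_loops_mass hprim (x₀.1 0) hc₀ hG
  refine ⟨ENNReal.ofReal κ, by simpa using hκ, 2 * N + 2, fun n hn => ?_⟩
  obtain ⟨k, hk, rfl⟩ : ∃ k, 1 ≤ k ∧ n = k + 2 * N + 1 := ⟨n - (2 * N + 1), by omega, by omega⟩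
  choose g hg hgx hgm using fun s : Word A k => h1 k hk s.rep
  have hpos : 0 < k + 2 * N + 1 := by omega
  refine le_trans ?_ (tsum_le_theta μ _ (R := Word A k) (fun s => perPt hpos (g s) (hg s))
    (fun s => perPt_mem _ _ _) (fun s t hst => ?_) (fun _ => mem_univ _))
  · rw [← mul_one (ENNReal.ofReal κ), ← tsum_measure_cyl μ k, ← ENNReal.tsum_mul_left]
    refine ENNReal.tsum_le_tsum fun s => ?_
    have := hgm s (perPt hpos (g s) (hg s)) fun i hi => perPt_apply hpos _ _ hi
    rw [← ofReal_measureReal (measure_ne_top _ _), ← ofReal_measureReal (measure_ne_top _ _),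
      ← ENNReal.ofReal_mul hκ.le]
    exact ENNReal.ofReal_le_ofReal this
  · refine Subtype.ext ?_
    rw [← s.pref_rep, ← t.pref_rep, pref_eq_iff]
    intro i hi
    rw [← hgx s i hi, ← hgx t i hi, ← perPt_apply hpos _ (hg s) (by omega),
      ← perPt_apply hpos _ (hg t) (by omega)]
    exact congrArg (fun z : Space A => z.1 (N + 1 + i)) hst

lemma weightedDistr_apply {φ : Space A → ℝ} (n : ℕ) {E : Set (ProbabilityMeasure (Space A))}
    (hE : MeasurableSet E) :
    weightedDistr (shift A) φ n (perSet (shift A) n) E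
      = (Zfn (shift A) φ n (perSet (shift A) n))⁻¹ *
        ∑' x : perSet (shift A) n, E.indicator
          (fun _ => ENNReal.ofReal (Real.exp (birkhoff (shift A) φ n x.1)))
            (empirical (shift A) x.1 n) := by
  rw [weightedDistr, Measure.smul_apply, smul_eq_mul, Measure.sum_apply _ hE]
  congr 1
  refine tsum_congr fun x => ?_
  rw [Measure.smul_apply, Measure.dirac_apply' _ hE, smul_eq_mul]
  by_cases h : empirical (shift A) x.1 n ∈ E <;> simp [h]

lemma exists_weightedDistr_comparison (hprim : FinitelyPrimitive A) {φ : Space A → ℝ}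
    {μ : Measure (Space A)} [IsProbabilityMeasure μ] {c₀ P : ℝ} (hc₀ : 1 ≤ c₀)
    (hG : IsGibbsWith A φ μ c₀ P) :
    ∃ C : ℝ≥0∞, C ≠ 0 ∧ C ≠ ⊤ ∧ ∃ n₀, 0 < n₀ ∧ ∀ n ≥ n₀,
      ∀ E : Set (ProbabilityMeasure (Space A)), MeasurableSet E →
        weightedDistr (shift A) φ n (perSet (shift A) n) E ≤ C * theta μ n E ∧
        theta μ n E ≤ C * weightedDistr (shift A) φ n (perSet (shift A) n) E := by
  obtain ⟨c, hc, n₀, hn₀⟩ := exists_le_theta_univ hprim hc₀ hG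
  have hc1 : c ≤ 1 := (hn₀ (n₀ + 1) (by omega)).trans (theta_le_one μ (by omega) _)
  have hct : c ≠ ⊤ := ne_top_of_le_ne_top ENNReal.one_ne_top hc1
  set K : ℝ≥0∞ := ENNReal.ofReal c₀ with hK
  have hK0 : K ≠ 0 := by simp [hK]; linarith
  have hKt : K ≠ ⊤ := ENNReal.ofReal_ne_top
  refine ⟨K * K * c⁻¹, by simp [hK0, hct], by finiteness, n₀ + 1, by omega, fun n hn E hE => ?_⟩
  have hn1 := hn₀ n (by omega)
  have hn2 := theta_le_one μ (n := n) (by omega) univ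
  rw [weightedDistr_apply n hE]
  set Z := Zfn (shift A) φ n (perSet (shift A) n) with hZ
  set W : Set (ProbabilityMeasure (Space A)) → ℝ≥0∞ := fun E => ∑' x : perSet (shift A) n,
    E.indicator (fun _ => ENNReal.ofReal (Real.exp (birkhoff (shift A) φ n x.1)))
      (empirical (shift A) x.1 n) with hW
  have hZW : Z = W univ := by simp [hZ, Zfn, hW]
  set e : ℝ≥0∞ := ENNReal.ofReal (Real.exp (P * n)) with he
  have he0 : e ≠ 0 := by simp [he, Real.exp_pos]
  have het : e ≠ ⊤ := ENNReal.ofReal_ne_top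
  have hexp : ∀ x : Space A, Real.exp (-(P * n) + birkhoff (shift A) φ n x)
      = (Real.exp (P * n))⁻¹ * Real.exp (birkhoff (shift A) φ n x) := fun x => by
    rw [Real.exp_add, Real.exp_neg]
  have h1 : ∀ E, W E ≤ K * e * theta μ n E := by
    intro E
    rw [theta, ← ENNReal.tsum_mul_left]
    refine ENNReal.tsum_le_tsum fun x => ?_
    by_cases hx : empirical (shift A) x.1 n ∈ E
    · simp only [indicator_of_mem hx]
      rw [← ofReal_measureReal (measure_ne_top _ _), hK, he,
        ← ENNReal.ofReal_mul (by positivity), ← ENNReal.ofReal_mul (by positivity)]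
      refine ENNReal.ofReal_le_ofReal ?_
      have := le_mass hc₀ hG x.1 n
      rw [hexp, inv_mul_le_iff₀ (by positivity), inv_mul_le_iff₀ (by positivity)] at this
      refine this.trans (le_of_eq ?_); simp only [mass]; ring
    · simp [hx]
  have h2 : ∀ E, e * theta μ n E ≤ K * W E := by
    intro E
    rw [theta, ← ENNReal.tsum_mul_left, ← ENNReal.tsum_mul_left]
    refine ENNReal.tsum_le_tsum fun x => ?_
    by_cases hx : empirical (shift A) x.1 n ∈ E
    · simp only [indicator_of_mem hx]
      rw [← ofReal_measureReal (measure_ne_top _ _), hK, he,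
        ← ENNReal.ofReal_mul (by positivity), ← ENNReal.ofReal_mul (by positivity)]
      refine ENNReal.ofReal_le_ofReal ?_
      have := mass_le hc₀ hG x.1 n
      rw [hexp] at this
      have h3 := Real.exp_pos (P * n)
      calc _ ≤ Real.exp (P * n) * (c₀ * ((Real.exp (P * n))⁻¹ *
            Real.exp (birkhoff (shift A) φ n x.1))) := mul_le_mul_of_nonneg_left this h3.le
        _ = _ := by field_simp
    · simp [hx]
  have hZlow : e * c ≤ K * Z := (mul_le_mul_right hn1 e).trans (hZW ▸ h2 univ)
  have hZup : Z ≤ K * e := (hZW ▸ h1 univ).trans (by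
    calc _ ≤ K * e * 1 := by gcongr
      _ = _ := mul_one _)
  have hZ0 : Z ≠ 0 := fun h => by
    rw [h, mul_zero] at hZlow
    exact mul_ne_zero he0 hc (le_zero_iff.1 hZlow)
  have hZt : Z ≠ ⊤ := ne_top_of_le_ne_top (by finiteness) hZup
  have hZi : Z⁻¹ ≤ K * e⁻¹ * c⁻¹ := by
    rw [← ENNReal.mul_le_mul_iff_right hZ0 hZt, ENNReal.mul_inv_cancel hZ0 hZt]
    calc (1 : ℝ≥0∞) = (e * c) * (e⁻¹ * c⁻¹) := by
          rw [mul_mul_mul_comm, ENNReal.mul_inv_cancel he0 het, ENNReal.mul_inv_cancel hc hct,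
            one_mul]
      _ ≤ (K * Z) * (e⁻¹ * c⁻¹) := by gcongr
      _ = _ := by ring
  constructor
  · calc Z⁻¹ * W E ≤ (K * e⁻¹ * c⁻¹) * (K * e * theta μ n E) := by gcongr; exact h1 E
      _ = (e⁻¹ * e) * (K * K * c⁻¹ * theta μ n E) := by ring
      _ = _ := by rw [ENNReal.inv_mul_cancel he0 het, one_mul]
  · have hone : 1 ≤ K * e * Z⁻¹ := by
      rw [← ENNReal.mul_inv_cancel hZ0 hZt]; gcongr
    have hci : 1 ≤ c⁻¹ := ENNReal.one_le_inv.2 hc1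
    calc theta μ n E = e⁻¹ * (e * theta μ n E) := by
          rw [← mul_assoc, ENNReal.inv_mul_cancel he0 het, one_mul]
      _ ≤ e⁻¹ * (K * W E) := mul_le_mul_right (h2 E) _
      _ = 1 * 1 * (e⁻¹ * (K * W E)) := by simp
      _ ≤ (K * e * Z⁻¹) * c⁻¹ * (e⁻¹ * (K * W E)) := by gcongr
      _ = (e⁻¹ * e) * (K * K * c⁻¹ * (Z⁻¹ * W E)) := by ring
      _ = _ := by rw [ENNReal.inv_mul_cancel he0 het, one_mul]

end Theta

section Empirical

open Classical in
/-- The number of visits to `E` during the first `n` iterates. -/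
noncomputable def visits {X : Type*} (T : X → X) (x : X) (n : ℕ) (E : Set X) : ℕ :=
  ((Finset.range n).filter fun i => T^[i] x ∈ E).card

lemma empirical_apply {X : Type*} [MeasurableSpace X] (T : X → X) (x : X) {n : ℕ} (hn : 0 < n)
    {E : Set X} (hE : MeasurableSet E) :
    (empirical T x n : Measure X) E = (n : ℝ≥0∞)⁻¹ * (visits T x n E : ℝ≥0∞) := by
  classical
  change (((max n 1 : ℕ) : ℝ≥0∞)⁻¹ • ∑ i ∈ Finset.range (max n 1), Measure.dirac (T^[i] x)) E = _
  rw [max_eq_left (by omega : 1 ≤ n), Measure.smul_apply, Measure.finsetSum_apply, smul_eq_mul]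
  congr 1
  rw [visits, Finset.card_filter]
  push_cast
  refine Finset.sum_congr rfl fun i _ => ?_
  rw [Measure.dirac_apply' _ hE]
  by_cases h : T^[i] x ∈ E <;> simp [h]

lemma empirical_real {X : Type*} [MeasurableSpace X] (T : X → X) (x : X) {n : ℕ} (hn : 0 < n)
    {E : Set X} (hE : MeasurableSet E) :
    (empirical T x n : Measure X).real E = (visits T x n E : ℝ) / n := by
  rw [Measure.real, empirical_apply T x hn hE, ENNReal.toReal_mul, ENNReal.toReal_inv]
  simp; ring

lemma invariant_empirical {X : Type*} [MeasurableSpace X] {T : X → X} (hT : Measurable T) {x : X}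
    {n : ℕ} (hn : 0 < n) (hx : x ∈ perSet T n) : Invariant T (empirical T x n : Measure X) := by
  change Measure.map T (((max n 1 : ℕ) : ℝ≥0∞)⁻¹ • ∑ i ∈ Finset.range (max n 1),
    Measure.dirac (T^[i] x)) = ((max n 1 : ℕ) : ℝ≥0∞)⁻¹ • ∑ i ∈ Finset.range (max n 1),
    Measure.dirac (T^[i] x)
  rw [max_eq_left (by omega : 1 ≤ n), Measure.map_smul, ← Measure.mapₗ_apply_of_measurable hT,
    map_sum]
  congr 1
  obtain ⟨m, rfl⟩ : ∃ m, n = m + 1 := ⟨n - 1, by omega⟩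
  rw [Finset.sum_range_succ, Finset.sum_range_succ']
  simp only [Measure.mapₗ_apply_of_measurable hT, Measure.map_dirac' hT,
    ← Function.iterate_succ_apply' T]
  congr 2

end Empirical

section Tightness

variable {S : Type*} [TopologicalSpace S] {A : S → S → Prop} [DiscreteTopology S] [Countable S]

lemma isCompact_letters {F : ℕ → Set S} (hF : ∀ i, (F i).Finite) :
    IsCompact {x : Space A | ∀ i, x.1 i ∈ F i} := by
  have hcl : IsClosed {x : ℕ → S | ∀ i, A (x i) (x (i + 1))} := by
    have : {x : ℕ → S | ∀ i, A (x i) (x (i + 1))}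
        = ⋂ i, (fun x : ℕ → S => (x i, x (i + 1))) ⁻¹' {p | A p.1 p.2} := by ext; simp
    rw [this]
    exact isClosed_iInter fun i => (isClosed_discrete _).preimage (by fun_prop)
  have he : IsClosedEmbedding (fun x : Space A => x.1) := hcl.isClosedEmbedding_subtypeVal
  have := he.isCompact_preimage (isCompact_univ_pi fun i => (hF i).isCompact)
  convert this using 1
  ext x; simp [Set.mem_pi]

lemma measurableSet_coord (i : ℕ) (F : Set S) : MeasurableSet {x : Space A | x.1 i ∈ F} :=
  Determined.measurableSet (n := i + 1) fun x y h hx => by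
    have := h i (by omega)
    simp only [Set.mem_ofPred_eq] at hx ⊢
    rwa [← this]

open Classical in
lemma exists_finite_letters (μ : Measure (Space A)) [IsProbabilityMeasure μ] {ε : ℝ≥0∞}
    (hε : ε ≠ 0) : ∃ F : Finset S, ∑' s : S, (if s ∈ F then 0 else μ {x | x.1 0 = s}) ≤ ε := by
  have h1 : ∑' s : S, μ {x : Space A | x.1 0 = s} ≤ 1 := by
    refine (tsum_meas_le_meas_iUnion_of_disjoint μ (fun s => ?_) ?_).trans prob_le_one
    · exact measurableSet_coord 0 {s}
    · intro s t hst
      exact Set.disjoint_left.2 fun x h h' => hst (h.symm.trans h')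
  have h2 := ENNReal.tendsto_tsum_compl_atTop_zero (ne_top_of_le_ne_top ENNReal.one_ne_top h1)
  obtain ⟨F, hF⟩ := (h2.eventually (ge_mem_nhds (pos_iff_ne_zero.2 hε))).exists
  refine ⟨F, le_trans (le_of_eq ?_) hF⟩
  refine Eq.trans ?_ (tsum_subtype {s | s ∉ F} fun s => μ {x : Space A | x.1 0 = s}).symm
  refine tsum_congr fun s => ?_
  by_cases h : s ∈ F <;> simp [h]

lemma measure_cyl_le_prod {φ : Space A → ℝ} {μ : Measure (Space A)}
    [IsProbabilityMeasure μ] {c₀ P : ℝ} (hc₀ : 1 ≤ c₀) (hG : IsGibbsWith A φ μ c₀ P)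
    (x : Space A) (n : ℕ) :
    μ (cyl x n) ≤ ENNReal.ofReal c₀ ^ (n + 1) * ∏ i : Fin n, μ {y | y.1 0 = x.1 i} := by
  have h := mass_le_prod hc₀ hG x n
  have h1 : ∀ i, cyl ((shift A)^[i] x) 1 = {y | y.1 0 = x.1 i} := by
    intro i; ext y; simp [cyl, shift_iterate_apply]
  rw [← ofReal_measureReal (measure_ne_top μ (cyl x n))]
  refine (ENNReal.ofReal_le_ofReal h).trans (le_of_eq ?_)
  rw [ENNReal.ofReal_mul (by positivity), ENNReal.ofReal_pow (by positivity),
    ENNReal.ofReal_prod_of_nonneg fun i _ => mass_nonneg _ _, Finset.prod_range]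
  congr 1
  refine Finset.prod_congr rfl fun i _ => ?_
  rw [mass, ofReal_measureReal (measure_ne_top _ _), h1]

open Classical in
/-- Chebyshev bound for the frequency of letters outside a finite set. -/
lemma tsum_cyl_le_of_visits {φ : Space A → ℝ} {μ : Measure (Space A)}
    [IsProbabilityMeasure μ] {c₀ P : ℝ} (hc₀ : 1 ≤ c₀) (hG : IsGibbsWith A φ μ c₀ P)
    {β : ℝ} {F : Finset S}
    (hF : ∑' s : S, (if s ∈ F then 0 else μ {x : Space A | x.1 0 = s})
      ≤ ENNReal.ofReal (Real.exp (-β))) {n : ℕ} (hn : 0 < n) {t : ℝ} (hβ : 0 ≤ β) :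
    ∑' x : perSet (shift A) n, {x : Space A | t * n ≤ visits (shift A) x n {y | y.1 0 ∉ F}}.indicator
      (fun x => μ (cyl x n)) x.1
      ≤ ENNReal.ofReal c₀ ^ (n + 1) * 2 ^ n * ENNReal.ofReal (Real.exp (-(β * (t * n)))) := by
  set w : S → ℝ≥0∞ := fun s => if s ∈ F then 1 else ENNReal.ofReal (Real.exp β) with hw
  have hsum : ∑' s : S, μ {x : Space A | x.1 0 = s} * w s ≤ 2 := by
    have h1 : ∑' s : S, μ {x : Space A | x.1 0 = s} ≤ 1 := by
      refine (tsum_meas_le_meas_iUnion_of_disjoint μ (fun s => ?_) ?_).trans prob_le_one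
      · exact measurableSet_coord 0 {s}
      · intro s t hst
        exact Set.disjoint_left.2 fun x h h' => hst (h.symm.trans h')
    calc _ ≤ ∑' s : S, (μ {x : Space A | x.1 0 = s} + ENNReal.ofReal (Real.exp β) *
          (if s ∈ F then 0 else μ {x : Space A | x.1 0 = s})) := by
          refine ENNReal.tsum_le_tsum fun s => ?_
          by_cases h : s ∈ F
          · simp [hw, h]
          · simp [hw, h, mul_comm]
      _ ≤ 1 + ENNReal.ofReal (Real.exp β) * ENNReal.ofReal (Real.exp (-β)) := by
          rw [ENNReal.tsum_add, ENNReal.tsum_mul_left]; gcongr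
      _ = 2 := by
          rw [← ENNReal.ofReal_mul (by positivity), ← Real.exp_add]; norm_num
  have hpt : ∀ x : Space A,
      {x : Space A | t * n ≤ visits (shift A) x n {y | y.1 0 ∉ F}}.indicator
        (fun x => μ (cyl x n)) x ≤ ENNReal.ofReal c₀ ^ (n + 1) *
          ENNReal.ofReal (Real.exp (-(β * (t * n)))) *
          ∏ i : Fin n, (fun s => μ {x : Space A | x.1 0 = s} * w s) (pref n x i) := by
    intro x
    by_cases hx : x ∈ {x : Space A | t * n ≤ visits (shift A) x n {y | y.1 0 ∉ F}}
    swap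
    · simp [indicator_of_notMem hx]
    rw [indicator_of_mem hx]
    refine (measure_cyl_le_prod hc₀ hG x n).trans ?_
    rw [Finset.prod_mul_distrib]
    have h1 : ∏ i : Fin n, w (pref n x i)
        = ENNReal.ofReal (Real.exp β) ^ visits (shift A) x n {y | y.1 0 ∉ F} := by
      rw [visits, ← Finset.prod_const, Finset.prod_filter, Finset.prod_range]
      refine Finset.prod_congr rfl fun i _ => ?_
      by_cases h : x.1 i ∈ F <;> simp [hw, pref, shift_iterate_apply, h]
    have h2 : 1 ≤ ENNReal.ofReal (Real.exp (-(β * (t * n)))) * ∏ i : Fin n, w (pref n x i) := by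
      rw [h1, ← ENNReal.ofReal_pow (by positivity), ← ENNReal.ofReal_mul (by positivity),
        ← Real.exp_nat_mul, ← Real.exp_add, ENNReal.one_le_ofReal, Real.one_le_exp_iff]
      have h3 : t * n ≤ visits (shift A) x n {y | y.1 0 ∉ F} := hx
      nlinarith
    calc _ = ENNReal.ofReal c₀ ^ (n + 1) * (∏ i : Fin n, μ {y : Space A | y.1 0 = x.1 i}) * 1 :=
          (mul_one _).symm
      _ ≤ ENNReal.ofReal c₀ ^ (n + 1) * (∏ i : Fin n, μ {y : Space A | y.1 0 = x.1 i}) *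
          (ENNReal.ofReal (Real.exp (-(β * (t * n)))) * ∏ i : Fin n, w (pref n x i)) := by gcongr
      _ = _ := by simp only [pref]; ring
  calc _ ≤ ∑' x : perSet (shift A) n, ENNReal.ofReal c₀ ^ (n + 1) *
          ENNReal.ofReal (Real.exp (-(β * (t * n)))) *
          ∏ i : Fin n, (fun s => μ {x : Space A | x.1 0 = s} * w s) (pref n x.1 i) :=
        ENNReal.tsum_le_tsum fun x => hpt x
    _ ≤ ENNReal.ofReal c₀ ^ (n + 1) * ENNReal.ofReal (Real.exp (-(β * (t * n)))) *
          ∑' s : Fin n → S, ∏ i : Fin n, (fun s => μ {x : Space A | x.1 0 = s} * w s) (s i) := by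
        rw [ENNReal.tsum_mul_left]
        refine mul_le_mul_right ?_ _
        exact ENNReal.tsum_comp_le_tsum_of_injective
          (f := fun x : perSet (shift A) n => pref n x.1)
          (fun x y h => Subtype.ext (perSet_ext hn x.2 y.2 (pref_eq_iff.1 h))) _
    _ ≤ ENNReal.ofReal c₀ ^ (n + 1) * ENNReal.ofReal (Real.exp (-(β * (t * n)))) * 2 ^ n := by
        rw [tsum_pi_prod n fun _ => fun s => μ {x : Space A | x.1 0 = s} * w s, Finset.prod_const,
          Finset.card_univ, Fintype.card_fin]
        gcongr
    _ = _ := by ring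

end Tightness

section Tightness

lemma Invariant.measure_iterate_preimage {X : Type*} [MeasurableSpace X] {T : X → X}
    (hT : Measurable T) {μ : Measure X} (h : Invariant T μ) (i : ℕ) {E : Set X}
    (hE : MeasurableSet E) : μ (T^[i] ⁻¹' E) = μ E := by
  have : MeasurePreserving T μ μ := ⟨hT, h⟩
  exact (this.iterate i).measure_preimage hE.nullMeasurableSet

variable {S : Type*} [TopologicalSpace S] {A : S → S → Prop} [DiscreteTopology S] [Countable S]

lemma exists_compact_theta_compl_le {φ : Space A → ℝ} {μ : Measure (Space A)}
    [IsProbabilityMeasure μ] {c₀ P : ℝ} (hc₀ : 1 ≤ c₀) (hG : IsGibbsWith A φ μ c₀ P) {L : ℝ}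
    (hL : 0 < L) : ∃ K : Set (ProbabilityMeasure (Space A)), IsCompact K ∧
      ∃ C : ℝ≥0∞, C ≠ ⊤ ∧ ∀ n, 0 < n →
        theta μ n Kᶜ ≤ C * ENNReal.ofReal (Real.exp (-(L * n))) := by
  classical
  set L' := L + Real.log 2 + Real.log c₀ with hL'
  have hlog2 := Real.log_nonneg (show (1 : ℝ) ≤ 2 by norm_num)
  have hlogc := Real.log_nonneg hc₀
  have hF : ∀ j : ℕ, ∃ F : Finset S,
      ∑' s : S, (if s ∈ F then 0 else μ {x : Space A | x.1 0 = s})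
        ≤ ENNReal.ofReal (Real.exp (-(2 ^ j * (L' + j)))) := fun j =>
    exists_finite_letters μ (by simp [Real.exp_pos])
  choose F hF using hF
  set C : ℕ → Set (Space A) := fun J => {x | ∀ i, x.1 i ∈ (F (J + i) : Set S)} with hC
  have hCc : ∀ J, IsCompact (C J) := fun J => isCompact_letters fun i => (F (J + i)).finite_toSet
  set u : ℕ → ℝ≥0 := fun J => 2 * (1 / 2) ^ J with hu
  have hut : Tendsto u atTop (𝓝 0) := by
    have := (NNReal.tendsto_pow_atTop_nhds_zero_of_lt_one (r := (1 / 2 : ℝ≥0))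
      (by rw [← NNReal.coe_lt_coe]; norm_num)).const_mul 2
    simpa [hu] using this
  refine ⟨_, isCompact_setOfPred_probabilityMeasure_mass_eq_compl_isCompact_le hut hCc
    (Or.inl inferInstance), 2 * ENNReal.ofReal c₀, by finiteness, fun n hn => ?_⟩
  set K : Set (ProbabilityMeasure (Space A)) := {ν | ∀ J, ν (C J)ᶜ ≤ u J} with hK
  have hbad : ∀ x ∈ perSet (shift A) n, empirical (shift A) x n ∈ Kᶜ →
      ∃ j : ℕ, ((1 / 2 : ℝ) ^ j) * n ≤ visits (shift A) x n {y | y.1 0 ∉ F j} := by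
    intro x hx hxK
    by_contra! hcon
    refine hxK fun J => ?_
    have hE : ∀ j, MeasurableSet {y : Space A | y.1 0 ∉ F j} := fun j =>
      measurableSet_coord 0 {s | s ∉ F j}
    have h1 : ∀ j, (empirical (shift A) x n : Measure (Space A)) {y | y.1 0 ∉ F j}
        ≤ ((1 / 2 : ℝ≥0) ^ j : ℝ≥0) := by
      intro j
      rw [← ofReal_measureReal (measure_ne_top _ _), empirical_real _ _ hn (hE j),
        ENNReal.ofReal_le_iff_le_toReal (by finiteness)]
      rw [div_le_iff₀ (by positivity)]
      simpa using (hcon j).le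
    have hinv := invariant_empirical measurable_shift hn hx
    have h2 : (C J)ᶜ ⊆ ⋃ i, (shift A)^[i] ⁻¹' {y | y.1 0 ∉ F (J + i)} := by
      intro y hy
      simp only [hC, mem_compl_iff, Set.mem_ofPred_eq, not_forall] at hy
      obtain ⟨i, hi⟩ := hy
      exact mem_iUnion.2 ⟨i, by simpa [shift_iterate_apply] using hi⟩
    have h3 : (empirical (shift A) x n : Measure (Space A)) (C J)ᶜ ≤ u J := by
      refine (measure_mono h2).trans ((measure_iUnion_le _).trans ?_)
      simp_rw [hinv.measure_iterate_preimage measurable_shift _ (hE _)]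
      refine (ENNReal.tsum_le_tsum fun i => h1 (J + i)).trans (le_of_eq ?_)
      have h4 : ∀ i, (((1 / 2 : ℝ≥0) ^ (J + i) : ℝ≥0) : ℝ≥0∞)
          = ((1 / 2 : ℝ≥0) ^ J : ℝ≥0) * (2⁻¹ : ℝ≥0∞) ^ i := by
        intro i; rw [pow_add]; push_cast; congr 2; simp
      simp_rw [h4]
      rw [ENNReal.tsum_mul_left, ENNReal.tsum_geometric_two, hu]
      push_cast; ring
    rw [← ENNReal.coe_le_coe]
    simpa using h3
  have key : ∀ x : perSet (shift A) n,
      Kᶜ.indicator (fun _ => μ (cyl x.1 n)) (empirical (shift A) x.1 n) ≤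
      ∑' j : ℕ, {x : Space A | (1 / 2 : ℝ) ^ j * n ≤
        visits (shift A) x n {y | y.1 0 ∉ F j}}.indicator (fun x => μ (cyl x n)) x.1 := by
    intro x
    by_cases hx : empirical (shift A) x.1 n ∈ Kᶜ
    · obtain ⟨j, hj⟩ := hbad x.1 x.2 hx
      rw [indicator_of_mem hx]
      refine le_trans ?_ (ENNReal.le_tsum j)
      rw [indicator_of_mem (show x.1 ∈ {x : Space A | (1 / 2 : ℝ) ^ j * n ≤
        visits (shift A) x n {y | y.1 0 ∉ F j}} from hj)]
    · simp [indicator_of_notMem hx]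
  refine (ENNReal.tsum_le_tsum key).trans ?_
  rw [ENNReal.tsum_comm]
  have hj : ∀ j : ℕ, ∑' x : perSet (shift A) n, {x : Space A | (1 / 2 : ℝ) ^ j * n ≤
        visits (shift A) x n {y | y.1 0 ∉ F j}}.indicator (fun x => μ (cyl x n)) x.1
      ≤ ENNReal.ofReal c₀ * ENNReal.ofReal (Real.exp (-(L * n))) * (2⁻¹ : ℝ≥0∞) ^ j := by
    intro j
    refine (tsum_cyl_le_of_visits hc₀ hG (hF j) hn (by positivity)).trans ?_
    rw [show (2 : ℝ≥0∞) = ENNReal.ofReal 2 by simp, ← ENNReal.ofReal_inv_of_pos (by norm_num),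
      ← ENNReal.ofReal_pow (by positivity), ← ENNReal.ofReal_pow (by positivity),
      ← ENNReal.ofReal_pow (by positivity), ← ENNReal.ofReal_mul (by positivity),
      ← ENNReal.ofReal_mul (by positivity), ← ENNReal.ofReal_mul (by positivity),
      ← ENNReal.ofReal_mul (by positivity)]
    refine ENNReal.ofReal_le_ofReal ?_
    have e1 : 2 ^ j * (L' + j) * ((1 / 2 : ℝ) ^ j * n) = (L' + j) * n := by
      rw [one_div, inv_pow]; field_simp
    have e2 : Real.exp (-((L' + j) * n)) = Real.exp (-(L * n)) * ((2 : ℝ) ^ n)⁻¹ * (c₀ ^ n)⁻¹ *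
        Real.exp (-(j * n : ℝ)) := by
      have e3 : ((2 : ℝ) ^ n)⁻¹ = Real.exp (-(Real.log 2 * n)) := by
        rw [Real.exp_neg, mul_comm, Real.exp_nat_mul, Real.exp_log (by norm_num)]
      have e4 : (c₀ ^ n)⁻¹ = Real.exp (-(Real.log c₀ * n)) := by
        rw [Real.exp_neg, mul_comm, Real.exp_nat_mul, Real.exp_log (by positivity)]
      rw [e3, e4, ← Real.exp_add, ← Real.exp_add, ← Real.exp_add, hL']
      congr 1; ring
    have e5 : Real.exp (-(j * n : ℝ)) ≤ (2⁻¹ : ℝ) ^ j := by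
      have h1 : (1 : ℝ) ≤ n := by exact_mod_cast hn
      have h2 : Real.exp (-1) ≤ 2⁻¹ := by
        rw [Real.exp_neg]
        refine inv_anti₀ (by norm_num) ?_
        have := Real.add_one_le_exp 1; linarith
      calc Real.exp (-(j * n : ℝ)) ≤ Real.exp (j * (-1)) := by
            refine Real.exp_le_exp.2 ?_
            nlinarith [(Nat.cast_nonneg j : (0 : ℝ) ≤ j)]
        _ = Real.exp (-1) ^ j := Real.exp_nat_mul _ _
        _ ≤ _ := by gcongr
    rw [e1, e2]
    calc _ = c₀ * Real.exp (-(L * n)) * Real.exp (-(j * n : ℝ)) := by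
          field_simp
          ring
      _ ≤ _ := by gcongr
  refine (ENNReal.tsum_le_tsum hj).trans (le_of_eq ?_)
  rw [ENNReal.tsum_mul_left, ENNReal.tsum_geometric_two]; ring

end Tightness

section Generator

open scoped symmDiff

variable {S : Type*} [TopologicalSpace S] {A : S → S → Prop} [DiscreteTopology S] [Countable S]

lemma exists_determined_symmDiff_lt (ν : Measure (Space A)) [IsProbabilityMeasure ν]
    {E : Set (Space A)} (hE : MeasurableSet E) {ε : ℝ≥0∞} (hε : 0 < ε) :
    ∃ K, ∃ U : Set (Space A), Determined K U ∧ ν (U ∆ E) < ε := by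
  set 𝒞 : Set (Set (Space A)) := {U | ∃ K, Determined K U} with h𝒞
  have hring : IsSetRing 𝒞 := by
    have hun : ∀ U V : Set (Space A), U ∈ 𝒞 → V ∈ 𝒞 → U ∪ V ∈ 𝒞 := by
      rintro U V ⟨K, hU⟩ ⟨L, hV⟩
      exact ⟨max K L, (hU.mono (le_max_left _ _)).union (hV.mono (le_max_right _ _))⟩
    have hco : ∀ U : Set (Space A), U ∈ 𝒞 → Uᶜ ∈ 𝒞 := fun U ⟨K, hU⟩ => ⟨K, hU.compl⟩
    refine ⟨⟨0, fun x y _ h => h.elim⟩, fun U V hU hV => hun U V hU hV, fun U V hU hV => ?_⟩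
    have : U \ V = (Uᶜ ∪ V)ᶜ := by ext; simp
    rw [this]
    exact hco _ (hun _ _ (hco _ hU) hV)
  have hgen : (inferInstance : MeasurableSpace (Space A)) = MeasurableSpace.generateFrom 𝒞 := by
    refine le_antisymm ?_ (MeasurableSpace.generateFrom_le fun U ⟨K, hU⟩ => hU.measurableSet)
    rw [BorelSpace.measurable_eq (α := Space A)]
    refine MeasurableSpace.generateFrom_le fun G hG => ?_
    rw [isOpen_eq_iUnion_cylinder hG]
    refine MeasurableSet.biUnion (Set.to_countable _) fun w _ => ?_
    exact MeasurableSpace.measurableSet_generateFrom ⟨_, determined_cylinder w⟩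
  obtain ⟨U, ⟨K, hU⟩, h⟩ := exists_measure_symmDiff_lt_of_generateFrom_isSetRing (μ := ν) hring
    ⟨{univ}, Set.countable_singleton _, by
      rintro _ rfl; exact ⟨0, fun _ _ _ h => h⟩, by simp⟩ hgen hE hε
  exact ⟨K, U, hU, h⟩

/-- A finite measurable partition is approximated by one depending on finitely many coordinates. -/
lemma exists_determined_map (ν : Measure (Space A)) [IsProbabilityMeasure ν]
    {p : Space A → ℕ} (hp : Measurable p) (hfin : (range p).Finite) {ε : ℝ≥0∞} (hε : 0 < ε) :
    ∃ K, ∃ q : Space A → ℕ, (∀ x y : Space A, (∀ i < K, x.1 i = y.1 i) → q x = q y) ∧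
      ν {x | p x ≠ q x} ≤ ε := by
  classical
  set R := hfin.toFinset with hR
  by_cases hRe : R.card = 0
  · refine ⟨0, fun _ => 0, fun _ _ _ => rfl, ?_⟩
    have : IsEmpty (Space A) := by
      rw [Finset.card_eq_zero, hR, Set.Finite.toFinset_eq_empty, range_eq_empty_iff] at hRe
      exact hRe
    simp [Set.eq_empty_of_isEmpty]
  have hε' : 0 < ε / R.card := ENNReal.div_pos hε.ne' (by simp)
  choose K U hU hν using fun a : ℕ =>
    exists_determined_symmDiff_lt ν (hp (measurableSet_singleton a)) hε'
  refine ⟨R.sup K, fun x => ∑ a ∈ R, if x ∈ U a then a else 0, fun x y h => ?_, ?_⟩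
  · refine Finset.sum_congr rfl fun a ha => ?_
    have hKa : K a ≤ R.sup K := Finset.le_sup ha
    have : x ∈ U a ↔ y ∈ U a :=
      ⟨hU a x y fun i hi => h i (by omega), hU a y x fun i hi => (h i (by omega)).symm⟩
    simp [this]
  · have hsub : {x | p x ≠ ∑ a ∈ R, if x ∈ U a then a else 0} ⊆ ⋃ a ∈ R, U a ∆ (p ⁻¹' {a}) := by
      intro x hx
      by_contra hcon
      refine hx ?_
      have h1 : ∀ a ∈ R, (x ∈ U a ↔ p x = a) := by
        intro a ha
        have : x ∉ U a ∆ (p ⁻¹' {a}) := fun h => hcon (mem_biUnion ha h)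
        rw [Set.mem_symmDiff] at this
        simp only [mem_preimage, mem_singleton_iff] at this
        tauto
      have h2 : ∑ a ∈ R, (if x ∈ U a then a else 0) = ∑ a ∈ R, if p x = a then a else 0 :=
        Finset.sum_congr rfl fun a ha => by simp [h1 a ha]
      rw [h2, Finset.sum_ite_eq, if_pos (by simp [hR])]
    calc _ ≤ ∑ a ∈ R, ν (U a ∆ (p ⁻¹' {a})) :=
          (measure_mono hsub).trans (measure_biUnion_finset_le _ _)
      _ ≤ ∑ a ∈ R, ε / R.card := Finset.sum_le_sum fun a _ => (hν a).le
      _ = ε := by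
          rw [Finset.sum_const, nsmul_eq_mul, ENNReal.mul_div_cancel (by simpa using hRe) (by simp)]

/-- The iterated joins of a finite partition have at most the entropy of the words, up to a small
linear error. -/
lemma exists_partitionEntropy_le_add (ν : Measure (Space A)) [IsProbabilityMeasure ν]
    (hinv : Invariant (shift A) ν) {p : Space A → ℕ} (hp : Measurable p)
    (hfin : (range p).Finite) {η : ℝ≥0∞} (hη : η ≠ 0) :
    ∃ K, ∀ n : ℕ, partitionEntropy ν (fun x => fun i : Fin n => p ((shift A)^[i] x))
      ≤ partitionEntropy ν (pref (A := A) (n + K)) + n * η := by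
  classical
  set R := hfin.toFinset with hR
  have hRpos : R.card ≠ 0 := by
    obtain ⟨x⟩ : Nonempty (Space A) := nonempty_of_isProbabilityMeasure ν
    exact Finset.card_ne_zero_of_mem (a := p x) (by simp [hR])
  obtain ⟨δ, hδ0, hδ1, hδ⟩ : ∃ δ : ℝ, 0 < δ ∧ δ < 1 ∧ ENNReal.ofReal (-Real.log (1 - δ)) ≤ η / 2 := by
    have h1 : Tendsto (fun δ : ℝ => ENNReal.ofReal (-Real.log (1 - δ))) (𝓝[>] 0) (𝓝 0) := by
      have : ContinuousAt (fun δ : ℝ => ENNReal.ofReal (-Real.log (1 - δ))) 0 := by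
        refine ENNReal.continuous_ofReal.continuousAt.comp (ContinuousAt.neg ?_)
        exact ContinuousAt.log (by fun_prop) (by norm_num)
      have h2 := this.tendsto
      simp only [sub_zero, Real.log_one, neg_zero, ENNReal.ofReal_zero] at h2
      exact h2.mono_left nhdsWithin_le_nhds
    have h2 := h1.eventually (ge_mem_nhds (ENNReal.half_pos hη))
    have h3 : ∀ᶠ δ : ℝ in 𝓝[>] 0, 0 < δ ∧ δ < 1 := by
      filter_upwards [Ioo_mem_nhdsGT (show (0 : ℝ) < 1 by norm_num)] with δ h using h
    obtain ⟨δ, h4, h5⟩ := (h2.and h3).exists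
    exact ⟨δ, h5.1, h5.2, h4⟩
  set r : ℕ → ℕ → ℝ≥0∞ := fun a b => if a = b then ENNReal.ofReal (1 - δ) else
    if a ∈ R then ENNReal.ofReal (δ / R.card) else 0 with hr
  have hcard : (0 : ℝ) < R.card := by positivity
  set B := nlog (ENNReal.ofReal (δ / R.card)) with hB
  have hBt : B ≠ ⊤ := by rw [hB, nlog_ofReal (by positivity)]; exact ENNReal.ofReal_ne_top
  obtain ⟨K, q, hq, hpq⟩ := exists_determined_map ν hp hfin
    (ε := η / 2 / (B + 1)) (ENNReal.div_pos (ENNReal.half_pos hη).ne' (by finiteness))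
  have hqm : Measurable q := by
    refine measurable_to_countable' fun a => Determined.measurableSet (n := K) fun x y h hx => ?_
    rw [mem_preimage, mem_singleton_iff] at hx ⊢
    rw [← hx, hq x y h]
  refine ⟨K, fun n => ?_⟩
  have hrsum : ∀ b, ∑' a, r a b ≤ 1 := by
    intro b
    calc ∑' a, r a b ≤ ∑' a, ((if a = b then ENNReal.ofReal (1 - δ) else 0) +
          if a ∈ R then ENNReal.ofReal (δ / R.card) else 0) := by
          refine ENNReal.tsum_le_tsum fun a => ?_
          by_cases h : a = b <;> simp [hr, h]
      _ = ENNReal.ofReal (1 - δ) + ENNReal.ofReal δ := by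
          rw [ENNReal.tsum_add, tsum_ite_eq, tsum_eq_sum (s := R) (by simp +contextual),
            Finset.sum_ite_mem, Finset.inter_self, Finset.sum_const, nsmul_eq_mul,
            ← ENNReal.ofReal_natCast, ← ENNReal.ofReal_mul (by positivity)]
          congr 2; field_simp
      _ = 1 := by
          rw [← ENNReal.ofReal_add (by linarith) hδ0.le]; norm_num
  have hrm : ∀ i (a : ℕ), Measurable fun x => r a (q ((shift A)^[i] x)) := fun i a =>
    (measurable_of_countable (r a)).comp (hqm.comp (measurable_shift.iterate i))
  set Q : (Fin n → ℕ) → ℝ≥0∞ := fun a => ∫⁻ x, ∏ i : Fin n, r (a i) (q ((shift A)^[i] x)) ∂ν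
    with hQ
  have hQsum : ∑' a, Q a ≤ 1 := by
    have e : ∑' a, Q a =
        ∫⁻ x, ∑' a : Fin n → ℕ, ∏ i : Fin n, r (a i) (q ((shift A)^[i] x)) ∂ν :=
      (lintegral_tsum fun a =>
        (Finset.measurable_fun_prod _ fun (i : Fin n) _ => hrm i (a i)).aemeasurable).symm
    rw [e]
    calc _ ≤ ∫⁻ _, 1 ∂ν := by
          refine lintegral_mono fun x => ?_
          rw [tsum_pi_prod n fun i a => r a (q ((shift A)^[i] x))]
          exact Finset.prod_le_one' fun i _ => hrsum _
      _ = 1 := by simp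
  have hpm : Measurable fun x : Space A => fun i : Fin n => p ((shift A)^[i] x) :=
    measurable_pi_lambda _ fun i => hp.comp (measurable_shift.iterate i)
  refine (partitionEntropy_le_cross ν hpm Q hQsum).trans ?_
  have hpt : ∀ x : Space A, nlog (Q fun i : Fin n => p ((shift A)^[i] x)) ≤
      nlog (ν (cyl x (n + K))) +
        ∑ i : Fin n, nlog (r (p ((shift A)^[i] x)) (q ((shift A)^[i] x))) := by
    intro x
    have hQle : ν (cyl x (n + K)) * ∏ i : Fin n, r (p ((shift A)^[i] x)) (q ((shift A)^[i] x))
        ≤ Q fun i : Fin n => p ((shift A)^[i] x) := by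
      rw [mul_comm, ← lintegral_indicator_const (measurableSet_cyl _ _)]
      refine lintegral_mono fun y => ?_
      by_cases hy : y ∈ cyl x (n + K)
      · rw [indicator_of_mem hy]
        refine le_of_eq (Finset.prod_congr rfl fun i _ => ?_)
        congr 1
        refine hq _ _ fun j hj => ?_
        rw [shift_iterate_apply, shift_iterate_apply]
        exact (hy _ (by omega)).symm
      · simp [indicator_of_notMem hy]
    refine (nlog_anti hQle (ne_top_of_le_ne_top ENNReal.one_ne_top
      ((ENNReal.le_tsum _).trans hQsum))).trans ?_
    have hrt : ∀ a b, r a b ≠ ⊤ := fun a b =>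
      ne_top_of_le_ne_top ENNReal.one_ne_top ((ENNReal.le_tsum a).trans (hrsum b))
    refine (nlog_mul_le (measure_ne_top _ _) (ENNReal.prod_ne_top fun i _ => hrt _ _)).trans ?_
    exact add_le_add le_rfl (nlog_prod_le _ _ fun i _ => hrt _ _)
  have hm1 : Measurable fun x : Space A => nlog (r (p x) (q x)) :=
    (measurable_of_countable fun z : ℕ × ℕ => nlog (r z.1 z.2)).comp (hp.prodMk hqm)
  have hone : ∫⁻ x, nlog (r (p x) (q x)) ∂ν ≤ η := by
    have hneq : MeasurableSet {x | p x ≠ q x} := (measurableSet_eq_fun hp hqm).compl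
    calc _ ≤ ∫⁻ x, (η / 2 + {x | p x ≠ q x}.indicator (fun _ => B) x) ∂ν := by
          refine lintegral_mono fun x => ?_
          by_cases h : p x = q x
          · simp only [hr, h, if_true]
            rw [nlog_ofReal (by linarith)]
            exact hδ.trans le_self_add
          · rw [indicator_of_mem (show x ∈ {x | p x ≠ q x} from h)]
            simp only [hr, h, if_false]
            rw [if_pos (by simp [hR])]
            exact le_add_self
      _ = η / 2 + B * ν {x | p x ≠ q x} := by
          rw [lintegral_add_left measurable_const, lintegral_indicator_const hneq]; simp
      _ ≤ η / 2 + (B + 1) * (η / 2 / (B + 1)) := by gcongr; exact le_self_add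
      _ = η := by
          rw [ENNReal.mul_div_cancel (by simp) (by finiteness), ENNReal.add_halves]
  let _ : MeasurableSpace (Fin (n + K) → S) := ⊤
  have hpr : Measurable (pref (A := A) (n + K)) := measurable_pref (n + K) id
  rw [partitionEntropy_eq_lintegral ν hpr]
  refine (lintegral_mono hpt).trans ?_
  have hmi : ∀ i : Fin n, Measurable fun x : Space A =>
      nlog (r (p ((shift A)^[i] x)) (q ((shift A)^[i] x))) := fun i =>
    hm1.comp (measurable_shift.iterate i)
  rw [lintegral_add_right _ (Finset.measurable_fun_sum _ fun i _ => hmi i),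
    lintegral_finsetSum _ fun i _ => hmi i]
  refine add_le_add (le_of_eq (lintegral_congr fun x => by rw [pref_preimage])) ?_
  have : ∀ i : Fin n, ∫⁻ x, nlog (r (p ((shift A)^[i] x)) (q ((shift A)^[i] x))) ∂ν ≤ η := by
    intro i
    have hmp : MeasurePreserving (shift A)^[i] ν ν :=
      MeasurePreserving.iterate ⟨measurable_shift, hinv⟩ i
    rw [hmp.lintegral_comp hm1]
    exact hone
  calc _ ≤ ∑ _i : Fin n, η := Finset.sum_le_sum fun i _ => this i
    _ = n * η := by simp

/-- The entropy is bounded by the growth of the entropies of words. -/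
lemma eventually_le_partitionEntropy_pref (ν : Measure (Space A)) [IsProbabilityMeasure ν]
    (hinv : Invariant (shift A) ν) {h : ℝ} (h0 : 0 ≤ h)
    (hh : ENNReal.ofReal h < entropy (shift A) ν) :
    ∀ᶠ k : ℕ in atTop, ENNReal.ofReal (h * k) ≤ partitionEntropy ν (pref (A := A) k) := by
  obtain ⟨h', hh1, hh2⟩ := exists_between hh
  have hh't : h' ≠ ⊤ := hh2.ne_top
  lift h' to ℝ≥0 using hh't
  have hlt : h < h' := by
    rw [← ENNReal.ofReal_coe_nnreal] at hh1
    exact (ENNReal.ofReal_lt_ofReal_iff_of_nonneg h0).1 hh1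
  simp only [entropy, lt_iSup_iff] at hh2
  obtain ⟨p, ⟨hp, hfin⟩, hlim⟩ := hh2
  have hev := eventually_lt_of_lt_liminf hlim
  obtain ⟨K, hK⟩ := exists_partitionEntropy_le_add ν hinv hp hfin
    (η := ENNReal.ofReal ((h' - h) / 2)) (by simpa using hlt)
  obtain ⟨n₀, hn₀⟩ := eventually_atTop.1 hev
  obtain ⟨n₁, hn₁⟩ := exists_nat_ge (h * K / ((h' - h) / 2))
  filter_upwards [eventually_ge_atTop (n₀ + n₁ + K + 1)] with k hk
  obtain ⟨n, rfl⟩ : ∃ n, k = n + K := ⟨k - K, by omega⟩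
  have hnpos : (0 : ℝ) < n := by exact_mod_cast (by omega : 0 < n)
  have h1 := (hn₀ n (by omega)).le
  have h2 : ENNReal.ofReal (h' * n) ≤
      partitionEntropy ν (fun x => fun i : Fin n => p ((shift A)^[i] x)) := by
    rw [mul_comm, ENNReal.ofReal_mul hnpos.le, ENNReal.ofReal_coe_nnreal]
    calc _ ≤ ENNReal.ofReal n * (ENNReal.ofReal (n : ℝ)⁻¹ *
          partitionEntropy ν (fun x => fun i : Fin n => p ((shift A)^[i] x))) := by gcongr
      _ = _ := by
        rw [← mul_assoc, ← ENNReal.ofReal_mul hnpos.le, mul_inv_cancel₀ hnpos.ne']; simp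
  have h3 := h2.trans (hK n)
  have h4 : ENNReal.ofReal (h * (n + K : ℕ)) + n * ENNReal.ofReal ((h' - h) / 2)
      ≤ ENNReal.ofReal (h' * n) := by
    rw [← ENNReal.ofReal_natCast n, ← ENNReal.ofReal_mul (by positivity),
      ← ENNReal.ofReal_add (by positivity) (by nlinarith)]
    refine ENNReal.ofReal_le_ofReal ?_
    have h5 : (n₁ : ℝ) ≤ n := by exact_mod_cast (by omega : n₁ ≤ n)
    have h6 : h * K ≤ n * ((h' - h) / 2) := by
      rw [← div_le_iff₀ (by linarith)]; linarith
    push_cast; nlinarith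
  exact (ENNReal.add_le_add_iff_right (by finiteness)).1 (h4.trans h3)

end Generator

section LawOfLargeNumbers

variable {W : Type*} [Countable W] [MeasurableSpace W] [MeasurableSingletonClass W]

lemma infinitePi_cylinder (ρ : Measure W) [IsProbabilityMeasure ρ] (m : ℕ) (s : Fin m → W) :
    Measure.infinitePi (fun _ : ℕ => ρ) {ω | (fun i : Fin m => ω i) = s} = ∏ i, ρ {s i} := by
  classical
  obtain ⟨w⟩ := nonempty_of_isProbabilityMeasure ρ
  have : {ω : ℕ → W | (fun i : Fin m => ω i) = s} =
      Set.pi (Finset.range m) fun i => {if h : i < m then s ⟨i, h⟩ else w} := by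
    ext ω
    simp only [Set.mem_ofPred_eq, Set.mem_pi, Finset.coe_range, Set.mem_Iio, mem_singleton_iff,
      funext_iff]
    constructor
    · intro h i hi
      rw [dif_pos hi]; exact h ⟨i, hi⟩
    · intro h i
      have := h i i.2
      rwa [dif_pos i.2] at this
  rw [this, Measure.infinitePi_pi _ (fun i _ => measurableSet_singleton _),
    ← Fin.prod_univ_eq_prod_range (fun i => ρ {if h : i < m then s ⟨i, h⟩ else w})]
  exact Finset.prod_congr rfl fun i _ => by simp

lemma infinitePi_of_prefix (ρ : Measure W) [IsProbabilityMeasure ρ] (m : ℕ)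
    (E : Set (Fin m → W)) :
    Measure.infinitePi (fun _ : ℕ => ρ) {ω | (fun i : Fin m => ω i) ∈ E} =
      ∑' s : E, ∏ i, ρ {s.1 i} := by
  have : {ω : ℕ → W | (fun i : Fin m => ω i) ∈ E} =
      ⋃ s : E, {ω | (fun i : Fin m => ω i) = s.1} := by
    ext ω; simp
  rw [this, measure_iUnion]
  · exact tsum_congr fun s => infinitePi_cylinder ρ m s.1
  · intro s s' h
    refine Set.disjoint_left.2 fun ω h1 h2 => h (Subtype.ext (Eq.trans (Eq.symm h1) h2))
  · intro s
    have : Measurable fun ω : ℕ → W => fun i : Fin m => ω i :=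
      measurable_pi_lambda _ fun i => measurable_pi_apply _
    exact this (measurableSet_singleton s.1)

/-- A one-sided weak law of large numbers, in terms of words. -/
lemma eventually_half_le_tsum_prod (ρ : Measure W) [IsProbabilityMeasure ρ] {ι : Type*}
    [Finite ι] (f : ι → W → ℝ) (hf : ∀ j, Integrable (f j) ρ) {δ : ℝ} (hδ : 0 < δ) :
    ∀ᶠ m : ℕ in atTop, 2⁻¹ ≤ ∑' s : {s : Fin m → W |
      ∀ j, m * (∫ w, f j w ∂ρ - δ) ≤ ∑ i, f j (s i)}, ∏ i, ρ {s.1 i} := by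
  classical
  have := Fintype.ofFinite ι
  set Q := Measure.infinitePi (fun _ : ℕ => ρ) with hQ
  have hmap : ∀ i, Measure.map (fun ω : ℕ → W => ω i) Q = ρ := fun i =>
    Measure.infinitePi_map_eval (fun _ : ℕ => ρ) i
  have hfm : ∀ j, Measurable (f j) := fun j => measurable_of_countable _
  have hae : ∀ j, ∀ᵐ ω ∂Q, Tendsto (fun m : ℕ => (∑ i ∈ Finset.range m, f j (ω i)) / m) atTop
      (𝓝 (∫ w, f j w ∂ρ)) := by
    intro j
    have h1 : Integrable (fun ω : ℕ → W => f j (ω 0)) Q := by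
      have : Integrable (f j) (Measure.map (fun ω : ℕ → W => ω 0) Q) := by rw [hmap]; exact hf j
      exact this.comp_measurable (measurable_pi_apply 0)
    have h2 : ProbabilityTheory.iIndepFun (fun (i : ℕ) (ω : ℕ → W) => f j (ω i)) Q :=
      ProbabilityTheory.iIndepFun_infinitePi (X := fun (_ : ℕ) => f j) fun _ => hfm j
    have h3 : ∀ i, ProbabilityTheory.IdentDistrib (fun ω : ℕ → W => f j (ω i))
        (fun ω : ℕ → W => f j (ω 0)) Q Q := by
      intro i
      have : ProbabilityTheory.IdentDistrib (fun ω : ℕ → W => ω i) (fun ω : ℕ → W => ω 0) Q Q :=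
        ⟨(measurable_pi_apply i).aemeasurable, (measurable_pi_apply 0).aemeasurable, by
          rw [hmap, hmap]⟩
      exact this.comp (hfm j)
    have := ProbabilityTheory.strong_law_ae_real (fun (i : ℕ) (ω : ℕ → W) => f j (ω i)) h1
      (fun a b hab => h2.indepFun hab) h3
    have he : ∫ ω, f j (ω 0) ∂Q = ∫ w, f j w ∂ρ := by
      have := integral_map (μ := Q) (φ := fun ω : ℕ → W => ω 0) (f := f j)
        (measurable_pi_apply 0).aemeasurable (hfm j).aestronglyMeasurable
      rw [hmap 0] at this
      exact this.symm
    rwa [he] at this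
  have hmeas : ∀ j (m : ℕ), Measurable fun ω : ℕ → W => (∑ i ∈ Finset.range m, f j (ω i)) / m :=
    fun j m => (Finset.measurable_fun_sum _ fun i _ =>
      (hfm j).comp (measurable_pi_apply i)).div_const _
  have htm : ∀ j, TendstoInMeasure Q (fun (m : ℕ) (ω : ℕ → W) =>
      (∑ i ∈ Finset.range m, f j (ω i)) / m) atTop (fun _ => ∫ w, f j w ∂ρ) := fun j =>
    tendstoInMeasure_of_tendsto_ae (fun m => (hmeas j m).aestronglyMeasurable) (hae j)
  have hsum : Tendsto (fun m : ℕ => ∑ j, Q {ω | ENNReal.ofReal δ ≤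
      edist ((∑ i ∈ Finset.range m, f j (ω i)) / m) (∫ w, f j w ∂ρ)}) atTop (𝓝 0) := by
    have := tendsto_finsetSum Finset.univ fun j _ => htm j (ENNReal.ofReal δ)
      (ENNReal.ofReal_pos.2 hδ)
    simpa using this
  filter_upwards [hsum.eventually_lt_const (show (0 : ℝ≥0∞) < 2⁻¹ by simp), eventually_gt_atTop 0]
    with m hm hm0
  rw [← infinitePi_of_prefix]
  set E : Set (ℕ → W) := {ω | (fun i : Fin m => ω i) ∈ {s : Fin m → W |
      ∀ j, m * (∫ w, f j w ∂ρ - δ) ≤ ∑ i, f j (s i)}} with hE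
  have hEm : MeasurableSet E := by
    have : Measurable fun ω : ℕ → W => fun i : Fin m => ω i :=
      measurable_pi_lambda _ fun i => measurable_pi_apply _
    exact this (Set.to_countable _).measurableSet
  have hcompl : Q Eᶜ ≤ 2⁻¹ := by
    refine le_trans (measure_mono (t := ⋃ j, {ω | ENNReal.ofReal δ ≤
      edist ((∑ i ∈ Finset.range m, f j (ω i)) / m) (∫ w, f j w ∂ρ)}) ?_) ?_
    · intro ω hω
      simp only [hE, mem_compl_iff, Set.mem_ofPred_eq, not_forall, not_le] at hω
      obtain ⟨j, hj⟩ := hω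
      refine mem_iUnion.2 ⟨j, ?_⟩
      rw [Set.mem_ofPred_eq, edist_dist]
      refine ENNReal.ofReal_le_ofReal ?_
      rw [Fin.sum_univ_eq_sum_range (fun i => f j (ω i))] at hj
      have : (∑ i ∈ Finset.range m, f j (ω i)) / m < ∫ w, f j w ∂ρ - δ := by
        rw [div_lt_iff₀ (by exact_mod_cast hm0)]; linarith
      rw [Real.dist_eq, abs_sub_comm]
      exact le_trans (by linarith) (le_abs_self _)
    · exact (measure_iUnion_fintype_le _ _).trans hm.le
  have h1 : Q E + Q Eᶜ = 1 := prob_add_prob_compl hEm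
  have h2 : (2⁻¹ : ℝ≥0∞) + 2⁻¹ = 1 := ENNReal.inv_two_add_inv_two
  by_contra hlt
  have : Q E + Q Eᶜ < 2⁻¹ + 2⁻¹ := ENNReal.add_lt_add_of_lt_of_le (by finiteness) (not_le.1 hlt) hcompl
  rw [h1, h2] at this
  exact lt_irrefl _ this

end LawOfLargeNumbers

section Concatenation

lemma visits_add {X : Type*} (T : X → X) (x : X) (a b : ℕ) (E : Set X) :
    visits T x (a + b) E = visits T x a E + visits T (T^[a] x) b E := by
  classical
  simp only [visits, Finset.card_filter, Finset.sum_range_add]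
  congr 1
  refine Finset.sum_congr rfl fun i _ => ?_
  rw [← Function.iterate_add_apply, add_comm i a]

lemma visits_mono {X : Type*} (T : X → X) (x : X) {a b : ℕ} (h : a ≤ b) (E : Set X) :
    visits T x a E ≤ visits T x b E := by
  obtain ⟨c, rfl⟩ := Nat.exists_eq_add_of_le h
  rw [visits_add]; omega

variable {S : Type*} [TopologicalSpace S] {A : S → S → Prop}

lemma Determined.visits_congr {l k : ℕ} {V : Set (Space A)} (hV : Determined l V) (hl : l ≤ k)
    {x y : Space A} (h : ∀ i < k, x.1 i = y.1 i) :
    visits (shift A) x (k - l) V = visits (shift A) y (k - l) V := by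
  classical
  unfold visits
  congr 1
  refine Finset.filter_congr fun i hi => ?_
  rw [Finset.mem_range] at hi
  have : ∀ j < l, ((shift A)^[i] x).1 j = ((shift A)^[i] y).1 j := fun j hj => by
    rw [shift_iterate_apply, shift_iterate_apply]; exact h _ (by omega)
  exact ⟨fun hx => hV _ _ this hx, fun hy => hV _ _ (fun j hj => (this j hj).symm) hy⟩

lemma mass_concat_le {φ : Space A → ℝ} {μ : Measure (Space A)}
    [IsProbabilityMeasure μ] {c₀ P : ℝ} (hc₀ : 1 ≤ c₀) (hG : IsGibbsWith A φ μ c₀ P)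
    {q : ℕ} (a : ℕ → ℝ) (ha : ∀ t, 0 ≤ a t) (y : Space A) (m : ℕ)
    (h : ∀ t < m, a t ≤ mass μ ((shift A)^[t * q] y) q) :
    ((c₀ ^ 3)⁻¹) ^ m * ∏ t ∈ Finset.range m, a t ≤ mass μ y (m * q) := by
  induction m with
  | zero => simp [mass_zero]
  | succ m ih =>
    have hc : 0 ≤ (c₀ ^ 3)⁻¹ := by positivity
    rw [Nat.succ_mul]
    refine le_trans ?_ (mul_mass_le_mass_add hc₀ hG y (m * q) q)
    rw [Finset.prod_range_succ, pow_succ]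
    calc _ = (c₀ ^ 3)⁻¹ * ((c₀ ^ 3)⁻¹ ^ m * ∏ t ∈ Finset.range m, a t) * a m := by ring
      _ ≤ _ := by
        gcongr
        · exact ha m
        · exact mul_nonneg (by positivity) (mass_nonneg (μ := μ) _ _)
        · exact ih fun t ht => h t (by omega)
        · exact h m (by omega)

lemma sum_visits_le {q : ℕ} (v : ℕ → ℕ) (V : Set (Space A)) (y : Space A) (m : ℕ)
    (h : ∀ t < m, v t ≤ visits (shift A) ((shift A)^[t * q] y) q V) :
    ∑ t ∈ Finset.range m, v t ≤ visits (shift A) y (m * q) V := by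
  induction m with
  | zero => simp
  | succ m ih =>
    rw [Nat.succ_mul, visits_add, Finset.sum_range_succ]
    exact add_le_add (ih fun t ht => h t (by omega)) (h m (by omega))

variable [DiscreteTopology S] [Countable S]

/-- Arbitrary words of a given length can be concatenated to periodic points, with control of
the mass and of the frequencies. -/
lemma exists_periodic_concat (hprim : FinitelyPrimitive A) {φ : Space A → ℝ}
    {μ : Measure (Space A)} [IsProbabilityMeasure μ] {c₀ P : ℝ} (hc₀ : 1 ≤ c₀)
    (hG : IsGibbsWith A φ μ c₀ P) :
    ∃ (N : ℕ) (κ : ℝ), 0 < κ ∧ ∀ k, 1 ≤ k → ∃ c : ℝ, 0 < c ∧ ∀ m, 1 ≤ m → ∀ r, N + 1 ≤ r →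
      r < N + 1 + (k + 2 * N + 1) → ∃ p : (Fin m → Word A k) → Space A,
        (∀ s, p s ∈ perSet (shift A) (m * (k + 2 * N + 1) + r)) ∧ Function.Injective p ∧
        (∀ s, c * κ ^ m * ∏ i, mass μ (s i).rep k ≤ mass μ (p s) (m * (k + 2 * N + 1) + r)) ∧
        ∀ s, ∀ V : Set (Space A), ∀ l ≤ k, Determined l V →
          ∑ i, visits (shift A) (s i).rep (k - l) V ≤
            visits (shift A) (p s) (m * (k + 2 * N + 1) + r) V := by
  obtain ⟨x₀⟩ : Nonempty (Space A) := nonempty_of_isProbabilityMeasure μ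
  obtain ⟨N, κ, hκ, hκ1, h1, h2⟩ := exists_loops_mass hprim (x₀.1 0) hc₀ hG
  have hc0 : 0 < c₀ := by linarith
  refine ⟨N, (c₀ ^ 3)⁻¹ * κ, by positivity, fun k hk => ?_⟩
  have hfill : ∀ r, ∃ f : ℕ → S, N + 1 ≤ r → IsLoop A (x₀.1 0) r f := fun r => by
    by_cases hr : N + 1 ≤ r
    · obtain ⟨f, hf⟩ := h2 r hr ⟨x₀, rfl⟩
      exact ⟨f, fun _ => hf⟩
    · exact ⟨fun _ => x₀.1 0, fun h => absurd h hr⟩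
  choose f hf using hfill
  have hfm : ∀ r, ∃ d : ℝ, 0 < d ∧ (N + 1 ≤ r → ∀ y : Space A, (∀ i < r, y.1 i = f r i) →
      d ≤ mass μ y r) := fun r => by
    by_cases hr : N + 1 ≤ r
    · have hr0 : 0 < r := by omega
      refine ⟨mass μ (perPt hr0 (f r) (hf r hr)) r, mass_pos hc₀ hG _ _, fun _ y hy => ?_⟩
      exact le_of_eq (mass_congr μ fun i hi => by rw [perPt_apply _ _ _ hi, hy i hi])
    · exact ⟨1, one_pos, fun h => absurd h hr⟩
  choose d hd hdm using hfm
  obtain ⟨d₀, hd₀, hdd⟩ : ∃ d₀ : ℝ, 0 < d₀ ∧ ∀ r < N + 1 + (k + 2 * N + 1), d₀ ≤ d r := by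
    have hne : (Finset.range (N + 1 + (k + 2 * N + 1))).Nonempty := ⟨0, by simp⟩
    obtain ⟨r, -, hr⟩ := Finset.exists_min_image _ d hne
    exact ⟨d r, hd r, fun r' hr' => hr r' (by simpa using hr')⟩
  refine ⟨(c₀ ^ 3)⁻¹ * d₀, by positivity, fun m hm r hr hr' => ?_⟩
  choose g hg hgx hgm using fun s : Word A k => h1 k hk s.rep
  set q := k + 2 * N + 1 with hq
  have hqpos : 0 < q := by omega
  have hmq : 0 < m * q := by positivity
  have hpos : 0 < m * q + r := by omega
  set B : (Fin m → Word A k) → ℕ → ℕ → S := fun s t =>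
    if h : t < m then g (s ⟨t, h⟩) else g (s ⟨0, hm⟩) with hB
  have hBl : ∀ s t, IsLoop A (x₀.1 0) q (B s t) := fun s t => by
    simp only [hB]; split_ifs <;> exact hg _
  have hBt : ∀ s (t : Fin m), B s t = g (s t) := fun s t => by simp [hB]
  have hl : ∀ s, IsLoop A (x₀.1 0) (m * q + r) (glue (m * q) (conc q (B s)) (f r)) := fun s =>
    isLoop_glue hmq (isLoop_conc hqpos (hBl s) m) (hf r hr)
  set p : (Fin m → Word A k) → Space A := fun s => perPt hpos _ (hl s) with hp
  have hpb : ∀ s (t : Fin m), ∀ i < q, ((shift A)^[t * q] (p s)).1 i = g (s t) i := by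
    intro s t i hi
    have hlt : t * q + i < m * q := by
      have : (t + 1) * q ≤ m * q := Nat.mul_le_mul_right _ t.2
      rw [Nat.succ_mul] at this; omega
    rw [shift_iterate_apply, hp, perPt_apply _ _ _ (by omega)]
    rw [glue, if_pos hlt, conc_mul_add _ hi, hBt]
  have hpx : ∀ s (t : Fin m), ∀ i < k,
      ((shift A)^[N + 1] ((shift A)^[t * q] (p s))).1 i = (s t).rep.1 i := by
    intro s t i hi
    rw [shift_iterate_apply, hpb s t _ (by omega), hgx _ i hi]
  have hpf : ∀ s, ∀ i < r, ((shift A)^[m * q] (p s)).1 i = f r i := by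
    intro s i hi
    rw [shift_iterate_apply, hp, perPt_apply _ _ _ (by omega), glue, if_neg (by omega)]
    congr 1; omega
  refine ⟨p, fun s => perPt_mem _ _ _, ?_, ?_, ?_⟩
  · intro s s' h
    funext t
    refine Subtype.ext ?_
    rw [← (s t).pref_rep, ← (s' t).pref_rep, pref_eq_iff]
    intro i hi
    rw [← hpx s t i hi, ← hpx s' t i hi, h]
  · intro s
    refine le_trans ?_ (mul_mass_le_mass_add hc₀ hG (p s) (m * q) r)
    have e1 : ((c₀ ^ 3)⁻¹) ^ m * ∏ t ∈ Finset.range m,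
        (if h : t < m then κ * mass μ (s ⟨t, h⟩).rep k else 0) ≤ mass μ (p s) (m * q) := by
      refine mass_concat_le hc₀ hG _ (fun t => ?_) _ _ fun t ht => ?_
      · split_ifs
        · exact mul_nonneg hκ.le (mass_nonneg _ _)
        · exact le_rfl
      · rw [dif_pos ht]
        exact hgm _ _ (hpb s ⟨t, ht⟩)
    rw [← Fin.prod_univ_eq_prod_range
      (fun t => if h : t < m then κ * mass μ (s ⟨t, h⟩).rep k else 0)] at e1
    simp only [Fin.is_lt, dif_pos, Fin.eta, Finset.prod_mul_distrib, Finset.prod_const,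
      Finset.card_univ, Fintype.card_fin] at e1
    have e2 : d₀ ≤ mass μ ((shift A)^[m * q] (p s)) r :=
      (hdd r hr').trans (hdm r hr _ (hpf s))
    calc _ = (c₀ ^ 3)⁻¹ * (((c₀ ^ 3)⁻¹) ^ m * (κ ^ m * ∏ i, mass μ (s i).rep k)) * d₀ := by
          rw [mul_pow]; ring
      _ ≤ _ := by
          gcongr
          exact mul_nonneg (by positivity) (mass_nonneg (μ := μ) _ _)
  · intro s V l hlk hV
    have e1 : ∑ t ∈ Finset.range m, (if h : t < m then
        visits (shift A) (s ⟨t, h⟩).rep (k - l) V else 0) ≤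
        visits (shift A) (p s) (m * q) V := by
      refine sum_visits_le _ _ _ _ fun t ht => ?_
      rw [dif_pos ht, ← hV.visits_congr hlk (hpx s ⟨t, ht⟩)]
      have : visits (shift A) ((shift A)^[t * q] (p s)) q V ≥
          visits (shift A) ((shift A)^[t * q] (p s)) (N + 1 + (k - l)) V :=
        visits_mono _ _ (by omega) _
      rw [visits_add _ _ (N + 1) (k - l)] at this
      exact le_trans (Nat.le_add_left _ _) this
    rw [← Fin.sum_univ_eq_sum_range
      (fun t => if h : t < m then visits (shift A) (s ⟨t, h⟩).rep (k - l) V else 0)] at e1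
    simp only [Fin.is_lt, dif_pos, Fin.eta] at e1
    exact e1.trans (visits_mono _ _ (by omega) _)

end Concatenation

section Integrals

lemma partitionEntropy_eq_lintegral_log {X : Type*} [MeasurableSpace X] {α : Type*} [Countable α]
    [MeasurableSpace α] [MeasurableSingletonClass α] (μ : Measure X) [IsProbabilityMeasure μ]
    {g : X → α} (hg : Measurable g) :
    partitionEntropy μ g =
      ∫⁻ x, ENNReal.ofReal (-Real.log (μ (g ⁻¹' {g x})).toReal) ∂μ := by
  rw [lintegral_comp_countable μ hg
    (fun a => ENNReal.ofReal (-Real.log (μ (g ⁻¹' {a})).toReal)), partitionEntropy]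
  refine tsum_congr fun a => ?_
  conv_rhs => rw [← ENNReal.ofReal_toReal (measure_ne_top μ (g ⁻¹' {a}))]
  rw [ENNReal.toReal_ofReal ENNReal.toReal_nonneg, ← ENNReal.ofReal_mul' ENNReal.toReal_nonneg]
  congr 1; ring

lemma integrable_of_le_of_integralGtBot {X : Type*} [MeasurableSpace X] {μ : Measure X}
    [IsProbabilityMeasure μ] {φ : X → ℝ} (hφ : Measurable φ) {C : ℝ} (hC : ∀ x, φ x ≤ C)
    (h : IntegralGtBot φ μ) : Integrable φ μ := by
  refine ⟨hφ.aestronglyMeasurable, ?_⟩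
  have : ∀ x, ‖φ x‖ₑ ≤ ENNReal.ofReal C + ENNReal.ofReal (-φ x) := fun x => by
    rw [Real.enorm_eq_ofReal_abs]
    rcases le_total 0 (φ x) with h | h
    · rw [abs_of_nonneg h]
      exact (ENNReal.ofReal_le_ofReal (hC x)).trans le_self_add
    · rw [abs_of_nonpos h]
      exact le_add_self
  refine lt_of_le_of_lt (lintegral_mono this) ?_
  rw [lintegral_add_left measurable_const]
  simp only [lintegral_const, measure_univ, mul_one]
  exact ENNReal.add_lt_top.2 ⟨by finiteness, lt_top_iff_ne_top.2 h⟩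

lemma eintegral_eq_integral {X : Type*} [MeasurableSpace X] {μ : Measure X} {φ : X → ℝ}
    (h : Integrable φ μ) : eintegral φ μ = ((∫ x, φ x ∂μ : ℝ) : EReal) := by
  have h1 : ∫⁻ x, ENNReal.ofReal (φ x) ∂μ ≠ ⊤ := h.lintegral_lt_top.ne
  have h2 : ∫⁻ x, ENNReal.ofReal (-φ x) ∂μ ≠ ⊤ := h.neg.lintegral_lt_top.ne
  rw [eintegral, integral_eq_lintegral_pos_part_sub_lintegral_neg_part h, EReal.coe_sub]
  lift ∫⁻ x, ENNReal.ofReal (φ x) ∂μ to ℝ≥0 using h1 with a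
  lift ∫⁻ x, ENNReal.ofReal (-φ x) ∂μ to ℝ≥0 using h2 with b
  rfl

variable {S : Type*} [TopologicalSpace S] {A : S → S → Prop}

lemma integrable_birkhoff {X : Type*} [MeasurableSpace X] {T : X → X} (hT : Measurable T)
    {μ : Measure X} (hinv : Invariant T μ) {φ : X → ℝ} (hφ : Integrable φ μ) (k : ℕ) :
    Integrable (birkhoff T φ k) μ :=
  integrable_finsetSum _ fun i _ =>
    (MeasurePreserving.iterate ⟨hT, hinv⟩ i).integrable_comp_of_integrable hφ

lemma integral_birkhoff {X : Type*} [MeasurableSpace X] {T : X → X} (hT : Measurable T)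
    {μ : Measure X} (hinv : Invariant T μ) {φ : X → ℝ} (hφ : Integrable φ μ) (k : ℕ) :
    ∫ x, birkhoff T φ k x ∂μ = k * ∫ x, φ x ∂μ := by
  have hmp := fun i => MeasurePreserving.iterate (f := T) ⟨hT, hinv⟩ i
  unfold birkhoff
  have hci : ∀ i, Integrable (fun x => φ (T^[i] x)) μ := fun i =>
    (hmp i).integrable_comp_of_integrable hφ
  rw [integral_finsetSum _ fun i _ => hci i]
  have : ∀ i, ∫ x, φ (T^[i] x) ∂μ = ∫ x, φ x ∂μ := fun i => by
    rw [← integral_map (hmp i).measurable.aemeasurable, (hmp i).map_eq]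
    rw [(hmp i).map_eq]; exact hφ.aestronglyMeasurable
  simp [this]

end Integrals

section Code

variable {S : Type*} [TopologicalSpace S] {A : S → S → Prop}

/-- The initial word of a point, as an element of `Word A k`. -/
def code (k : ℕ) (x : Space A) : Word A k := ⟨pref k x, x, rfl⟩

lemma code_rep_apply {k : ℕ} (x : Space A) {i : ℕ} (hi : i < k) :
    (code k x).rep.1 i = x.1 i :=
  pref_eq_iff.1 (code k x).pref_rep i hi

lemma code_preimage {k : ℕ} (s : Word A k) : code k ⁻¹' {s} = cyl s.rep k := by
  rw [← pref_preimage, s.pref_rep]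
  ext x
  simp only [mem_preimage, mem_singleton_iff, Subtype.ext_iff]
  rfl

variable [DiscreteTopology S] [Countable S]

lemma measurable_code_comp (k : ℕ) {α : Type*} [MeasurableSpace α] (f : Word A k → α) :
    Measurable fun x : Space A => f (code k x) := by
  classical
  rcases isEmpty_or_nonempty (Space A) with h | ⟨⟨x₀⟩⟩
  · exact measurable_of_empty _
  · have := measurable_pref (A := A) k
      (fun a => if h : a ∈ Set.range (pref (A := A) k) then f ⟨a, h⟩ else f (code k x₀))
    simpa [code] using this

lemma measurable_mass (μ : Measure (Space A)) (k : ℕ) : Measurable fun x => mass μ x k := by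
  have := measurable_code_comp (A := A) k fun s => mass μ s.rep k
  refine Eq.mp (congrArg Measurable ?_) this
  funext x
  exact mass_congr μ fun i hi => code_rep_apply x hi

lemma integrable_log_mass {φ : Space A → ℝ}
    {μ : Measure (Space A)} [IsProbabilityMeasure μ] {c₀ P : ℝ} (hc₀ : 1 ≤ c₀)
    (hG : IsGibbsWith A φ μ c₀ P) {ν : Measure (Space A)} [IsProbabilityMeasure ν]
    (hinv : Invariant (shift A) ν) (hi : Integrable φ ν) (k : ℕ) :
    Integrable (fun x => Real.log (mass μ x k)) ν ∧
      k * (∫ x, φ x ∂ν - P) - Real.log c₀ ≤ ∫ x, Real.log (mass μ x k) ∂ν := by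
  have hb := integrable_birkhoff measurable_shift hinv hi k
  have h1 : Integrable (fun x => birkhoff (shift A) φ k x - (P * k + Real.log c₀)) ν :=
    hb.sub (integrable_const _)
  have h2 : Integrable (fun x => birkhoff (shift A) φ k x - (P * k - Real.log c₀)) ν :=
    hb.sub (integrable_const _)
  have h_int : Integrable (fun x => Real.log (mass μ x k)) ν :=
    integrable_of_le_of_le (measurable_mass μ k).log.aestronglyMeasurable
      (Eventually.of_forall fun x => by have := birkhoff_le hc₀ hG x k; linarith)
      (Eventually.of_forall fun x => by have := le_birkhoff hc₀ hG x k; linarith) h1 h2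
  refine ⟨h_int, ?_⟩
  have := integral_mono h1 h_int fun x => by have := birkhoff_le hc₀ hG x k; linarith
  rw [integral_sub hb (integrable_const _), integral_birkhoff measurable_shift hinv hi] at this
  simp only [integral_const, probReal_univ, smul_eq_mul, one_mul] at this
  linarith

lemma integrable_log_mass_self {φ : Space A → ℝ}
    {μ : Measure (Space A)} [IsProbabilityMeasure μ] {c₀ P : ℝ} (hc₀ : 1 ≤ c₀)
    (hG : IsGibbsWith A φ μ c₀ P) {ν : Measure (Space A)} [IsProbabilityMeasure ν]
    (hinv : Invariant (shift A) ν) (hi : Integrable φ ν) (k : ℕ) :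
    Integrable (fun x => Real.log (mass ν x k)) ν ∧ ∀ a : ℝ, 0 ≤ a →
      ENNReal.ofReal a ≤ partitionEntropy ν (pref (A := A) k) →
        a ≤ -∫ x, Real.log (mass ν x k) ∂ν := by
  let _ : MeasurableSpace (Fin k → S) := ⊤
  have hpr : Measurable (pref (A := A) k) := measurable_pref k id
  have hH : partitionEntropy ν (pref (A := A) k) =
      ∫⁻ x, ENNReal.ofReal (-Real.log (mass ν x k)) ∂ν := by
    rw [partitionEntropy_eq_lintegral_log ν hpr]
    refine lintegral_congr fun x => ?_
    rw [pref_preimage]; rfl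
  have hnn : ∀ x, 0 ≤ -Real.log (mass ν x k) := fun x =>
    neg_nonneg.2 (Real.log_nonpos (mass_nonneg _ _) (mass_le_one _ _))
  have hfin : partitionEntropy ν (pref (A := A) k) ≠ ⊤ := by
    refine ne_top_of_le_ne_top ?_ (partitionEntropy_le_cross ν hpr (fun a => μ (pref k ⁻¹' {a}))
      (tsum_measure_fiber μ hpr).le)
    have : ∀ x : Space A, nlog (μ (pref k ⁻¹' {pref k x})) =
        ENNReal.ofReal (-Real.log (mass μ x k)) := fun x => by
      rw [pref_preimage, ← nlog_ofReal (mass_pos hc₀ hG x k), mass,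
        ofReal_measureReal (measure_ne_top _ _)]
    simp only [this]
    exact (integrable_log_mass hc₀ hG hinv hi k).1.neg.lintegral_lt_top.ne
  have h_int : Integrable (fun x => -Real.log (mass ν x k)) ν := by
    refine ⟨(measurable_mass ν k).log.neg.aestronglyMeasurable, ?_⟩
    rw [hasFiniteIntegral_iff_ofReal (Eventually.of_forall hnn), ← hH]
    exact lt_top_iff_ne_top.2 hfin
  refine ⟨by simpa using h_int.neg, fun a ha h => ?_⟩
  rw [hH, ← ofReal_integral_eq_lintegral_ofReal h_int (Eventually.of_forall hnn),
    ENNReal.ofReal_le_ofReal_iff (integral_nonneg hnn), integral_neg] at h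
  exact h

lemma integral_visits {ν : Measure (Space A)} [IsProbabilityMeasure ν]
    (hinv : Invariant (shift A) ν) {V : Set (Space A)} (hV : MeasurableSet V) (k : ℕ) :
    Integrable (fun x => (visits (shift A) x k V : ℝ)) ν ∧
      ∫ x, (visits (shift A) x k V : ℝ) ∂ν = k * ν.real V := by
  classical
  have hi : Integrable (V.indicator fun _ => (1 : ℝ)) ν := (integrable_const 1).indicator hV
  have : (fun x : Space A => (visits (shift A) x k V : ℝ)) =
      birkhoff (shift A) (V.indicator fun _ => (1 : ℝ)) k := by
    funext x
    simp [visits, birkhoff, indicator_apply]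
  rw [this]
  refine ⟨integrable_birkhoff measurable_shift hinv hi k, ?_⟩
  rw [integral_birkhoff measurable_shift hinv hi]
  simp [integral_indicator_const, hV]

end Code

section LowerBound

variable {S : Type*} [TopologicalSpace S] {A : S → S → Prop} [DiscreteTopology S] [Countable S]

lemma exp_mul_prod_le {m : ℕ} {a b : Fin m → ℝ} (ha : ∀ i, 0 ≤ a i) (hb : ∀ i, 0 < b i) {D : ℝ}
    (h : D ≤ ∑ i, (Real.log (b i) - Real.log (a i))) : Real.exp D * ∏ i, a i ≤ ∏ i, b i := by
  by_cases h0 : ∃ i, a i = 0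
  · obtain ⟨i, hi⟩ := h0
    rw [Finset.prod_eq_zero (Finset.mem_univ i) hi, mul_zero]
    exact Finset.prod_nonneg fun i _ => (hb i).le
  · push Not at h0
    have ha' : ∀ i, 0 < a i := fun i => lt_of_le_of_ne (ha i) (h0 i).symm
    rw [Finset.sum_sub_distrib, ← Real.log_prod fun i _ => (hb i).ne',
      ← Real.log_prod fun i _ => (ha' i).ne'] at h
    have hA : 0 < ∏ i, a i := Finset.prod_pos fun i _ => ha' i
    have hB : 0 < ∏ i, b i := Finset.prod_pos fun i _ => hb i
    calc _ = Real.exp (D + Real.log (∏ i, a i)) := by rw [Real.exp_add, Real.exp_log hA]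
      _ ≤ Real.exp (Real.log (∏ i, b i)) := Real.exp_le_exp.2 (by linarith)
      _ = _ := Real.exp_log hB

/-- Law of large numbers for the words of length `k` of an invariant measure, combined with the
comparison of `ν` and the Gibbs state. -/
lemma eventually_le_tsum_prod_mass {φ : Space A → ℝ} {μ : Measure (Space A)}
    [IsProbabilityMeasure μ] {c₀ P : ℝ} (hc₀ : 1 ≤ c₀) (hG : IsGibbsWith A φ μ c₀ P)
    {ν : Measure (Space A)} [IsProbabilityMeasure ν] (hinv : Invariant (shift A) ν)
    (hi : Integrable φ ν) {k l : ℕ} (hl : l ≤ k) (D : Finset (Set (Space A)))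
    (hD : ∀ U ∈ D, Determined l U) {a : ℝ} (ha : 0 ≤ a)
    (hak : ENNReal.ofReal a ≤ partitionEntropy ν (pref (A := A) k)) :
    ∀ᶠ m : ℕ in atTop, ENNReal.ofReal
        (2⁻¹ * Real.exp (m * (a + k * (∫ x, φ x ∂ν - P) - Real.log c₀ - 1))) ≤
      ∑' s : {s : Fin m → Word A k | ∀ U ∈ D,
        m * ((k - l : ℕ) * ν.real U - 1) ≤ ∑ i, (visits (shift A) (s i).rep (k - l) U : ℝ)},
        ENNReal.ofReal (∏ i, mass μ (s.1 i).rep k) := by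
  have hWc : Countable (Word A k) := inferInstance
  let _ : MeasurableSpace (Word A k) := ⊤
  have hcode : Measurable (code (A := A) k) := measurable_code_comp k id
  set ρ : Measure (Word A k) := ν.map (code k) with hρ
  have hρp : IsProbabilityMeasure ρ := Measure.isProbabilityMeasure_map hcode.aemeasurable
  have hρs : ∀ s, ρ {s} = ENNReal.ofReal (mass ν s.rep k) := fun s => by
    rw [hρ, Measure.map_apply hcode (measurableSet_singleton s), code_preimage, mass,
      ofReal_measureReal (measure_ne_top _ _)]
  set f : Option D → Word A k → ℝ := fun j s => match j with
    | none => Real.log (mass μ s.rep k) - Real.log (mass ν s.rep k)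
    | some U => visits (shift A) s.rep (k - l) U.1 with hf
  have hf0 : ∀ s, f none s = Real.log (mass μ s.rep k) - Real.log (mass ν s.rep k) := fun _ => rfl
  have hf1 : ∀ U s, f (some U) s = visits (shift A) s.rep (k - l) U.1 := fun _ _ => rfl
  clear_value f
  have hfn : ∀ x : Space A, f none (code k x) =
      Real.log (mass μ x k) - Real.log (mass ν x k) := fun x => by
    simp only [hf0, mass_congr μ fun i hi => code_rep_apply x hi,
      mass_congr ν fun i hi => code_rep_apply x hi]
  have hfs : ∀ (U : D) (x : Space A), f (some U) (code k x) = visits (shift A) x (k - l) U.1 :=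
    fun U x => by
      rw [hf1]
      rw [(hD U.1 U.2).visits_congr hl fun i hi => code_rep_apply x hi]
  obtain ⟨hi1, hi2⟩ := integrable_log_mass hc₀ hG hinv hi k
  obtain ⟨hi3, hi4⟩ := integrable_log_mass_self hc₀ hG hinv hi k
  have hUm : ∀ U ∈ D, MeasurableSet U := fun U hU => (hD U hU).measurableSet
  have hfi : ∀ j, Integrable (f j) ρ := fun j => by
    rw [hρ, integrable_map_measure (measurable_of_countable _).aestronglyMeasurable
      hcode.aemeasurable]
    cases j with
    | none =>
      refine (hi1.sub hi3).congr (Eventually.of_forall fun x => ?_)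
      exact (hfn x).symm
    | some U =>
      refine (integral_visits hinv (hUm U.1 U.2) (k - l)).1.congr (Eventually.of_forall fun x => ?_)
      exact (hfs U x).symm
  have h_int : ∀ j, ∫ s, f j s ∂ρ = ∫ x, f j (code k x) ∂ν := fun j => by
    rw [hρ, integral_map hcode.aemeasurable (measurable_of_countable _).aestronglyMeasurable]
  have hn : a + k * (∫ x, φ x ∂ν - P) - Real.log c₀ ≤ ∫ s, f none s ∂ρ := by
    rw [h_int]
    simp only [hfn]
    rw [integral_sub hi1 hi3]
    have := hi4 a ha hak
    linarith
  have hs : ∀ U : D, ∫ s, f (some U) s ∂ρ = (k - l : ℕ) * ν.real U.1 := fun U => by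
    rw [h_int]
    simp only [hfs]
    exact (integral_visits hinv (hUm U.1 U.2) (k - l)).2
  filter_upwards [eventually_half_le_tsum_prod ρ f hfi one_pos] with m hm
  set E : ℝ := Real.exp (m * (a + k * (∫ x, φ x ∂ν - P) - Real.log c₀ - 1)) with hE
  set T1 := {s : Fin m → Word A k | ∀ j, m * (∫ w, f j w ∂ρ - 1) ≤ ∑ i, f j (s i)} with hT1
  set T2 := {s : Fin m → Word A k | ∀ U ∈ D,
        m * ((k - l : ℕ) * ν.real U - 1) ≤ ∑ i, (visits (shift A) (s i).rep (k - l) U : ℝ)}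
  have hT : ∀ s ∈ T1, s ∈ T2 := fun s h U hU => by
    have := h (some ⟨U, hU⟩)
    rw [hs] at this
    simp only [hf1] at this
    exact this
  calc ENNReal.ofReal (2⁻¹ * E) = ENNReal.ofReal E * 2⁻¹ := by
        rw [mul_comm, ENNReal.ofReal_mul (Real.exp_pos _).le, ENNReal.ofReal_inv_of_pos two_pos,
          ENNReal.ofReal_ofNat]
    _ ≤ ENNReal.ofReal E * ∑' s : T1, ∏ i, ρ {s.1 i} := by gcongr
    _ = ∑' s : T1, ENNReal.ofReal E * ∏ i, ρ {s.1 i} := ENNReal.tsum_mul_left.symm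
    _ ≤ ∑' s : T1, ENNReal.ofReal (∏ i, mass μ (s.1 i).rep k) := by
        refine ENNReal.tsum_le_tsum fun s => ?_
        simp only [hρs]
        rw [← ENNReal.ofReal_prod_of_nonneg fun i _ => mass_nonneg (μ := ν) _ _,
          ← ENNReal.ofReal_mul (Real.exp_pos _).le]
        refine ENNReal.ofReal_le_ofReal (exp_mul_prod_le (fun i => mass_nonneg (μ := ν) _ _)
          (fun i => mass_pos hc₀ hG _ _) ?_)
        have h1 := s.2 none
        simp only [hf0 (s.1 _)] at h1
        refine le_trans ?_ h1
        gcongr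
    _ ≤ _ := ENNReal.tsum_comp_le_tsum_of_injective
        (f := fun s : T1 => (⟨s.1, hT s.1 s.2⟩ : T2))
        (fun s t h => Subtype.ext (congrArg (fun z : T2 => z.1) h))
        (fun s : T2 => ENNReal.ofReal (∏ i, mass μ (s.1 i).rep k))

lemma exists_lt_entropy_of_lt_freeEnergy {X : Type*} [MeasurableSpace X] {T : X → X} {φ : X → ℝ}
    {C P x : ℝ} (hφ : Measurable φ) (hC : ∀ x, φ x ≤ C) {μ : ProbabilityMeasure X}
    (hx : (x : EReal) < freeEnergy T φ P μ) :
    Invariant T (μ : Measure X) ∧ Integrable φ (μ : Measure X) ∧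
      ∃ h : ℝ, 0 ≤ h ∧ x < h + (∫ y, φ y ∂(μ : Measure X) - P) ∧
        (h = 0 ∨ ENNReal.ofReal h < entropy T (μ : Measure X)) := by
  rw [freeEnergy] at hx
  split_ifs at hx with hcond
  swap
  · exact absurd hx not_lt_bot
  obtain ⟨hinv, hgt⟩ := hcond
  have hi : Integrable φ (μ : Measure X) := integrable_of_le_of_integralGtBot hφ hC hgt
  rw [eintegral_eq_integral hi] at hx
  refine ⟨hinv, hi, ?_⟩
  set I := ∫ y, φ y ∂(μ : Measure X)
  by_cases hlt : x < I - P
  · exact ⟨0, le_rfl, by linarith, Or.inl rfl⟩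
  have h2 : ENNReal.ofReal (x - (I - P)) < entropy T (μ : Measure X) := by
    by_contra hle
    rw [not_lt] at hle
    refine absurd hx (not_lt.2 ?_)
    have h3 : ((entropy T (μ : Measure X) : ℝ≥0∞) : EReal) ≤ ((x - (I - P) : ℝ) : EReal) := by
      refine (EReal.coe_ennreal_le_coe_ennreal_iff.2 hle).trans ?_
      rw [EReal.coe_ennreal_ofReal, max_eq_left (by linarith)]
    calc _ ≤ ((x - (I - P) : ℝ) : EReal) + ((I : ℝ) : EReal) - ((P : ℝ) : EReal) :=
          EReal.sub_le_sub (add_le_add h3 le_rfl) le_rfl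
      _ = _ := by
          rw [← EReal.coe_add, ← EReal.coe_sub]; congr 1; ring
  obtain ⟨h, hh1, hh2⟩ := exists_between h2
  lift h to ℝ≥0 using hh2.ne_top
  rw [← ENNReal.ofReal_coe_nnreal] at hh1 hh2
  have := (ENNReal.ofReal_lt_ofReal_iff_of_nonneg (by linarith)).1 hh1
  exact ⟨h, h.2, by linarith, Or.inr hh2⟩

/-- Large deviations lower bound near an invariant measure. -/
lemma eventually_exp_le_theta (hprim : FinitelyPrimitive A) {φ : Space A → ℝ} (hφ : Measurable φ)
    {μ : Measure (Space A)} [IsProbabilityMeasure μ] {c₀ P : ℝ} (hc₀ : 1 ≤ c₀)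
    (hG : IsGibbsWith A φ μ c₀ P) {G : Set (ProbabilityMeasure (Space A))} (hGo : IsOpen G)
    {ν : ProbabilityMeasure (Space A)} (hν : ν ∈ G) {β : ℝ}
    (hβ : (β : EReal) < freeEnergy (shift A) φ P ν) :
    ∀ᶠ n : ℕ in atTop, ENNReal.ofReal (Real.exp (β * n)) ≤ theta μ n G := by
  obtain ⟨hinv, hi, h1, h10, hβ1, hor⟩ :=
    exists_lt_entropy_of_lt_freeEnergy hφ (phi_le hc₀ hG) hβ
  set I := ∫ x, φ x ∂(ν : Measure (Space A)) with hI
  have hent : ∀ᶠ k : ℕ in atTop,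
      ENNReal.ofReal (h1 * k) ≤ partitionEntropy (ν : Measure (Space A)) (pref (A := A) k) := by
    rcases hor with rfl | h2
    · simp
    · exact eventually_le_partitionEntropy_pref _ hinv h10 h2
  obtain ⟨l, D, ε, hε, hD, hDG⟩ := exists_determined_nhds hGo hν
  obtain ⟨N, κ, hκ, hconc⟩ := exists_periodic_concat hprim hc₀ hG
  obtain ⟨k, hk1, hkl, hkent, hkε, hkβ⟩ : ∃ k : ℕ, 1 ≤ k ∧ l ≤ k ∧
      ENNReal.ofReal (h1 * k) ≤ partitionEntropy (ν : Measure (Space A)) (pref (A := A) k) ∧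
      (2 * N + 3 + l : ℝ) ≤ ε * k ∧
      β * (2 * N + 1) + Real.log c₀ + 1 - Real.log κ < (h1 + (I - P) - β) * k := by
    have e1 : Tendsto (fun k : ℕ => ε * k) atTop atTop :=
      tendsto_natCast_atTop_atTop.const_mul_atTop hε
    have e2 : Tendsto (fun k : ℕ => (h1 + (I - P) - β) * k) atTop atTop :=
      tendsto_natCast_atTop_atTop.const_mul_atTop (by linarith)
    exact ((eventually_ge_atTop 1).and ((eventually_ge_atTop l).and (hent.and
      ((e1.eventually_ge_atTop _).and (e2.eventually_gt_atTop _))))).exists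
  obtain ⟨c, hc, hconc⟩ := hconc k hk1
  set q := k + 2 * N + 1 with hq
  set R := N + 1 + q with hR
  set Dk := h1 * k + k * (I - P) - Real.log c₀ - 1 with hDk
  have hgap : 0 < Dk + Real.log κ - β * q := by
    rw [hDk, hq]; push_cast; linarith
  have hev1 := eventually_le_tsum_prod_mass hc₀ hG hinv hi hkl D hD
    (by positivity : (0 : ℝ) ≤ h1 * k) hkent
  have hev2 : ∀ᶠ m : ℕ in atTop, |β| * R - Real.log (c * 2⁻¹) ≤
      (Dk + Real.log κ - β * q) * m :=
    (tendsto_natCast_atTop_atTop.const_mul_atTop hgap).eventually_ge_atTop _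
  obtain ⟨M, hM⟩ := eventually_atTop.1 (hev1.and (hev2.and (eventually_ge_atTop (R + 1))))
  filter_upwards [eventually_ge_atTop (N + 1 + (M + 1) * q)] with n hn
  have hq0 : 0 < q := by omega
  obtain ⟨m, r, hmM, hr1, hr2, rfl⟩ : ∃ m r, M ≤ m ∧ N + 1 ≤ r ∧ r < R ∧ n = m * q + r := by
    refine ⟨(n - (N + 1)) / q, N + 1 + (n - (N + 1)) % q, ?_, by omega, ?_, ?_⟩
    · rw [Nat.le_div_iff_mul_le hq0]
      rw [Nat.succ_mul] at hn; omega
    · have := Nat.mod_lt (n - (N + 1)) hq0; omega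
    · have := Nat.div_add_mod' (n - (N + 1)) q; omega
  obtain ⟨hm1, hm2, hm3⟩ := hM m hmM
  obtain ⟨p, hp1, hp2, hp3, hp4⟩ := hconc m (by omega) r hr1 hr2
  have hm0 : (0 : ℝ) < m := by exact_mod_cast (by omega : 0 < m)
  set T := {s : Fin m → Word A k | ∀ U ∈ D, m * ((k - l : ℕ) * (ν : Measure (Space A)).real U - 1)
    ≤ ∑ i, (visits (shift A) (s i).rep (k - l) U : ℝ)} with hT
  have hrR : (r : ℝ) ≤ R := by exact_mod_cast hr2.le
  have hmem : ∀ s : T, empirical (shift A) (p s.1) (m * q + r) ∈ G := by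
    intro s
    refine hDG _ fun U hU => ?_
    have hpos : (0 : ℝ) < (m * q + r : ℕ) := by exact_mod_cast (by omega : 0 < m * q + r)
    rw [empirical_real _ _ (by omega) (hD U hU).measurableSet, lt_div_iff₀ hpos]
    have h1 := s.2 U hU
    have h2 : (∑ i, (visits (shift A) (s.1 i).rep (k - l) U : ℝ)) ≤
        visits (shift A) (p s.1) (m * q + r) U := by
      exact_mod_cast hp4 s.1 U l hkl (hD U hU)
    refine lt_of_lt_of_le ?_ (h1.trans h2)
    set v := (ν : Measure (Space A)).real U with hv
    have hv1 : v ≤ 1 := measureReal_le_one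
    have hv0 : 0 ≤ v := measureReal_nonneg
    have hm3' : (R : ℝ) + 1 ≤ m := by exact_mod_cast hm3
    have hrr : (0 : ℝ) ≤ r := by positivity
    rw [Nat.cast_sub hkl]
    push_cast [hq]
    have e1 : v * (m * (2 * N + 1 + l) + r) ≤ 1 * (m * (2 * N + 1 + l) + r) := by gcongr
    have e2 : m * (2 * N + 3 + l : ℝ) ≤ m * (ε * k) := by gcongr
    have e3 : 0 ≤ ε * (m * (2 * N + 1) + r) := by positivity
    nlinarith [e1, e2, e3]
  refine le_trans ?_ (tsum_le_theta μ (m * q + r) (R := T) (fun s => p s.1) (fun s => hp1 s.1)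
    (fun s t h => Subtype.ext (hp2 h)) hmem)
  calc ENNReal.ofReal (Real.exp (β * (m * q + r : ℕ)))
      ≤ ENNReal.ofReal (c * κ ^ m) * ENNReal.ofReal (2⁻¹ * Real.exp (m * Dk)) := by
        rw [← ENNReal.ofReal_mul (by positivity)]
        refine ENNReal.ofReal_le_ofReal ?_
        have : c * κ ^ m * (2⁻¹ * Real.exp (m * Dk)) =
            Real.exp (Real.log (c * 2⁻¹) + m * (Dk + Real.log κ)) := by
          have h1 : Real.exp (m * Real.log κ) = κ ^ m := by rw [Real.exp_nat_mul, Real.exp_log hκ]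
          rw [Real.exp_add, Real.exp_log (by positivity), mul_add, Real.exp_add, h1]
          ring
        rw [this]
        refine Real.exp_le_exp.2 ?_
        push_cast
        have e4 : β * r ≤ |β| * R := by
          calc β * r ≤ |β| * r := by gcongr; exact le_abs_self _
            _ ≤ _ := by gcongr
        linarith
    _ ≤ ENNReal.ofReal (c * κ ^ m) * ∑' s : T, ENNReal.ofReal (∏ i, mass μ (s.1 i).rep k) := by
        gcongr
    _ = ∑' s : T, ENNReal.ofReal (c * κ ^ m) * ENNReal.ofReal (∏ i, mass μ (s.1 i).rep k) :=
        ENNReal.tsum_mul_left.symm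
    _ ≤ _ := by
        refine ENNReal.tsum_le_tsum fun s => ?_
        rw [← ENNReal.ofReal_mul (by positivity), ← ofReal_measureReal (measure_ne_top _ _)]
        exact ENNReal.ofReal_le_ofReal (hp3 s.1)

end LowerBound

section Suspension

variable {X Ω : Type*} [MeasurableSpace X] [MeasurableSpace Ω]

/-- The average of the images of the measure `Q` under `T^[j] ∘ π`, for `j < n`. -/
noncomputable def suspend (T : X → X) (π : Ω → X) (Q : Measure Ω) (n : ℕ) : Measure X :=
  ∑ j ∈ Finset.range n, (n : ℝ≥0∞)⁻¹ • Measure.map (fun ω => T^[j] (π ω)) Q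

variable {T : X → X} {π : Ω → X} {Q : Measure Ω} {n : ℕ}

lemma sum_inv_natCast (hn : 0 < n) : ∑ _j ∈ Finset.range n, (n : ℝ≥0∞)⁻¹ = 1 := by
  rw [Finset.sum_const, Finset.card_range, nsmul_eq_mul, ENNReal.mul_inv_cancel]
  · exact_mod_cast hn.ne'
  · finiteness

lemma isProbabilityMeasure_suspend [IsProbabilityMeasure Q] (hT : Measurable T)
    (hπ : Measurable π) (hn : 0 < n) : IsProbabilityMeasure (suspend T π Q n) := by
  refine ⟨?_⟩
  rw [suspend, Measure.finsetSum_apply]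
  have : ∀ j, ((n : ℝ≥0∞)⁻¹ • Measure.map (fun ω => T^[j] (π ω)) Q) univ = (n : ℝ≥0∞)⁻¹ := by
    intro j
    have hm : Measurable fun ω => T^[j] (π ω) := (hT.iterate j).comp hπ
    rw [Measure.smul_apply, Measure.map_apply hm MeasurableSet.univ]
    simp
  simp only [this, sum_inv_natCast hn]

lemma invariant_suspend (hT : Measurable T) (hπ : Measurable π) {θ : Ω → Ω}
    (hθ : MeasurePreserving θ Q Q) (h : ∀ ω, T^[n] (π ω) = π (θ ω)) :
    Invariant T (suspend T π Q n) := by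
  have hm : ∀ j, Measurable fun ω => T^[j] (π ω) := fun j => (hT.iterate j).comp hπ
  have h1 : ∀ j, Measure.map T (Measure.map (fun ω => T^[j] (π ω)) Q) =
      Measure.map (fun ω => T^[j + 1] (π ω)) Q := fun j => by
    rw [Measure.map_map hT (hm j)]
    congr 1; funext ω; simp only [Function.comp, Function.iterate_succ_apply']
  have h2 : Measure.map (fun ω => T^[n] (π ω)) Q = Measure.map (fun ω => T^[0] (π ω)) Q := by
    have : (fun ω => T^[n] (π ω)) = (fun ω => T^[0] (π ω)) ∘ θ := by
      funext ω; simp [h]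
    rw [this, ← Measure.map_map (hm 0) hθ.measurable, hθ.map_eq]
  rw [Invariant, suspend, ← Measure.mapₗ_apply_of_measurable hT, map_sum]
  simp only [Measure.mapₗ_apply_of_measurable hT, Measure.map_smul, h1]
  rcases n with _ | m
  · simp
  · rw [Finset.sum_range_succ, Finset.sum_range_succ', h2]

lemma integral_suspend (hT : Measurable T) (hπ : Measurable π) (hn : 0 < n)
    {f : X → ℝ} (hf : Measurable f) (hi : ∀ j < n, Integrable (fun ω => f (T^[j] (π ω))) Q) :
    Integrable f (suspend T π Q n) ∧
      ∫ x, f x ∂(suspend T π Q n) = (n : ℝ)⁻¹ * ∫ ω, birkhoff T f n (π ω) ∂Q := by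
  have hm : ∀ j, Measurable fun ω => T^[j] (π ω) := fun j => (hT.iterate j).comp hπ
  have hi' : ∀ j ∈ Finset.range n,
      Integrable f ((n : ℝ≥0∞)⁻¹ • Measure.map (fun ω => T^[j] (π ω)) Q) := fun j hj => by
    refine Integrable.smul_measure ?_ (by simp; omega)
    exact (integrable_map_measure hf.aestronglyMeasurable (hm j).aemeasurable).2
      (hi j (Finset.mem_range.1 hj))
  refine ⟨integrable_finsetSum_measure.2 hi', ?_⟩
  unfold birkhoff
  rw [suspend, integral_finsetSum_measure hi', integral_finsetSum _ fun j hj =>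
    hi j (Finset.mem_range.1 hj), Finset.mul_sum]
  refine Finset.sum_congr rfl fun j _ => ?_
  rw [integral_smul_measure, integral_map (hm j).aemeasurable hf.aestronglyMeasurable]
  simp

lemma le_partitionEntropy_suspend [IsProbabilityMeasure Q] (hT : Measurable T)
    (hπ : Measurable π) (hn : 0 < n) {α : Type*} [MeasurableSpace α] [MeasurableSingletonClass α]
    {g : X → α} (hg : Measurable g) {H : ℝ≥0∞}
    (h : ∀ j < n, H ≤ partitionEntropy Q fun ω => g (T^[j] (π ω))) :
    H ≤ partitionEntropy (suspend T π Q n) g := by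
  have hm : ∀ j, Measurable fun ω => T^[j] (π ω) := fun j => (hT.iterate j).comp hπ
  have : ∀ j, IsProbabilityMeasure (Measure.map (fun ω => T^[j] (π ω)) Q) := fun j =>
    Measure.isProbabilityMeasure_map (hm j).aemeasurable
  have hmap : ∀ j, partitionEntropy (Measure.map (fun ω => T^[j] (π ω)) Q) g =
      partitionEntropy Q fun ω => g (T^[j] (π ω)) := fun j => by
    unfold partitionEntropy
    refine tsum_congr fun a => ?_
    rw [Measure.map_apply (hm j) (hg (measurableSet_singleton a))]
    rfl
  refine le_trans ?_ (sum_mul_partitionEntropy_le (Finset.range n) (fun _ => (n : ℝ≥0∞)⁻¹)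
    (sum_inv_natCast hn) (fun j => Measure.map (fun ω => T^[j] (π ω)) Q) g)
  simp only [hmap]
  calc H = ∑ _j ∈ Finset.range n, (n : ℝ≥0∞)⁻¹ * H := by
        rw [← Finset.sum_mul, sum_inv_natCast hn, one_mul]
    _ ≤ _ := Finset.sum_le_sum fun j hj => by
        gcongr; exact h j (Finset.mem_range.1 hj)

end Suspension

section Bernoulli

variable {W : Type*} [MeasurableSpace W]

lemma measurePreserving_shift_infinitePi (ρ : Measure W) [IsProbabilityMeasure ρ] :
    MeasurePreserving (fun (ω : ℕ → W) (t : ℕ) => ω (t + 1))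
      (Measure.infinitePi fun _ => ρ) (Measure.infinitePi fun _ => ρ) := by
  have hm : Measurable fun (ω : ℕ → W) (t : ℕ) => ω (t + 1) :=
    measurable_pi_lambda _ fun t => measurable_pi_apply _
  refine ⟨hm, ?_⟩
  refine Measure.eq_infinitePi _ fun s t ht => ?_
  rw [Measure.map_apply hm (MeasurableSet.pi s.countable_toSet fun i _ => ht i)]
  have : (fun (ω : ℕ → W) (t : ℕ) => ω (t + 1)) ⁻¹' Set.pi s t =
      Set.pi (s.map ⟨Nat.succ, Nat.succ_injective⟩ : Finset ℕ) fun i => t (i - 1) := by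
    ext ω; simp [Set.mem_pi]
  rw [this, Measure.infinitePi_pi _ fun i _ => ht _, Finset.prod_map]
  simp

end Bernoulli

section LoopCoding

variable {S : Type*} [TopologicalSpace S] {A : S → S → Prop} {b : S} {n K : ℕ} {g : Fin K → ℕ → S}

/-- The point obtained by following the loops `g (ω 0)`, `g (ω 1)`, … -/
def loopPt (hn : 0 < n) (hg : ∀ w, IsLoop A b n (g w)) (ω : ℕ → Fin K) : Space A :=
  concPt hn (fun t => g (ω t)) fun t => hg (ω t)

variable (hn : 0 < n) (hg : ∀ w, IsLoop A b n (g w))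

lemma loopPt_apply (ω : ℕ → Fin K) (t : ℕ) {i : ℕ} (hi : i < n) :
    (loopPt hn hg ω).1 (t * n + i) = g (ω t) i :=
  conc_mul_add (B := fun t => g (ω t)) t hi

lemma loopPt_apply_zero (ω : ℕ → Fin K) {i : ℕ} (hi : i < n) :
    (loopPt hn hg ω).1 i = g (ω 0) i := by
  simpa using loopPt_apply hn hg ω 0 hi

lemma loopPt_mem_letters (ω : ℕ → Fin K) (i : ℕ) :
    (loopPt hn hg ω).1 i ∈ ⋃ w, g w '' Iio n :=
  mem_iUnion.2 ⟨ω (i / n), i % n, Nat.mod_lt _ hn, rfl⟩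

lemma finite_letters : (⋃ w, g w '' Iio n).Finite :=
  finite_iUnion fun _ => (finite_Iio n).image _

lemma shift_iterate_loopPt (ω : ℕ → Fin K) :
    (shift A)^[n] (loopPt hn hg ω) = loopPt hn hg fun t => ω (t + 1) :=
  shift_iterate_concPt hn _ _

variable [DiscreteTopology S] [Countable S]

lemma measurable_loopPt : Measurable (loopPt hn hg) := by
  refine Continuous.measurable (continuous_of_coord fun i => ?_)
  have h1 : Continuous fun w : Fin K => g w (i % n) := continuous_of_discreteTopology
  have h2 : Continuous fun ω : ℕ → Fin K => ω (i / n) := _root_.continuous_apply (i / n)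
  exact h1.comp h2

variable (ρ : Measure (Fin K)) [IsProbabilityMeasure ρ]

/-- The invariant measure obtained from a Bernoulli measure on sequences of loops. -/
noncomputable def loopMeasure : ProbabilityMeasure (Space A) :=
  ⟨suspend (shift A) (loopPt hn hg) (Measure.infinitePi fun _ => ρ) n,
    isProbabilityMeasure_suspend measurable_shift (measurable_loopPt hn hg) hn⟩

lemma invariant_loopMeasure : Invariant (shift A) (loopMeasure hn hg ρ : Measure (Space A)) :=
  invariant_suspend measurable_shift (measurable_loopPt hn hg)
    (measurePreserving_shift_infinitePi ρ) (shift_iterate_loopPt hn hg)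

lemma infinitePi_shift_cylinder (m : ℕ) (s : ℕ → Fin K) :
    (Measure.infinitePi fun _ => ρ) {ω : ℕ → Fin K | ∀ i < m, ω (i + 1) = s i} =
      ∏ i : Fin m, ρ {s i} := by
  rw [← infinitePi_cylinder ρ m fun i : Fin m => s i]
  have hm : MeasurableSet {ω : ℕ → Fin K | (fun i : Fin m => ω i) = fun i : Fin m => s i} :=
    (measurable_pi_lambda _ fun i => measurable_pi_apply _) (measurableSet_singleton _)
  rw [← (measurePreserving_shift_infinitePi ρ).measure_preimage hm.nullMeasurableSet]
  congr 1
  ext ω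
  simp only [mem_ofPred_eq, mem_preimage, funext_iff, Fin.forall_iff]

lemma le_partitionEntropy_loop {α : Type*} [Countable α] [MeasurableSpace α]
    [MeasurableSingletonClass α] {f : (ℕ → Fin K) → α} (hf : Measurable f) {m : ℕ}
    (h : ∀ ω ω', f ω = f ω' → ∀ i < m, ω (i + 1) = ω' (i + 1)) :
    m * ∫⁻ w, nlog (ρ {w}) ∂ρ ≤ partitionEntropy (Measure.infinitePi fun _ => ρ) f := by
  rw [partitionEntropy_eq_lintegral _ hf]
  have hm : Measurable fun w => nlog (ρ {w}) := measurable_of_countable _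
  calc (m : ℝ≥0∞) * ∫⁻ w, nlog (ρ {w}) ∂ρ
      = ∑ i : Fin m, ∫⁻ ω : ℕ → Fin K, nlog (ρ {ω (i + 1)}) ∂(Measure.infinitePi fun _ => ρ) := by
        have : ∀ i : Fin m, ∫⁻ ω : ℕ → Fin K, nlog (ρ {ω (i + 1)})
            ∂(Measure.infinitePi fun _ => ρ) = ∫⁻ w, nlog (ρ {w}) ∂ρ := fun i =>
          (measurePreserving_eval_infinitePi (fun _ : ℕ => ρ) (i + 1)).lintegral_comp hm
        simp [this]
    _ = ∫⁻ ω : ℕ → Fin K, ∑ i : Fin m, nlog (ρ {ω (i + 1)}) ∂(Measure.infinitePi fun _ => ρ) := by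
        rw [lintegral_finsetSum]
        exact fun i _ => hm.comp (measurable_pi_apply _)
    _ ≤ _ := by
        refine lintegral_mono fun ω => ?_
        refine (sum_nlog_le_nlog_prod Finset.univ (fun i : Fin m => ρ {ω (i + 1)})
          fun i _ => prob_le_one).trans (nlog_anti ?_ ?_)
        · rw [← infinitePi_shift_cylinder ρ m fun i => ω (i + 1)]
          exact measure_mono fun ω' hω' => h _ _ hω'
        · exact (ENNReal.prod_lt_top fun i _ => measure_lt_top _ _).ne

lemma le_entropy_loopMeasure (hinj : ∀ w w', (∀ i < n, g w i = g w' i) → w = w') :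
    ENNReal.ofReal (n : ℝ)⁻¹ * ∫⁻ w, nlog (ρ {w}) ∂ρ ≤
      entropy (shift A) (loopMeasure hn hg ρ : Measure (Space A)) := by
  classical
  set H := ∫⁻ w, nlog (ρ {w}) ∂ρ with hH
  set F : Set S := ⋃ w, g w '' Iio n with hF
  obtain ⟨enc, henc⟩ := exists_injective_nat S
  set p : Space A → ℕ := fun x => F.indicator enc (x.1 0) with hp
  have hpm : Measurable p :=
    ((continuous_of_discreteTopology (f := F.indicator enc)).comp (continuous_apply 0)).measurable
  have hpf : (range p).Finite := by
    refine ((finite_letters (n := n) (g := g)).image enc |>.union (finite_singleton 0)).subset ?_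
    rintro _ ⟨x, rfl⟩
    by_cases hx : x.1 0 ∈ F
    · left; exact ⟨_, hx, by simp [hp, hx]⟩
    · right; simp [hp, hx]
  have hn0 : (0 : ℝ) < n := by exact_mod_cast hn
  have key : ∀ k : ℕ, ((k / n - 1 : ℕ) : ℝ≥0∞) * H ≤
      partitionEntropy (loopMeasure hn hg ρ : Measure (Space A))
        (fun x => fun i : Fin k => p ((shift A)^[i] x)) := fun k => by
    have hgm : Measurable fun x : Space A => fun i : Fin k => p ((shift A)^[i] x) :=
      measurable_pi_lambda _ fun i => hpm.comp (measurable_shift.iterate i)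
    refine le_partitionEntropy_suspend measurable_shift (measurable_loopPt hn hg) hn hgm
      fun j hj => ?_
    have hm' : Measurable fun ω => (fun i : Fin k => p ((shift A)^[i] ((shift A)^[j]
        (loopPt hn hg ω)))) :=
      hgm.comp ((measurable_shift.iterate j).comp (measurable_loopPt hn hg))
    refine le_partitionEntropy_loop ρ hm' fun ω ω' h t ht => hinj _ _ fun i hi => ?_
    rw [← loopPt_apply hn hg ω _ hi, ← loopPt_apply hn hg ω' _ hi]
    have hk : (t + 1 + 1) * n ≤ k :=
      (Nat.mul_le_mul_right n (by omega : t + 1 + 1 ≤ k / n)).trans (Nat.div_mul_le_self k n)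
    have e1 : (t + 1) * n = t * n + n := Nat.succ_mul _ _
    have e2 : (t + 1 + 1) * n = (t + 1) * n + n := Nat.succ_mul _ _
    have h1 := congrFun h ⟨(t + 1) * n + i - j, by omega⟩
    simp only [hp, shift_iterate_apply] at h1
    rw [show j + ((t + 1) * n + i - j + 0) = (t + 1) * n + i by omega] at h1
    rw [indicator_of_mem (loopPt_mem_letters hn hg ω _),
      indicator_of_mem (loopPt_mem_letters hn hg ω' _)] at h1
    exact henc h1
  refine le_trans ?_ (le_iSup₂_of_le p ⟨hpm, hpf⟩ le_rfl)
  have hlim : Tendsto (fun k : ℕ => ENNReal.ofReal ((n : ℝ)⁻¹ - 2 * (k : ℝ)⁻¹) * H) atTop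
      (𝓝 (ENNReal.ofReal (n : ℝ)⁻¹ * H)) := by
    refine ENNReal.Tendsto.mul_const (ENNReal.tendsto_ofReal ?_) (Or.inl ?_)
    · simpa using tendsto_const_nhds.sub ((tendsto_inv_atTop_nhds_zero_nat (𝕜 := ℝ)).const_mul 2)
    · simp; omega
  rw [← hlim.liminf_eq]
  refine liminf_le_liminf ?_
  filter_upwards [eventually_ge_atTop 1] with k hk
  refine le_trans ?_ (mul_le_mul_right (key k) _)
  rw [← mul_assoc, ← ENNReal.ofReal_natCast (k / n - 1), ← ENNReal.ofReal_mul (by positivity)]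
  gcongr
  have hk0 : (0 : ℝ) < k := by exact_mod_cast hk
  have h1 : (k : ℝ) / n < (k / n : ℕ) + 1 := by
    rw [div_lt_iff₀ hn0]
    have := Nat.lt_div_mul_add (a := k) hn
    have : (k : ℝ) < (k / n : ℕ) * n + n := by exact_mod_cast this
    linarith
  have h2 : ((k / n : ℕ) : ℝ) ≤ (k / n - 1 : ℕ) + 1 := by exact_mod_cast (by omega)
  calc (n : ℝ)⁻¹ - 2 * (k : ℝ)⁻¹ = (k : ℝ)⁻¹ * (k / n - 2) := by field_simp
    _ ≤ _ := by gcongr; linarith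

lemma loopMeasure_visits_le {V : Set (Space A)} (hV : MeasurableSet V) {v : ℝ}
    (h : ∀ ω, v ≤ visits (shift A) (loopPt hn hg ω) n V) :
    v ≤ n * (loopMeasure hn hg ρ : Measure (Space A)).real V := by
  classical
  have hn0 : (0 : ℝ) < n := by exact_mod_cast hn
  have hb : Measurable (V.indicator fun _ => (1 : ℝ)) := measurable_const.indicator hV
  have hl := measurable_loopPt hn hg
  have hi : ∀ j, Integrable (fun ω => V.indicator (fun _ => (1 : ℝ)) ((shift A)^[j]
      (loopPt hn hg ω))) (Measure.infinitePi fun _ => ρ) := fun j => by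
    refine Integrable.of_bound (C := 1)
      (hb.comp ((measurable_shift.iterate j).comp hl)).aestronglyMeasurable
      (Eventually.of_forall fun ω => ?_)
    by_cases hx : (shift A)^[j] (loopPt hn hg ω) ∈ V <;> simp [hx]
  obtain ⟨-, h2⟩ := integral_suspend measurable_shift hl hn hb fun j _ => hi j
  rw [integral_indicator_const _ hV, smul_eq_mul, mul_one] at h2
  change (loopMeasure hn hg ρ : Measure (Space A)).real V = _ at h2
  rw [h2, ← mul_assoc, mul_inv_cancel₀ hn0.ne', one_mul]
  have h3 : ∀ ω, birkhoff (shift A) (V.indicator fun _ => (1 : ℝ)) n (loopPt hn hg ω) =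
      visits (shift A) (loopPt hn hg ω) n V := fun ω => by
    simp [visits, birkhoff, indicator_apply]
  calc v = ∫ ω, v ∂(Measure.infinitePi fun _ : ℕ => ρ) := by simp
    _ ≤ _ := by
      refine integral_mono (integrable_const _) (integrable_finsetSum _ fun j _ => hi j) fun ω => ?_
      exact (h ω).trans (h3 ω).ge

lemma loopMeasure_integral {φ : Space A → ℝ} (hφ : Measurable φ)
    {μ : Measure (Space A)} [IsProbabilityMeasure μ] {c₀ P : ℝ} (hc₀ : 1 ≤ c₀)
    (hG : IsGibbsWith A φ μ c₀ P) {r : Fin K → ℝ} (hr : ∀ w, 0 < r w)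
    (h : ∀ ω, r (ω 0) ≤ mass μ (loopPt hn hg ω) n) :
    Integrable φ (loopMeasure hn hg ρ : Measure (Space A)) ∧
      (n : ℝ)⁻¹ * (P * n + ∫ w, Real.log (r w) ∂ρ - Real.log c₀) ≤
        ∫ x, φ x ∂(loopMeasure hn hg ρ : Measure (Space A)) := by
  have hl := measurable_loopPt hn hg
  obtain ⟨κ, hκ, hκ1⟩ := exists_le_mass_of_finite hc₀ hG (finite_letters (n := n) (g := g)) 1
  have hi : ∀ j, Integrable (fun ω => φ ((shift A)^[j] (loopPt hn hg ω)))
      (Measure.infinitePi fun _ => ρ) := fun j => by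
    refine Integrable.of_bound (C := |P + Real.log c₀| + |P + Real.log κ - Real.log c₀|)
      (hφ.comp ((measurable_shift.iterate j).comp hl)).aestronglyMeasurable
      (Eventually.of_forall fun ω => ?_)
    have h1 := phi_le hc₀ hG ((shift A)^[j] (loopPt hn hg ω))
    have h2 := le_birkhoff hc₀ hG ((shift A)^[j] (loopPt hn hg ω)) 1
    have h3 : κ ≤ mass μ ((shift A)^[j] (loopPt hn hg ω)) 1 := hκ1 _ fun i _ => by
      rw [shift_iterate_apply]; exact loopPt_mem_letters hn hg ω _
    have h4 := Real.log_le_log hκ h3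
    simp only [birkhoff, Finset.range_one, Finset.sum_singleton, Nat.cast_one, mul_one,
      Function.iterate_zero, id] at h2
    rw [Real.norm_eq_abs, abs_le]
    constructor
    · have := neg_abs_le (P + Real.log κ - Real.log c₀)
      have := abs_nonneg (P + Real.log c₀)
      linarith
    · have := le_abs_self (P + Real.log c₀)
      have := abs_nonneg (P + Real.log κ - Real.log c₀)
      linarith
  obtain ⟨h1, h2⟩ := integral_suspend measurable_shift hl hn hφ fun j _ => hi j
  refine ⟨h1, ?_⟩
  change ∫ x, φ x ∂(loopMeasure hn hg ρ : Measure (Space A)) = _ at h2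
  rw [h2]
  gcongr
  have hm : Measurable fun w => Real.log (r w) := measurable_of_countable _
  have hir : Integrable (fun w => Real.log (r w)) ρ := Integrable.of_finite
  have hmp := measurePreserving_eval_infinitePi (fun _ : ℕ => ρ) 0
  have hir' : Integrable (fun ω : ℕ → Fin K => Real.log (r (ω 0)))
      (Measure.infinitePi fun _ => ρ) := (hmp.integrable_comp hm.aestronglyMeasurable).2 hir
  have hie : ∫ ω : ℕ → Fin K, Real.log (r (ω 0)) ∂(Measure.infinitePi fun _ => ρ) =
      ∫ w, Real.log (r w) ∂ρ := by
    have := integral_map (μ := Measure.infinitePi fun _ : ℕ => ρ) hmp.measurable.aemeasurable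
      hm.aestronglyMeasurable
    rw [hmp.map_eq] at this
    exact this.symm
  calc P * n + ∫ w, Real.log (r w) ∂ρ - Real.log c₀
      = ∫ ω : ℕ → Fin K, (P * n - Real.log c₀ + Real.log (r (ω 0)))
          ∂(Measure.infinitePi fun _ => ρ) := by
        rw [integral_add (integrable_const _) hir', hie]
        simp; ring
    _ ≤ _ := by
        refine integral_mono ((integrable_const _).add hir')
          (integrable_finsetSum _ fun j _ => hi j) fun ω => ?_
        have h3 := le_birkhoff hc₀ hG (loopPt hn hg ω) n
        have h4 := Real.log_le_log (hr _) (h ω)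
        simp only
        linarith

end LoopCoding

section LocalUpperBound

variable {S : Type*} [TopologicalSpace S] {A : S → S → Prop} [DiscreteTopology S] [Countable S]

lemma exists_le_freeEnergy_loopMeasure {b : S} {n K : ℕ} {g : Fin K → ℕ → S} (hn : 0 < n)
    (hg : ∀ w, IsLoop A b n (g w)) (hinj : ∀ w w', (∀ i < n, g w i = g w' i) → w = w')
    (hK : 0 < K) {φ : Space A → ℝ} (hφ : Measurable φ)
    {μ : Measure (Space A)} [IsProbabilityMeasure μ] {c₀ P : ℝ} (hc₀ : 1 ≤ c₀)
    (hG : IsGibbsWith A φ μ c₀ P) {a : Fin K → ℝ} (ha : ∀ w, 0 < a w) {κ : ℝ} (hκ : 0 < κ)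
    (h : ∀ w, ∀ y : Space A, (∀ i < n, y.1 i = g w i) → κ * a w ≤ mass μ y n) :
    ∃ (ρ : Measure (Fin K)) (_ : IsProbabilityMeasure ρ),
      (((n : ℝ)⁻¹ * (Real.log κ + Real.log (∑ w, a w) - Real.log c₀) : ℝ) : EReal) ≤
        freeEnergy (shift A) φ P (loopMeasure hn hg ρ) := by
  have hM : 0 < ∑ w, a w := by
    have : Nonempty (Fin K) := ⟨⟨0, hK⟩⟩
    exact Finset.sum_pos (fun w _ => ha w) Finset.univ_nonempty
  set M := ∑ w, a w with hMd
  have haM : ∀ w, 0 < a w / M := fun w => div_pos (ha w) hM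
  set ρ : Measure (Fin K) := ∑ w, ENNReal.ofReal (a w / M) • Measure.dirac w with hρ
  have hρs : ∀ w, ρ {w} = ENNReal.ofReal (a w / M) := fun w => by
    rw [hρ, Measure.finsetSum_apply, Finset.sum_eq_single w]
    · simp
    · intro v _ hv; simp [hv]
    · simp
  have hρp : IsProbabilityMeasure ρ := ⟨by
    rw [hρ, Measure.finsetSum_apply]
    simp only [Measure.smul_apply, measure_univ, smul_eq_mul, mul_one]
    rw [← ENNReal.ofReal_sum_of_nonneg fun w _ => (haM w).le, ← Finset.sum_div, div_self hM.ne',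
      ENNReal.ofReal_one]⟩
  clear_value ρ
  refine ⟨ρ, hρp, ?_⟩
  obtain ⟨h1, h2⟩ := loopMeasure_integral hn hg ρ hφ hc₀ hG (r := fun w => κ * a w)
    (fun w => mul_pos hκ (ha w)) fun ω => h _ _ fun i hi => loopPt_apply_zero hn hg ω hi
  have h3 := le_entropy_loopMeasure hn hg ρ hinj
  have hle : ∀ w, a w / M ≤ 1 := fun w => by
    rw [div_le_one hM]
    exact Finset.single_le_sum (f := a) (fun v _ => (ha v).le) (Finset.mem_univ w)
  have hi1 : Integrable (fun w => -Real.log (a w / M)) ρ := Integrable.of_finite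
  have hi2 : Integrable (fun w => Real.log (κ * a w)) ρ := Integrable.of_finite
  have h4 : ∫⁻ w, nlog (ρ {w}) ∂ρ = ENNReal.ofReal (∫ w, -Real.log (a w / M) ∂ρ) := by
    rw [ofReal_integral_eq_lintegral_ofReal hi1]
    · refine lintegral_congr fun w => ?_
      rw [hρs, nlog_ofReal (haM w)]
    · exact Eventually.of_forall fun w => neg_nonneg.2 (Real.log_nonpos (haM w).le (hle w))
  have h5 : ∫ w, Real.log (κ * a w) ∂ρ + ∫ w, -Real.log (a w / M) ∂ρ =
      Real.log κ + Real.log M := by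
    rw [← integral_add hi2 hi1]
    have : ∀ w, Real.log (κ * a w) + -Real.log (a w / M) = Real.log κ + Real.log M := fun w => by
      rw [Real.log_mul hκ.ne' (ha w).ne', Real.log_div (ha w).ne' hM.ne']; ring
    simp [this]
  have h6 : 0 ≤ ∫ w, -Real.log (a w / M) ∂ρ :=
    integral_nonneg fun w => neg_nonneg.2 (Real.log_nonpos (haM w).le (hle w))
  have hn0 : (0 : ℝ) < n := by exact_mod_cast hn
  rw [freeEnergy, if_pos ⟨invariant_loopMeasure hn hg ρ, h1.neg.lintegral_lt_top.ne⟩,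
    eintegral_eq_integral h1]
  rw [h4, ← ENNReal.ofReal_mul (by positivity)] at h3
  have h7 : (((n : ℝ)⁻¹ * ∫ w, -Real.log (a w / M) ∂ρ : ℝ) : EReal) ≤
      ((entropy (shift A) (loopMeasure hn hg ρ : Measure (Space A)) : ℝ≥0∞) : EReal) := by
    refine le_trans ?_ (EReal.coe_ennreal_le_coe_ennreal_iff.2 h3)
    rw [EReal.coe_ennreal_ofReal, max_eq_left (by positivity)]
  refine le_trans ?_ (EReal.sub_le_sub (add_le_add h7 (EReal.coe_le_coe_iff.2 h2)) le_rfl)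
  rw [← EReal.coe_add, ← EReal.coe_sub, EReal.coe_le_coe_iff, ← h5]
  have : (n : ℝ)⁻¹ * (P * n) = P := by field_simp
  linarith [this, mul_add (n : ℝ)⁻¹ (P * n) (∫ w, Real.log (κ * a w) ∂ρ),
    mul_sub (n : ℝ)⁻¹ (P * n + ∫ w, Real.log (κ * a w) ∂ρ) (Real.log c₀),
    mul_add (n : ℝ)⁻¹ (∫ w, Real.log (κ * a w) ∂ρ) (∫ w, -Real.log (a w / M) ∂ρ),
    mul_sub (n : ℝ)⁻¹ (∫ w, Real.log (κ * a w) ∂ρ + ∫ w, -Real.log (a w / M) ∂ρ) (Real.log c₀)]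

lemma visits_le {X : Type*} (T : X → X) (x : X) (n : ℕ) (E : Set X) : visits T x n E ≤ n := by
  classical
  unfold visits
  exact (Finset.card_filter_le _ _).trans (Finset.card_range n).le

/-- Upper bound for the weights of periodic points near a given measure. -/
lemma exists_nhds_theta_le (hprim : FinitelyPrimitive A) {φ : Space A → ℝ} (hφ : Measurable φ)
    {μ : Measure (Space A)} [IsProbabilityMeasure μ] {c₀ P : ℝ} (hc₀ : 1 ≤ c₀)
    (hG : IsGibbsWith A φ μ c₀ P) {G : Set (ProbabilityMeasure (Space A))} (hGo : IsOpen G)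
    {ν₀ : ProbabilityMeasure (Space A)} (hν₀ : ν₀ ∈ G) :
    ∃ U : Set (ProbabilityMeasure (Space A)), IsOpen U ∧ ν₀ ∈ U ∧ ∃ (N : ℕ) (C : ℝ) (n₀ : ℕ),
      ∀ n ≥ n₀, ∀ β : ℝ, (∀ ν ∈ G, freeEnergy (shift A) φ P ν ≤ β) →
        theta μ n U ≤ ENNReal.ofReal (Real.exp (β * (n + N) + C)) := by
  classical
  obtain ⟨x₀⟩ : Nonempty (Space A) := nonempty_of_isProbabilityMeasure μ
  obtain ⟨N, κ, hκ, -, hloop, -⟩ := exists_loops_mass hprim (x₀.1 0) hc₀ hG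
  obtain ⟨l, D, ε, hε, hD, hDG⟩ := exists_determined_nhds hGo hν₀
  refine ⟨{ξ | ∀ V ∈ D, (ν₀ : Measure (Space A)).real V - ε / 2 < (ξ : Measure (Space A)).real V},
    ?_, fun V _ => by linarith, 2 * N + 1, Real.log c₀ - Real.log κ,
    l + 1 + ⌈(l + 2 * N + 2) / (ε / 2)⌉₊, fun n hn β hβ => ?_⟩
  · have : {ξ : ProbabilityMeasure (Space A) | ∀ V ∈ D,
        (ν₀ : Measure (Space A)).real V - ε / 2 < (ξ : Measure (Space A)).real V} =
        ⋂ V ∈ D, {ξ : ProbabilityMeasure (Space A) |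
          (ν₀ : Measure (Space A)).real V - ε / 2 < (ξ : Measure (Space A)).real V} := by
      ext; simp
    rw [this]
    exact isOpen_biInter_finset fun V hV =>
      isOpen_lt continuous_const (continuous_real_determined (hD V hV))
  set U : Set (ProbabilityMeasure (Space A)) := {ξ | ∀ V ∈ D,
    (ν₀ : Measure (Space A)).real V - ε / 2 < (ξ : Measure (Space A)).real V} with hU
  have hn1 : 1 ≤ n := by omega
  have hnε : (l + 2 * N + 2 : ℝ) ≤ n * (ε / 2) := by
    rw [← div_le_iff₀ (by positivity)]
    refine (Nat.le_ceil _).trans ?_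
    have : ⌈((l : ℝ) + 2 * N + 2) / (ε / 2)⌉₊ ≤ n := by omega
    exact Nat.cast_le.2 this
  rw [theta, ENNReal.tsum_eq_iSup_sum]
  refine iSup_le fun s => ?_
  have hs : ∑ x ∈ s, U.indicator (fun _ => μ (cyl x.1 n)) (empirical (shift A) x.1 n) =
      ∑ x ∈ s.filter fun x => empirical (shift A) x.1 n ∈ U, μ (cyl x.1 n) := by
    simp [indicator_apply, Finset.sum_filter]
  rw [hs]
  set s' := s.filter fun x => empirical (shift A) x.1 n ∈ U with hs'
  rcases s'.eq_empty_or_nonempty with h0 | h0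
  · simp [h0]
  set K := s'.card with hK
  have hK0 : 0 < K := h0.card_pos
  set p : Fin K → Space A := fun w => (s'.equivFin.symm w).1.1 with hp
  have hpper : ∀ w, p w ∈ perSet (shift A) n := fun w => (s'.equivFin.symm w).1.2
  have hpU : ∀ w, empirical (shift A) (p w) n ∈ U := fun w =>
    (Finset.mem_filter.1 (s'.equivFin.symm w).2).2
  have hpi : Function.Injective p := fun w w' h =>
    s'.equivFin.symm.injective (Subtype.ext (Subtype.ext h))
  have hsum : ∑ x ∈ s', μ (cyl x.1 n) = ENNReal.ofReal (∑ w, mass μ (p w) n) := by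
    rw [ENNReal.ofReal_sum_of_nonneg fun w _ => mass_nonneg (μ := μ) _ _]
    rw [← Finset.sum_coe_sort s', ← s'.equivFin.symm.sum_comp]
    refine Finset.sum_congr rfl fun w _ => ?_
    rw [mass, ofReal_measureReal (measure_ne_top _ _)]
  rw [hsum]
  clear_value p
  choose g hg1 hg2 hg3 using fun w => hloop n hn1 (p w)
  have hn' : 0 < n + 2 * N + 1 := by omega
  obtain ⟨ρ, hρ, hF⟩ := exists_le_freeEnergy_loopMeasure hn' hg1 (fun w w' h => hpi
    (perSet_ext hn1 (hpper w) (hpper w') fun i hi => by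
      rw [← hg2 w i hi, ← hg2 w' i hi]; exact h _ (by omega))) hK0 hφ hc₀ hG
    (fun w => mass_pos hc₀ hG (p w) n) hκ hg3
  have hmem : loopMeasure hn' hg1 ρ ∈ G := by
    refine hDG _ fun V hV => ?_
    have hVm := (hD V hV).measurableSet
    set v := (ν₀ : Measure (Space A)).real V with hv
    have hv1 : v ≤ 1 := measureReal_le_one
    have h1 := loopMeasure_visits_le hn' hg1 ρ hVm (v := n * (v - ε / 2) - l) fun ω => by
      have e1 := hpU (ω 0) V hV
      have hn0 : (0 : ℝ) < n := by exact_mod_cast hn1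
      rw [empirical_real _ _ hn1 hVm, lt_div_iff₀ hn0] at e1
      have hln : l ≤ n := by omega
      have e2 : visits (shift A) (p (ω 0)) (n - l) V =
          visits (shift A) ((shift A)^[N + 1] (loopPt hn' hg1 ω)) (n - l) V :=
        (hD V hV).visits_congr hln fun i hi => by
          rw [shift_iterate_apply, ← hg2 _ i hi]
          exact (loopPt_apply_zero hn' hg1 ω (by omega)).symm
      have e3 := visits_add (shift A) (p (ω 0)) (n - l) l V
      rw [Nat.sub_add_cancel hln] at e3
      have e4 := visits_le (shift A) ((shift A)^[n - l] (p (ω 0))) l V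
      have e5 := visits_mono (shift A) (loopPt hn' hg1 ω)
        (by omega : N + 1 + (n - l) ≤ n + 2 * N + 1) V
      rw [visits_add] at e5
      have e6 : visits (shift A) (p (ω 0)) n V ≤
          visits (shift A) (loopPt hn' hg1 ω) (n + 2 * N + 1) V + l := by omega
      have e7 : (visits (shift A) (p (ω 0)) n V : ℝ) ≤
          visits (shift A) (loopPt hn' hg1 ω) (n + 2 * N + 1) V + l := by exact_mod_cast e6
      linarith
    push_cast at h1
    have hn0 : (0 : ℝ) < n + 2 * N + 1 := by positivity
    refine lt_of_mul_lt_mul_left ?_ hn0.le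
    have hN0 : (0 : ℝ) ≤ 2 * N + 1 := by positivity
    nlinarith [mul_le_mul_of_nonneg_left hv1 hN0, mul_nonneg hN0 hε.le]
  have h1 := hF.trans (hβ _ hmem)
  rw [EReal.coe_le_coe_iff, inv_mul_le_iff₀ (by positivity)] at h1
  push_cast at h1
  refine ENNReal.ofReal_le_ofReal ?_
  rw [← Real.log_le_iff_le_exp]
  · push_cast; linarith
  · have : Nonempty (Fin K) := ⟨⟨0, hK0⟩⟩
    exact Finset.sum_pos (fun w _ => mass_pos hc₀ hG _ _) Finset.univ_nonempty

end LocalUpperBound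

section Rates

lemma tendsto_inv_mul_log_exp {c : ℝ} (hc : 0 < c) (β : ℝ) :
    Tendsto (fun n : ℕ => (((n : ℝ)⁻¹ : ℝ) : EReal) *
      ENNReal.log (ENNReal.ofReal (c * Real.exp (β * n)))) atTop (𝓝 (β : EReal)) := by
  have h1 : ∀ n : ℕ, (((n : ℝ)⁻¹ : ℝ) : EReal) *
      ENNReal.log (ENNReal.ofReal (c * Real.exp (β * n))) =
      (((n : ℝ)⁻¹ * (Real.log c + β * n) : ℝ) : EReal) := fun n => by
    rw [ENNReal.log_ofReal_of_pos (by positivity), Real.log_mul hc.ne' (Real.exp_pos _).ne',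
      Real.log_exp, ← EReal.coe_mul]
  simp only [h1]
  refine (continuous_coe_real_ereal.tendsto β).comp ?_
  have h2 : Tendsto (fun n : ℕ => (n : ℝ)⁻¹ * Real.log c + β) atTop (𝓝 (0 * Real.log c + β)) :=
    (tendsto_inv_atTop_nhds_zero_nat.mul_const _).add_const _
  rw [zero_mul, zero_add] at h2
  refine h2.congr' ?_
  filter_upwards [eventually_ge_atTop 1] with n hn
  have : (0 : ℝ) < n := by exact_mod_cast hn
  field_simp

lemma inv_mul_log_mono (n : ℕ) {x y : ℝ≥0∞} (h : x ≤ y) :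
    (((n : ℝ)⁻¹ : ℝ) : EReal) * ENNReal.log x ≤ (((n : ℝ)⁻¹ : ℝ) : EReal) * ENNReal.log y :=
  mul_le_mul_of_nonneg_left (ENNReal.log_monotone h) (EReal.coe_nonneg.2 (by positivity))

lemma limsup_inv_mul_log_le {u : ℕ → ℝ≥0∞} {c β : ℝ} (hc : 0 < c)
    (h : ∀ᶠ n : ℕ in atTop, u n ≤ ENNReal.ofReal (c * Real.exp (β * n))) :
    atTop.limsup (fun n : ℕ => (((n : ℝ)⁻¹ : ℝ) : EReal) * ENNReal.log (u n)) ≤ (β : EReal) := by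
  rw [← (tendsto_inv_mul_log_exp hc β).limsup_eq]
  exact limsup_le_limsup (h.mono fun n hn => inv_mul_log_mono n hn)

lemma le_liminf_inv_mul_log {u : ℕ → ℝ≥0∞} {c β : ℝ} (hc : 0 < c)
    (h : ∀ᶠ n : ℕ in atTop, ENNReal.ofReal (c * Real.exp (β * n)) ≤ u n) :
    (β : EReal) ≤ atTop.liminf (fun n : ℕ => (((n : ℝ)⁻¹ : ℝ) : EReal) * ENNReal.log (u n)) := by
  rw [← (tendsto_inv_mul_log_exp hc β).liminf_eq]
  exact liminf_le_liminf (h.mono fun n hn => inv_mul_log_mono n hn)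

variable {Y : Type*} [TopologicalSpace Y] {F : Y → EReal}

lemma neg_rateOf (y : Y) :
    -rateOf F y = ⨅ (G : Set Y) (_ : IsOpen G ∧ y ∈ G), ⨆ ν ∈ G, F ν := neg_neg _

lemma neg_rateOf_le {G : Set Y} (hG : IsOpen G) {y : Y} (hy : y ∈ G) :
    -rateOf F y ≤ ⨆ ν ∈ G, F ν := by
  rw [neg_rateOf]
  exact iInf₂_le G ⟨hG, hy⟩

lemma exists_of_neg_rateOf_lt {y : Y} {β : EReal} (h : -rateOf F y < β) :
    ∃ G, IsOpen G ∧ y ∈ G ∧ ⨆ ν ∈ G, F ν < β := by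
  rw [neg_rateOf] at h
  simp only [iInf_lt_iff] at h
  obtain ⟨G, ⟨h1, h2⟩, h3⟩ := h
  exact ⟨G, h1, h2, h3⟩

lemma exists_of_lt_neg_rateOf {G : Set Y} (hG : IsOpen G) {y : Y} (hy : y ∈ G) {β : EReal}
    (h : β < -rateOf F y) : ∃ ν ∈ G, β < F ν := by
  have := h.trans_le (neg_rateOf_le hG hy)
  simpa only [lt_iSup_iff, exists_prop] using this

lemma lowerSemicontinuous_rateOf : LowerSemicontinuous (rateOf F) := by
  intro y c hc
  obtain ⟨G, hG, hy, h⟩ := exists_of_neg_rateOf_lt (EReal.neg_lt_neg_iff.2 hc)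
  filter_upwards [hG.mem_nhds hy] with z hz
  exact EReal.neg_lt_neg_iff.1 ((neg_rateOf_le hG hz).trans_lt h)

variable [MeasurableSpace Y] {η : ℕ → Measure Y}

lemma expTight_of_le (h : ∀ L : ℝ, 0 < L → ∃ K : Set Y, IsCompact K ∧ ∃ c : ℝ, 0 < c ∧
      ∀ᶠ n : ℕ in atTop, η n Kᶜ ≤ ENNReal.ofReal (c * Real.exp (-L * n))) : ExpTight η := by
  intro L hL
  obtain ⟨K, hK, c, hc, hn⟩ := h L hL
  exact ⟨K, hK, limsup_inv_mul_log_le hc hn⟩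

lemma hasLDP_of_le (htight : ∀ L : ℝ, 0 < L → ∃ K : Set Y, IsCompact K ∧ ∃ c : ℝ, 0 < c ∧
      ∀ᶠ n : ℕ in atTop, η n Kᶜ ≤ ENNReal.ofReal (c * Real.exp (-L * n)))
    (hlow : ∀ G : Set Y, IsOpen G → ∀ ν ∈ G, ∀ β : ℝ, (β : EReal) < F ν →
      ∃ c : ℝ, 0 < c ∧ ∀ᶠ n : ℕ in atTop, ENNReal.ofReal (c * Real.exp (β * n)) ≤ η n G)
    (hup : ∀ G : Set Y, IsOpen G → ∀ ν ∈ G, ∀ β : ℝ, (∀ ξ ∈ G, F ξ ≤ β) →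
      ∃ U : Set Y, IsOpen U ∧ ν ∈ U ∧ ∃ c : ℝ, 0 < c ∧
        ∀ᶠ n : ℕ in atTop, η n U ≤ ENNReal.ofReal (c * Real.exp (β * n))) :
    HasLDP η (rateOf F) := by
  classical
  refine ⟨fun G hG => EReal.ge_of_forall_gt_iff_ge.1 fun β hβ => ?_,
    fun K hK => EReal.le_of_forall_lt_iff_le.1 fun β hβ => ?_⟩
  · obtain ⟨y, hy, hβy⟩ : ∃ y ∈ G, rateOf F y < -(β : EReal) := by
      have := EReal.lt_neg_comm.1 hβ
      simpa only [iInf_lt_iff, exists_prop] using this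
    obtain ⟨ν, hν, h⟩ := exists_of_lt_neg_rateOf hG hy (EReal.lt_neg_comm.1 hβy)
    obtain ⟨c, hc, hn⟩ := hlow G hG ν hν β h
    exact le_liminf_inv_mul_log hc hn
  · obtain ⟨C, hC, c, hc, hn⟩ := htight (max 1 (-β)) (by positivity)
    have h1 : ∀ y ∈ K, ∃ U : Set Y, IsOpen U ∧ y ∈ U ∧ ∃ c : ℝ, 0 < c ∧
        ∀ᶠ n : ℕ in atTop, η n U ≤ ENNReal.ofReal (c * Real.exp (β * n)) := fun y hy => by
      obtain ⟨G, hG, hyG, h⟩ := exists_of_neg_rateOf_lt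
        ((EReal.neg_le_neg_iff.2 (iInf₂_le y hy)).trans_lt hβ)
      exact hup G hG y hyG β fun ξ hξ => (le_iSup₂ (f := fun ξ _ => F ξ) ξ hξ).trans h.le
    choose! U hU hyU cU hcU hnU using h1
    obtain ⟨t, ht⟩ := (hC.inter_left hK).elim_nhds_subcover' (fun y _ => U y)
      fun y hy => (hU y hy.1).mem_nhds (hyU y hy.1)
    refine limsup_inv_mul_log_le (c := ∑ y ∈ t, cU y + c)
      (add_pos_of_nonneg_of_pos (Finset.sum_nonneg fun y _ => (hcU y y.2.1).le) hc) ?_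
    have h2 : ∀ᶠ n : ℕ in atTop, ∀ y ∈ t, η n (U y) ≤
        ENNReal.ofReal (cU y * Real.exp (β * n)) :=
      (eventually_all_finset t).2 fun y _ => hnU y y.2.1
    filter_upwards [hn, h2] with n hn1 hn2
    have h3 : K ⊆ (⋃ y ∈ t, U y) ∪ Cᶜ := fun x hx => by
      by_cases hxC : x ∈ C
      · exact Or.inl (ht ⟨hx, hxC⟩)
      · exact Or.inr hxC
    calc η n K ≤ η n (⋃ y ∈ t, U y) + η n Cᶜ := (measure_mono h3).trans (measure_union_le _ _)
      _ ≤ ∑ y ∈ t, η n (U y) + η n Cᶜ := by gcongr; exact measure_biUnion_finset_le _ _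
      _ ≤ ∑ y ∈ t, ENNReal.ofReal (cU y * Real.exp (β * n)) +
            ENNReal.ofReal (c * Real.exp (β * n)) := by
          refine add_le_add (Finset.sum_le_sum hn2) (hn1.trans (ENNReal.ofReal_le_ofReal ?_))
          gcongr
          linarith [le_max_right 1 (-β)]
      _ = _ := by
          have hp : ∀ y ∈ t, 0 ≤ cU y * Real.exp (β * n) := fun y _ =>
            mul_nonneg (hcU y y.2.1).le (Real.exp_pos _).le
          rw [← ENNReal.ofReal_sum_of_nonneg hp, ← ENNReal.ofReal_add
            (Finset.sum_nonneg hp) (by positivity), ← Finset.sum_mul, add_mul]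

lemma goodRate_of_le [T2Space Y] (htight : ∀ L : ℝ, 0 < L → ∃ K : Set Y, IsCompact K ∧
      ∃ c : ℝ, 0 < c ∧ ∀ᶠ n : ℕ in atTop, η n Kᶜ ≤ ENNReal.ofReal (c * Real.exp (-L * n)))
    (hlow : ∀ G : Set Y, IsOpen G → ∀ ν ∈ G, ∀ β : ℝ, (β : EReal) < F ν →
      ∃ c : ℝ, 0 < c ∧ ∀ᶠ n : ℕ in atTop, ENNReal.ofReal (c * Real.exp (β * n)) ≤ η n G) :
    GoodRate (rateOf F) := by
  refine ⟨lowerSemicontinuous_rateOf, fun α hα => ?_⟩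
  obtain ⟨K, hK, c, hc, hn⟩ := htight (α + 1) (by linarith)
  refine hK.of_isClosed_subset (lowerSemicontinuous_rateOf.isClosed_preimage _) fun y hy => ?_
  by_contra hyK
  have h1 : ((-(α + 1) : ℝ) : EReal) < -rateOf F y := by
    refine lt_of_lt_of_le ?_ (EReal.neg_le_neg_iff.2 hy)
    rw [← EReal.coe_neg, EReal.coe_lt_coe_iff]; linarith
  obtain ⟨ν, hν, h2⟩ := exists_of_lt_neg_rateOf hK.isClosed.isOpen_compl hyK h1
  obtain ⟨β, hβ1, hβ2⟩ := EReal.lt_iff_exists_real_btwn.1 h2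
  obtain ⟨c', hc', hn'⟩ := hlow _ hK.isClosed.isOpen_compl ν hν β hβ2
  have h3 := (le_liminf_inv_mul_log hc' hn').trans
    (le_trans (liminf_le_limsup (f := atTop)) (limsup_inv_mul_log_le hc hn))
  rw [EReal.coe_le_coe_iff] at h3
  rw [EReal.coe_lt_coe_iff] at hβ1
  linarith

end Rates

section Convexity

variable {X : Type*} [MeasurableSpace X]

lemma integral_mix (t : ℝ) (h0 : 0 ≤ t) (h1 : t ≤ 1) (μ ν : ProbabilityMeasure X) {f : X → ℝ}
    (hμ : Integrable f (μ : Measure X)) (hν : Integrable f (ν : Measure X)) :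
    Integrable f (mix t h0 h1 μ ν : Measure X) ∧ ∫ x, f x ∂(mix t h0 h1 μ ν : Measure X) =
      t * ∫ x, f x ∂(μ : Measure X) + (1 - t) * ∫ x, f x ∂(ν : Measure X) := by
  have hμ' := hμ.smul_measure (c := ENNReal.ofReal t) ENNReal.ofReal_ne_top
  have hν' := hν.smul_measure (c := ENNReal.ofReal (1 - t)) ENNReal.ofReal_ne_top
  refine ⟨hμ'.add_measure hν', ?_⟩
  change ∫ x, f x ∂(ENNReal.ofReal t • (μ : Measure X) + ENNReal.ofReal (1 - t) • (ν : Measure X))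
    = _
  rw [integral_add_measure hμ' hν', integral_smul_measure, integral_smul_measure,
    ENNReal.toReal_ofReal h0, ENNReal.toReal_ofReal (by linarith), smul_eq_mul, smul_eq_mul]

lemma continuous_mix [TopologicalSpace X] [OpensMeasurableSpace X] (t : ℝ) (h0 : 0 ≤ t)
    (h1 : t ≤ 1) : Continuous fun p : ProbabilityMeasure X × ProbabilityMeasure X =>
      mix t h0 h1 p.1 p.2 := by
  rw [ProbabilityMeasure.continuous_iff_forall_continuous_integral]
  intro f
  have h : ∀ ν : ProbabilityMeasure X, Integrable f (ν : Measure X) := fun ν => f.integrable _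
  simp only [(integral_mix t h0 h1 _ _ (h _) (h _)).2]
  have hc := ProbabilityMeasure.continuous_integral_boundedContinuousFunction (X := X) f
  exact (continuous_const.mul (hc.comp continuous_fst)).add
    (continuous_const.mul (hc.comp continuous_snd))

lemma convexRate_of_concave [TopologicalSpace X] [OpensMeasurableSpace X]
    {F : ProbabilityMeasure X → EReal} (hF : ∀ ν, F ν ≤ 0)
    (hconc : ∀ μ ν : ProbabilityMeasure X, ∀ t : ℝ, ∀ (h0 : 0 ≤ t) (h1 : t ≤ 1), ∀ a b : ℝ,
      (a : EReal) < F μ → (b : EReal) < F ν →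
        ((t * a + (1 - t) * b : ℝ) : EReal) ≤ F (mix t h0 h1 μ ν)) : ConvexRate (rateOf F) := by
  have hpos : ∀ ν, 0 ≤ rateOf F ν := fun ν => by
    have h1 := (neg_rateOf_le (F := F) isOpen_univ (mem_univ ν)).trans (iSup₂_le fun ξ _ => hF ξ)
    simpa using EReal.neg_le_neg_iff.2 h1
  intro μ ν t h0 h1
  rcases h0.eq_or_lt with rfl | h0'
  · have : mix 0 h0 h1 μ ν = ν := Subtype.ext (by simp [mix])
    rw [this]; simp
  rcases h1.eq_or_lt with rfl | h1'
  · have : mix 1 h0 h1 μ ν = μ := Subtype.ext (by simp [mix])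
    rw [this]; simp
  have h1t : 0 < 1 - t := by linarith
  have hbot : ∀ (s : ℝ) (ξ : ProbabilityMeasure X), 0 < s → (s : EReal) * rateOf F ξ ≠ ⊥ :=
    fun s ξ hs => ((mul_nonneg (EReal.coe_nonneg.2 hs.le) (hpos ξ)).trans_lt'
      EReal.bot_lt_zero).ne'
  by_cases hμt : rateOf F μ = ⊤
  · rw [hμt, EReal.coe_mul_top_of_pos h0', EReal.top_add_of_ne_bot (hbot _ _ h1t)]
    exact le_top
  by_cases hνt : rateOf F ν = ⊤
  · rw [hνt, EReal.coe_mul_top_of_pos h1t, EReal.add_top_of_ne_bot (hbot _ _ h0')]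
    exact le_top
  have e1 := EReal.coe_toReal hμt ((hpos μ).trans_lt' EReal.bot_lt_zero).ne'
  have e2 := EReal.coe_toReal hνt ((hpos ν).trans_lt' EReal.bot_lt_zero).ne'
  set a := (rateOf F μ).toReal
  set b := (rateOf F ν).toReal
  rw [← e1, ← e2, ← EReal.coe_mul, ← EReal.coe_mul, ← EReal.coe_add, ← EReal.neg_le_neg_iff,
    neg_rateOf]
  refine le_iInf₂ fun G hG => ?_
  obtain ⟨G₁, G₂, hG₁, hG₂, hm₁, hm₂, hsub⟩ := isOpen_prod_iff.1
    (hG.1.preimage (continuous_mix t h0 h1)) μ ν hG.2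
  refine EReal.ge_of_forall_gt_iff_ge.1 fun z hz => ?_
  rw [← EReal.coe_neg, EReal.coe_lt_coe_iff] at hz
  set ε := -(t * a + (1 - t) * b) - z with hε
  have hε0 : 0 < ε := by linarith
  obtain ⟨μ', hμ', hμF⟩ := exists_of_lt_neg_rateOf hG₁ hm₁ (β := ((-a - ε : ℝ) : EReal)) (by
    rw [← e1, ← EReal.coe_neg, EReal.coe_lt_coe_iff]; linarith)
  obtain ⟨ν', hν', hνF⟩ := exists_of_lt_neg_rateOf hG₂ hm₂ (β := ((-b - ε : ℝ) : EReal)) (by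
    rw [← e2, ← EReal.coe_neg, EReal.coe_lt_coe_iff]; linarith)
  have h2 := hconc μ' ν' t h0 h1 _ _ hμF hνF
  refine le_trans (le_trans ?_ h2) (le_iSup₂ (f := fun ξ _ => F ξ) (mix t h0 h1 μ' ν')
    (hsub (mk_mem_prod hμ' hν')))
  rw [EReal.coe_le_coe_iff]
  apply le_of_eq
  rw [hε]; ring

end Convexity

section Concavity

variable {X : Type*} [MeasurableSpace X] {T : X → X} {φ : X → ℝ}

lemma exists_partition_of_lt_freeEnergy {C P x : ℝ} (hφ : Measurable φ) (hC : ∀ x, φ x ≤ C)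
    {μ : ProbabilityMeasure X} (hx : (x : EReal) < freeEnergy T φ P μ) :
    Invariant T (μ : Measure X) ∧ Integrable φ (μ : Measure X) ∧
      ∃ h : ℝ, 0 ≤ h ∧ x < h + (∫ y, φ y ∂(μ : Measure X) - P) ∧
      ∃ p : X → ℕ, Measurable p ∧ (range p).Finite ∧ ∀ᶠ n : ℕ in atTop, ENNReal.ofReal h ≤
        ENNReal.ofReal ((n : ℝ)⁻¹) *
          partitionEntropy (μ : Measure X) fun x => fun i : Fin n => p (T^[i] x) := by
  obtain ⟨hinv, hi, h, h0, hxh, rfl | hent⟩ := exists_lt_entropy_of_lt_freeEnergy hφ hC hx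
  · exact ⟨hinv, hi, 0, le_rfl, hxh, fun _ => 0, measurable_const,
      (finite_singleton 0).subset (by rintro _ ⟨_, rfl⟩; rfl), by simp⟩
  rw [entropy] at hent
  simp only [lt_iSup_iff] at hent
  obtain ⟨p, ⟨hp1, hp2⟩, hp3⟩ := hent
  exact ⟨hinv, hi, h, h0, hxh, p, hp1, hp2, (eventually_lt_of_lt_liminf hp3).mono fun _ h => h.le⟩

lemma Invariant.mix (hT : Measurable T) {μ ν : ProbabilityMeasure X}
    (hμ : Invariant T (μ : Measure X)) (hν : Invariant T (ν : Measure X)) (t : ℝ) (h0 : 0 ≤ t)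
    (h1 : t ≤ 1) : Invariant T (mix t h0 h1 μ ν : Measure X) := by
  change Measure.map T (ENNReal.ofReal t • (μ : Measure X) + ENNReal.ofReal (1 - t) •
    (ν : Measure X)) = _
  rw [Measure.map_add _ _ hT, Measure.map_smul, Measure.map_smul, hμ, hν]
  rfl

lemma mul_partitionEntropy_add_le_mix {α : Type*} [Countable α] [MeasurableSpace α]
    [MeasurableSingletonClass α] (μ ν : ProbabilityMeasure X) (t : ℝ) (h0 : 0 ≤ t) (h1 : t ≤ 1)
    (g : X → α) :
    ENNReal.ofReal t * partitionEntropy (μ : Measure X) g +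
      ENNReal.ofReal (1 - t) * partitionEntropy (ν : Measure X) g ≤
        partitionEntropy (mix t h0 h1 μ ν : Measure X) g := by
  have hp : ∀ i : Bool, IsProbabilityMeasure (bif i then (μ : Measure X) else ν) := fun i => by
    cases i <;> rw [cond] <;> infer_instance
  have := sum_mul_partitionEntropy_le Finset.univ
    (fun i : Bool => bif i then ENNReal.ofReal t else ENNReal.ofReal (1 - t))
    (by simp only [Fintype.sum_bool, cond_true, cond_false]
        rw [← ENNReal.ofReal_add h0 (by linarith)]; simp)
    (fun i => bif i then (μ : Measure X) else ν) g
  simp only [Fintype.sum_bool, cond_true, cond_false] at this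
  exact this

lemma freeEnergy_mix {C P : ℝ} (hT : Measurable T) (hφ : Measurable φ) (hC : ∀ x, φ x ≤ C)
    (μ ν : ProbabilityMeasure X) (t : ℝ) (h0 : 0 ≤ t) (h1 : t ≤ 1) (a b : ℝ)
    (ha : (a : EReal) < freeEnergy T φ P μ) (hb : (b : EReal) < freeEnergy T φ P ν) :
    ((t * a + (1 - t) * b : ℝ) : EReal) ≤ freeEnergy T φ P (mix t h0 h1 μ ν) := by
  obtain ⟨hinv₁, hi₁, h₁, h₁0, hle₁, p, hp, hpf, hpn⟩ :=
    exists_partition_of_lt_freeEnergy hφ hC ha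
  obtain ⟨hinv₂, hi₂, h₂, h₂0, hle₂, q, hq, hqf, hqn⟩ :=
    exists_partition_of_lt_freeEnergy hφ hC hb
  obtain ⟨hi, hie⟩ := integral_mix t h0 h1 μ ν hi₁ hi₂
  have h1t : 0 ≤ 1 - t := by linarith
  set r : X → ℕ := fun x => Nat.pair (p x) (q x) with hr
  have hrm : Measurable r := (measurable_of_countable fun z : ℕ × ℕ => Nat.pair z.1 z.2).comp
    (hp.prodMk hq)
  have hrf : (range r).Finite := by
    refine ((hpf.prod hqf).image fun z : ℕ × ℕ => Nat.pair z.1 z.2).subset ?_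
    rintro _ ⟨x, rfl⟩
    exact ⟨(p x, q x), ⟨⟨x, rfl⟩, ⟨x, rfl⟩⟩, rfl⟩
  have hent : ENNReal.ofReal (t * h₁ + (1 - t) * h₂) ≤
      entropy T (mix t h0 h1 μ ν : Measure X) := by
    refine le_trans ?_ (le_iSup₂_of_le r ⟨hrm, hrf⟩ le_rfl)
    refine le_liminf_of_le (by isBoundedDefault) ?_
    filter_upwards [hpn, hqn] with n hn1 hn2
    have hrn : Measurable fun x => fun i : Fin n => r (T^[i] x) :=
      measurable_pi_lambda _ fun i => hrm.comp (hT.iterate i)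
    have e1 : partitionEntropy (μ : Measure X) (fun x => fun i : Fin n => p (T^[i] x)) ≤
        partitionEntropy (μ : Measure X) fun x => fun i : Fin n => r (T^[i] x) := by
      have := partitionEntropy_comp_le (μ : Measure X) hrn
        fun s : Fin n → ℕ => fun i => (Nat.unpair (s i)).1
      simpa [hr] using this
    have e2 : partitionEntropy (ν : Measure X) (fun x => fun i : Fin n => q (T^[i] x)) ≤
        partitionEntropy (ν : Measure X) fun x => fun i : Fin n => r (T^[i] x) := by
      have := partitionEntropy_comp_le (ν : Measure X) hrn
        fun s : Fin n → ℕ => fun i => (Nat.unpair (s i)).2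
      simpa [hr] using this
    calc ENNReal.ofReal (t * h₁ + (1 - t) * h₂)
        = ENNReal.ofReal t * ENNReal.ofReal h₁ +
            ENNReal.ofReal (1 - t) * ENNReal.ofReal h₂ := by
          rw [ENNReal.ofReal_add (by positivity) (by positivity), ENNReal.ofReal_mul h0,
            ENNReal.ofReal_mul h1t]
      _ ≤ ENNReal.ofReal t * (ENNReal.ofReal ((n : ℝ)⁻¹) * partitionEntropy (μ : Measure X)
            fun x => fun i : Fin n => r (T^[i] x)) + ENNReal.ofReal (1 - t) *
            (ENNReal.ofReal ((n : ℝ)⁻¹) * partitionEntropy (ν : Measure X)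
            fun x => fun i : Fin n => r (T^[i] x)) := by
          gcongr
          · exact hn1.trans (by gcongr)
          · exact hn2.trans (by gcongr)
      _ = ENNReal.ofReal ((n : ℝ)⁻¹) * (ENNReal.ofReal t * partitionEntropy (μ : Measure X)
            (fun x => fun i : Fin n => r (T^[i] x)) + ENNReal.ofReal (1 - t) *
            partitionEntropy (ν : Measure X) fun x => fun i : Fin n => r (T^[i] x)) := by ring
      _ ≤ _ := by
          gcongr
          exact mul_partitionEntropy_add_le_mix μ ν t h0 h1 _
  rw [freeEnergy, if_pos ⟨hinv₁.mix hT hinv₂ t h0 h1, hi.neg.lintegral_lt_top.ne⟩,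
    eintegral_eq_integral hi]
  have h3 : ((t * h₁ + (1 - t) * h₂ : ℝ) : EReal) ≤
      ((entropy T (CMS.mix t h0 h1 μ ν : Measure X) : ℝ≥0∞) : EReal) := by
    refine le_trans ?_ (EReal.coe_ennreal_le_coe_ennreal_iff.2 hent)
    rw [EReal.coe_ennreal_ofReal, max_eq_left (by positivity)]
  refine le_trans ?_ (EReal.sub_le_sub (add_le_add h3 le_rfl) le_rfl)
  rw [← EReal.coe_add, ← EReal.coe_sub, EReal.coe_le_coe_iff, hie]
  nlinarith [mul_le_mul_of_nonneg_left hle₁.le h0, mul_le_mul_of_nonneg_left hle₂.le h1t]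

end Concavity

section Assembly

variable {S : Type*} [TopologicalSpace S] {A : S → S → Prop} [DiscreteTopology S] [Countable S]
  {φ : Space A → ℝ} {μ : Measure (Space A)} [IsProbabilityMeasure μ] {c₀ P : ℝ}

instance {X : Type*} [MeasurableSpace X] [TopologicalSpace X] [OpensMeasurableSpace X] :
    BorelSpace (ProbabilityMeasure X) := ⟨rfl⟩

lemma weightedDistr_compl_le (hprim : FinitelyPrimitive A) (hc₀ : 1 ≤ c₀)
    (hG : IsGibbsWith A φ μ c₀ P) (L : ℝ) (hL : 0 < L) :
    ∃ K : Set (ProbabilityMeasure (Space A)), IsCompact K ∧ ∃ c : ℝ, 0 < c ∧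
      ∀ᶠ n : ℕ in atTop, weightedDistr (shift A) φ n (perSet (shift A) n) Kᶜ ≤
        ENNReal.ofReal (c * Real.exp (-L * n)) := by
  obtain ⟨K, hK, D, hD, hn⟩ := exists_compact_theta_compl_le hc₀ hG hL
  obtain ⟨C, -, hC, n₀, hn₀, hcmp⟩ := exists_weightedDistr_comparison hprim hc₀ hG
  refine ⟨K, hK, (C * D).toReal + 1, by positivity, ?_⟩
  filter_upwards [eventually_ge_atTop n₀] with n hn1
  refine ((hcmp n hn1 _ hK.isClosed.isOpen_compl.measurableSet).1).trans ?_
  calc C * theta μ n Kᶜ ≤ C * (D * ENNReal.ofReal (Real.exp (-(L * n)))) := by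
        gcongr; exact hn n (by omega)
    _ = ENNReal.ofReal ((C * D).toReal * Real.exp (-L * n)) := by
        rw [ENNReal.ofReal_mul (by positivity), ENNReal.ofReal_toReal (by finiteness), mul_assoc,
          neg_mul]
    _ ≤ _ := by gcongr; linarith

lemma le_weightedDistr (hprim : FinitelyPrimitive A) (hφ : Measurable φ) (hc₀ : 1 ≤ c₀)
    (hG : IsGibbsWith A φ μ c₀ P) (G : Set (ProbabilityMeasure (Space A))) (hGo : IsOpen G)
    (ν : ProbabilityMeasure (Space A)) (hν : ν ∈ G) (β : ℝ)
    (hβ : (β : EReal) < freeEnergy (shift A) φ P ν) :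
    ∃ c : ℝ, 0 < c ∧ ∀ᶠ n : ℕ in atTop, ENNReal.ofReal (c * Real.exp (β * n)) ≤
      weightedDistr (shift A) φ n (perSet (shift A) n) G := by
  obtain ⟨C, hC0, hC, n₀, hn₀, hcmp⟩ := exists_weightedDistr_comparison hprim hc₀ hG
  have hC' : 0 < C.toReal := ENNReal.toReal_pos hC0 hC
  refine ⟨C.toReal⁻¹, inv_pos.2 hC', ?_⟩
  filter_upwards [eventually_ge_atTop n₀, eventually_exp_le_theta hprim hφ hc₀ hG hGo hν hβ]
    with n hn1 hn2
  rw [ENNReal.ofReal_mul (by positivity), ENNReal.ofReal_inv_of_pos hC', ENNReal.ofReal_toReal hC,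
    ENNReal.inv_mul_le_iff hC0 hC]
  exact hn2.trans (hcmp n hn1 _ hGo.measurableSet).2

lemma exists_nhds_weightedDistr_le (hprim : FinitelyPrimitive A) (hφ : Measurable φ) (hc₀ : 1 ≤ c₀)
    (hG : IsGibbsWith A φ μ c₀ P) (G : Set (ProbabilityMeasure (Space A))) (hGo : IsOpen G)
    (ν : ProbabilityMeasure (Space A)) (hν : ν ∈ G) (β : ℝ)
    (hβ : ∀ ξ ∈ G, freeEnergy (shift A) φ P ξ ≤ β) :
    ∃ U : Set (ProbabilityMeasure (Space A)), IsOpen U ∧ ν ∈ U ∧ ∃ c : ℝ, 0 < c ∧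
      ∀ᶠ n : ℕ in atTop, weightedDistr (shift A) φ n (perSet (shift A) n) U ≤
        ENNReal.ofReal (c * Real.exp (β * n)) := by
  obtain ⟨U, hU, hνU, N, D, n₁, hn₁⟩ := exists_nhds_theta_le hprim hφ hc₀ hG hGo hν
  obtain ⟨C, hC0, hC, n₀, hn₀, hcmp⟩ := exists_weightedDistr_comparison hprim hc₀ hG
  have hC' : 0 < C.toReal := ENNReal.toReal_pos hC0 hC
  refine ⟨U, hU, hνU, C.toReal * Real.exp (β * N + D), by positivity, ?_⟩
  filter_upwards [eventually_ge_atTop n₀, eventually_ge_atTop n₁] with n hn1 hn2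
  refine ((hcmp n hn1 _ hU.measurableSet).1).trans ?_
  calc C * theta μ n U ≤ C * ENNReal.ofReal (Real.exp (β * (n + N) + D)) := by
        gcongr; exact hn₁ n hn2 β hβ
    _ = _ := by
        rw [mul_assoc, ENNReal.ofReal_mul hC'.le, ENNReal.ofReal_toReal hC, ← Real.exp_add]
        congr 3; ring

lemma freeEnergy_nonpos (hprim : FinitelyPrimitive A) (hφ : Measurable φ) (hc₀ : 1 ≤ c₀)
    (hG : IsGibbsWith A φ μ c₀ P) (ν : ProbabilityMeasure (Space A)) :
    freeEnergy (shift A) φ P ν ≤ 0 := by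
  by_contra! h
  obtain ⟨β, hβ0, hβ⟩ := EReal.lt_iff_exists_real_btwn.1 h
  have hβ0 : 0 < β := by exact_mod_cast hβ0
  obtain ⟨n, hn1, hn2⟩ := ((eventually_exp_le_theta hprim hφ hc₀ hG isOpen_univ (mem_univ ν)
    hβ).and (eventually_gt_atTop 0)).exists
  have h1 := hn1.trans (theta_le_one μ hn2 univ)
  rw [ENNReal.ofReal_le_one, Real.exp_le_one_iff] at h1
  have : (0 : ℝ) < n := by exact_mod_cast hn2
  nlinarith [mul_pos hβ0 this]

end Assembly

end CMS

open CMS in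
/-- **Theorem B (periodic points).** For a finitely primitive countable Markov shift with a
Gibbs state for a measurable potential `φ`, the distributions `η_n` of weighted periodic
points are exponentially tight and satisfy the LDP with the convex good rate function of
Theorem A. -/
theorem theoremB_periodic {S : Type*} [Countable S] [TopologicalSpace S] [DiscreteTopology S]
    (A : S → S → Prop) (hA : NoZeroRowCol A) (hprim : FinitelyPrimitive A)
    (φ : Space A → ℝ) (hφ : Measurable φ)
    (μφ : ProbabilityMeasure (Space A)) (c₀ P : ℝ) (hc₀ : 1 ≤ c₀)
    (hGibbs : IsGibbsWith A φ (μφ : Measure (Space A)) c₀ P) :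
    ExpTight (fun n => weightedDistr (shift A) φ n (perSet (shift A) n)) ∧
    HasLDP (fun n => weightedDistr (shift A) φ n (perSet (shift A) n))
      (rateOf (freeEnergy (shift A) φ P)) ∧
    GoodRate (rateOf (freeEnergy (shift A) φ P)) ∧
    ConvexRate (rateOf (freeEnergy (shift A) φ P)) := by
  have htight := weightedDistr_compl_le hprim hc₀ hGibbs
  have hlow := le_weightedDistr hprim hφ hc₀ hGibbs
  exact ⟨expTight_of_le htight,
    hasLDP_of_le htight hlow (exists_nhds_weightedDistr_le hprim hφ hc₀ hGibbs),
    goodRate_of_le htight hlow,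
    convexRate_of_concave (freeEnergy_nonpos hprim hφ hc₀ hGibbs)
      (freeEnergy_mix measurable_shift hφ (phi_le hc₀ hGibbs))⟩
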